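/- Let ṅ, n̈ ≥ 1, let ṗ, p̈ ∈ [1/2,∞], ṗ₁, p̈₁, ṗ₂, p̈₂ ∈ [1,∞], and ȧ, ä, ȧ₁, ä₁, ȧ₂, ä₂ ∈ [0,∞) satisfy 1/ṗ = 1/ṗ₁ + 1/ṗ₂, 1/p̈ = 1/p̈₁ + 1/p̈₂, ȧ/ṗ = ȧ₁/ṗ₁ + ȧ₂/ṗ₂, and ä/p̈ = ä₁/p̈₁ + ä₂/p̈₂. Set p* := min{1, ṗ, p̈}. If s > max{0, (ṅ+n̈)(1/p* − 1)} or s ∈ 2ℕ, then there exists C > 0, depending only on the stated parameters, such that for all f, g ∈ 𝒮(ℝ^{ṅ+n̈}): ‖J^s(fg)‖_{L^{p̈}_{ä} L^{ṗ}_{ȧ}} ≤ C ( ‖J^s f‖_{L^{p̈₁}_{ä₁} L^{ṗ₁}_{ȧ₁}} ‖g‖_{L^{p̈₂}_{ä₂} L^{ṗ₂}_{ȧ₂}} + ‖f‖_{L^{p̈₁}_{ä₁} L^{ṗ₁}_{ȧ₁}} ‖J^s g‖_{L^{p̈₂}_{ä₂} L^{ṗ₂}_{ȧ₂}} ), where J^s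 is the operator on ℝ^{ṅ+n̈}. -/

import Mathlib

open MeasureTheory Real Complex
open scoped ENNReal NNReal RealInnerProductSpace

noncomputable section

abbrev Eu (n : ℕ) := EuclideanSpace ℝ (Fin n)

/-- The polynomial weight `⟨x⟩^a = (1+|x|²)^{a/2}` as an `ℝ≥0∞`-valued function. -/
def jweight {n : ℕ} (a : ℝ) (x : Eu n) : ℝ≥0∞ :=
  ENNReal.ofReal ((1 + ‖x‖ ^ 2) ^ (a / 2))

/-- Weighted Lebesgue (quasi-)norm `‖f‖_{L^p_{⟨x⟩^a}}`; for `p = ∞` the essential sup norm. -/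
def wNorm {n : ℕ} {F : Type*} [NormedAddCommGroup F] (p : ℝ≥0∞) (a : ℝ)
    (f : Eu n → F) : ℝ≥0∞ :=
  if p = ∞ then essSup (fun x => (‖f x‖₊ : ℝ≥0∞)) volume
  else (∫⁻ x, (‖f x‖₊ : ℝ≥0∞) ^ p.toReal * jweight a x) ^ (1 / p.toReal)

/-- The Fourier transform `f̂(ξ) = ∫ f(x) e^{-i x·ξ} dx`. -/
def FT {n : ℕ} (f : Eu n → ℂ) (ξ : Eu n) : ℂ :=
  ∫ x, f x * Complex.exp (-(Complex.I * ((⟪x, ξ⟫ : ℝ) : ℂ)))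

/-- The inhomogeneous fractional derivative (Bessel potential) `J^s`. -/
def Js {n : ℕ} (s : ℝ) (f : Eu n → ℂ) (x : Eu n) : ℂ :=
  ((((2 * Real.pi) ^ n)⁻¹ : ℝ) : ℂ) *
    ∫ ξ, (((1 + ‖ξ‖ ^ 2) ^ (s / 2) : ℝ) : ℂ) * FT f ξ *
      Complex.exp (Complex.I * ((⟪x, ξ⟫ : ℝ) : ℂ))

/-- The weighted mixed norm `‖F‖_{L^{Q}_{B} L^{q}_{b}}`: the inner exponent/weight pair
`(q, b)` is applied in the first variable `ẋ ∈ ℝ^{ṅ}`, and the outer pair `(Q, B)`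
in the second variable `ẍ ∈ ℝ^{n̈}`. -/
def mixedNorm {m k : ℕ} (Q : ℝ≥0∞) (B : ℝ) (q : ℝ≥0∞) (b : ℝ)
    (f : Eu m × Eu k → ℂ) : ℝ≥0∞ :=
  let g : Eu k → ℝ≥0∞ := fun y =>
    if q = ∞ then essSup (fun x => (‖f (x, y)‖₊ : ℝ≥0∞)) volume
    else (∫⁻ x, (‖f (x, y)‖₊ : ℝ≥0∞) ^ q.toReal * jweight b x) ^ (1 / q.toReal)
  if Q = ∞ then essSup g volume
  else (∫⁻ y, g y ^ Q.toReal * jweight B y) ^ (1 / Q.toReal)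

/-- The Fourier transform on `ℝ^{ṅ} × ℝ^{n̈}`. -/
def FT2 {m k : ℕ} (f : Eu m × Eu k → ℂ) (ξ : Eu m × Eu k) : ℂ :=
  ∫ x : Eu m × Eu k,
    f x * Complex.exp (-(Complex.I * ((⟪x.1, ξ.1⟫ + ⟪x.2, ξ.2⟫ : ℝ) : ℂ)))

/-- The Bessel potential `J^s` on `ℝ^{ṅ+n̈}`, realized on `ℝ^{ṅ} × ℝ^{n̈}` with the
symbol `(1+|ξ̇|²+|ξ̈|²)^{s/2}`. -/
def Js2 {m k : ℕ} (s : ℝ) (f : Eu m × Eu k → ℂ) (x : Eu m × Eu k) : ℂ :=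
  ((((2 * Real.pi) ^ (m + k))⁻¹ : ℝ) : ℂ) *
    ∫ ξ : Eu m × Eu k, (((1 + ‖ξ.1‖ ^ 2 + ‖ξ.2‖ ^ 2) ^ (s / 2) : ℝ) : ℂ) * FT2 f ξ *
      Complex.exp (Complex.I * ((⟪x.1, ξ.1⟫ + ⟪x.2, ξ.2⟫ : ℝ) : ℂ))

namespace KP
open scoped ContDiff

variable {m k : ℕ}

instance instHaarE : (volume : Measure (Eu m × Eu k)).IsAddHaarMeasure :=
  inferInstanceAs ((volume.prod volume : Measure (Eu m × Eu k)).IsAddHaarMeasure)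

instance instNegE : (volume : Measure (Eu m × Eu k)).IsNegInvariant :=
  Measure.IsAddHaarMeasure.isNegInvariant_of_regular _

lemma finrankE : Module.finrank ℝ (Eu m × Eu k) = m + k := by
  simp [Module.finrank_prod]

/-- bilinear pairing -/
def ip (x ξ : Eu m × Eu k) : ℝ := ⟪x.1, ξ.1⟫ + ⟪x.2, ξ.2⟫

/-- character -/
def ee (x ξ : Eu m × Eu k) : ℂ := Complex.exp (Complex.I * ((ip x ξ : ℝ) : ℂ))

/-- unnormalised inverse Fourier integral -/
def IF (v : Eu m × Eu k → ℂ) (x : Eu m × Eu k) : ℂ := ∫ ξ, v ξ * ee x ξ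

/-- the normalising constant -/
def cn (m k : ℕ) : ℝ := ((2 * Real.pi) ^ (m + k))⁻¹

lemma cn_pos : 0 < cn m k := by unfold cn; positivity

lemma ip_comm (x y : Eu m × Eu k) : ip x y = ip y x := by
  simp [ip, real_inner_comm]
lemma ip_add_right (x y z : Eu m × Eu k) : ip x (y + z) = ip x y + ip x z := by
  simp [ip, inner_add_right]; ring
lemma ip_neg_left (x y : Eu m × Eu k) : ip (-x) y = - ip x y := by
  simp [ip]; ring
lemma ip_neg_right (x y : Eu m × Eu k) : ip x (-y) = - ip x y := by
  simp [ip]; ring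
lemma ip_sub_left (x y z : Eu m × Eu k) : ip (x - y) z = ip x z - ip y z := by
  simp [ip, inner_sub_left]; ring
lemma ip_smul_left (r : ℝ) (x y : Eu m × Eu k) : ip (r • x) y = r * ip x y := by
  simp [ip, inner_smul_left]; ring
lemma ip_smul_right (r : ℝ) (x y : Eu m × Eu k) : ip x (r • y) = r * ip x y := by
  simp [ip, inner_smul_right]; ring
lemma continuous_ip : Continuous (fun p : (Eu m × Eu k) × (Eu m × Eu k) => ip p.1 p.2) := by
  unfold ip; fun_prop
@[fun_prop]
lemma continuous_ip' {X : Type*} [TopologicalSpace X] {f g : X → Eu m × Eu k}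
    (hf : Continuous f) (hg : Continuous g) : Continuous (fun x => ip (f x) (g x)) :=
  continuous_ip.comp (hf.prodMk hg)
@[fun_prop]
lemma continuous_ee {X : Type*} [TopologicalSpace X] {f g : X → Eu m × Eu k}
    (hf : Continuous f) (hg : Continuous g) : Continuous (fun x => ee (f x) (g x)) := by
  unfold ee; fun_prop
@[fun_prop]
lemma measurable_ee {X : Type*} [MeasurableSpace X] {f g : X → Eu m × Eu k}
    (hf : Measurable f) (hg : Measurable g) : Measurable (fun x => ee (f x) (g x)) := by
  have : Continuous (fun p : (Eu m × Eu k) × (Eu m × Eu k) => ee p.1 p.2) := by fun_prop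
  exact Continuous.measurable2 this hf hg
@[simp] lemma norm_ee (x y : Eu m × Eu k) : ‖ee x y‖ = 1 := by
  unfold ee; rw [mul_comm]; exact Complex.norm_exp_ofReal_mul_I _
lemma ee_add_right (x y z : Eu m × Eu k) : ee x (y + z) = ee x y * ee x z := by
  simp [ee, ip_add_right, mul_add, Complex.exp_add]
lemma ee_neg_right (x y : Eu m × Eu k) : ee x (-y) = ee (-x) y := by
  simp [ee, ip_neg_left, ip_neg_right]
lemma ee_sub_left (x y z : Eu m × Eu k) : ee (x - y) z = ee x z * ee (-y) z := by
  simp [ee, ip_sub_left, ip_neg_left, ← Complex.exp_add]; ring_nf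
lemma ee_comm (x y : Eu m × Eu k) : ee x y = ee y x := by simp [ee, ip_comm x y]
@[simp] lemma ee_zero_right (x : Eu m × Eu k) : ee x 0 = 1 := by simp [ee, ip]
lemma FT2_eq (f : Eu m × Eu k → ℂ) (ξ) : FT2 f ξ = ∫ x, f x * ee (-x) ξ := by
  simp only [FT2, ee, ip_neg_left, Complex.ofReal_neg, mul_neg]; rfl
lemma FT2_eq_IF (f : Eu m × Eu k → ℂ) (ξ) : FT2 f ξ = IF f (-ξ) := by
  rw [FT2_eq, IF]; congr 1; ext x; rw [ee_comm, ee_neg_right]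
/-- japanese bracket -/
def jb (ξ : Eu m × Eu k) : ℝ := 1 + ‖ξ.1‖ ^ 2 + ‖ξ.2‖ ^ 2
lemma Js2_eq (s : ℝ) (f : Eu m × Eu k → ℂ) (x) :
    Js2 s f x = IF (fun ξ => ((jb ξ ^ (s / 2) : ℝ) : ℂ) * ((cn m k : ℝ) * FT2 f ξ)) x := by
  simp only [Js2, IF, ← integral_const_mul]
  congr 1; ext ξ
  simp [ee, ip, jb, cn]; ring

/-- The linear equivalence `E ≃L V`. -/
abbrev VV (m k : ℕ) := WithLp 2 (Eu m × Eu k)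
def eqV : (Eu m × Eu k) ≃L[ℝ] VV m k := (WithLp.prodContinuousLinearEquiv 2 ℝ (Eu m) (Eu k)).symm

lemma inner_eqV (x y : Eu m × Eu k) : ⟪(eqV x : VV m k), eqV y⟫ = ip x y := by
  simp [eqV, ip, WithLp.prod_inner_apply]

lemma mp_eqV : MeasurePreserving (fun x : Eu m × Eu k => (eqV x : VV m k)) :=
  WithLp.volume_preserving_toLp (Eu m) (Eu k)

lemma integral_eqV (h : VV m k → ℂ) : ∫ v, h v = ∫ x : Eu m × Eu k, h (eqV x) :=
  (mp_eqV.integral_comp (eqV.toHomeomorph.measurableEmbedding) h).symm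

open FourierTransform in
lemma schwartz_FT (f : SchwartzMap (Eu m × Eu k) ℂ) :
    ∃ F : SchwartzMap (Eu m × Eu k) ℂ, (∀ ξ, F ξ = FT2 f ξ) ∧
      ∀ x, f x = (cn m k : ℂ) * IF F x := by
  let f' : SchwartzMap (VV m k) ℂ := SchwartzMap.compCLMOfContinuousLinearEquiv ℂ eqV.symm f
  have hf' : ∀ x, f' (eqV x) = f x := fun x => by simp [f']
  have h2pi : (2 * Real.pi)⁻¹ ≠ 0 := by positivity
  let e2 : (Eu m × Eu k) ≃L[ℝ] VV m k :=
    (ContinuousLinearEquiv.smulLeft (Units.mk0 ((2 * Real.pi)⁻¹) h2pi)).trans eqV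
  have he2 : ∀ x, e2 x = eqV ((2 * Real.pi)⁻¹ • x) := fun x => rfl
  let F : SchwartzMap (Eu m × Eu k) ℂ := SchwartzMap.compCLMOfContinuousLinearEquiv ℂ e2 (𝓕 f')
  have hF : ∀ ξ, F ξ = (𝓕 (f' : VV m k → ℂ)) (eqV ((2 * Real.pi)⁻¹ • ξ)) := fun ξ => rfl
  refine ⟨F, fun ξ => ?_, fun x => ?_⟩
  · rw [hF, Real.fourier_eq', integral_eqV, FT2_eq]
    congr 1; ext x
    rw [inner_eqV, hf', ip_smul_right, smul_eq_mul, mul_comm, ee, ip_neg_left]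
    congr 2
    have : (Real.pi : ℂ) ≠ 0 := by exact_mod_cast Real.pi_ne_zero
    push_cast; field_simp
  · have h1 : (f' : VV m k → ℂ) = 𝓕⁻ (𝓕 (f' : VV m k → ℂ)) := by
      rw [← SchwartzMap.fourier_coe, ← SchwartzMap.fourierInv_coe]
      simp
    rw [← hf', h1, Real.fourierInv_eq', integral_eqV, IF]
    simp only [hF]
    have h3 := Measure.integral_comp_smul (volume : Measure (Eu m × Eu k))
      (fun v => Complex.exp (((2 * Real.pi * ip v x : ℝ) : ℂ) * Complex.I) *
        𝓕 (f' : VV m k → ℂ) (eqV v)) ((2 * Real.pi)⁻¹)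
    rw [finrankE] at h3
    have h4 : ∀ ξ : Eu m × Eu k, 𝓕 (f' : VV m k → ℂ) (eqV ((2 * Real.pi)⁻¹ • ξ)) * ee x ξ =
      Complex.exp (((2 * Real.pi * ip ((2 * Real.pi)⁻¹ • ξ) x : ℝ) : ℂ) * Complex.I) *
        𝓕 (f' : VV m k → ℂ) (eqV ((2 * Real.pi)⁻¹ • ξ)) := by
      intro ξ
      rw [mul_comm, ip_smul_left, ee]
      congr 2
      have : (Real.pi : ℂ) ≠ 0 := by exact_mod_cast Real.pi_ne_zero
      rw [ip_comm x ξ]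
      push_cast; field_simp
    simp_rw [h4, h3, inner_eqV, smul_eq_mul]
    rw [abs_of_pos (by positivity), cn, Complex.real_smul, ← mul_assoc, ← Complex.ofReal_mul]
    rw [show ((2 * Real.pi) ^ (m + k))⁻¹ * (((2 * Real.pi)⁻¹ ^ (m + k))⁻¹) = 1 by
      rw [inv_pow, inv_inv]; exact inv_mul_cancel₀ (by positivity)]
    simp

lemma schwartz_IF (b : SchwartzMap (Eu m × Eu k) ℂ) :
    ∃ Ψ : SchwartzMap (Eu m × Eu k) ℂ, (∀ y, Ψ y = (cn m k : ℂ) * IF b y) ∧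
      ∀ ξ, FT2 Ψ ξ = b ξ := by
  obtain ⟨F, h1, h2⟩ := schwartz_FT b
  refine ⟨(cn m k : ℂ) • SchwartzMap.compCLMOfContinuousLinearEquiv ℂ
    (ContinuousLinearEquiv.neg ℝ) F, fun y => ?_, fun ξ => ?_⟩
  · simp [h1, FT2_eq_IF]
  · rw [h2, FT2_eq, IF, ← integral_const_mul, ← integral_neg_eq_self]
    congr 1; ext x
    simp [ee_comm x ξ, mul_assoc]

lemma ipL_aux : ∃ L : (Eu m × Eu k) →L[ℝ] (Eu m × Eu k) →L[ℝ] ℝ, ∀ x y, L x y = ip x y := by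
  refine ⟨(((innerSL ℝ).comp (ContinuousLinearMap.fst ℝ (Eu m) (Eu k))).flip.comp
      (ContinuousLinearMap.fst ℝ (Eu m) (Eu k))).flip +
    (((innerSL ℝ).comp (ContinuousLinearMap.snd ℝ (Eu m) (Eu k))).flip.comp
      (ContinuousLinearMap.snd ℝ (Eu m) (Eu k))).flip, fun x y => ?_⟩
  simp [ip]

lemma norm_sq_le_ip (x : Eu m × Eu k) : ‖x‖ ^ 2 ≤ ip x x := by
  simp only [ip, real_inner_self_eq_norm_sq, Prod.norm_def]
  rcases max_cases ‖x.1‖ ‖x.2‖ with h | h <;> rw [h.1] <;> nlinarith [sq_nonneg ‖x.1‖, sq_nonneg ‖x.2‖]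

/-- Decay of inverse Fourier integrals. -/
lemma decay_IF (N : ℕ) (a : Eu m × Eu k → ℂ) (ha : ContDiff ℝ ∞ a) (hc : HasCompactSupport a)
    (y : Eu m × Eu k) :
    ‖y‖ ^ N * ‖IF a y‖ ≤ (2 * Real.pi) ^ N * 2 ^ N * ∑ p ∈ Finset.range (N + 1),
      ∫ v, ‖iteratedFDeriv ℝ p a v‖ := by
  obtain ⟨L, hL⟩ := ipL_aux (m := m) (k := k)
  set w : Eu m × Eu k := -((2 * Real.pi)⁻¹ • y) with hw
  have hint : ∀ (k' n : ℕ), (k' : ℕ∞) ≤ (⊤ : ℕ∞) → (n : ℕ∞) ≤ (⊤ : ℕ∞) →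
      Integrable (fun v ↦ ‖v‖ ^ k' * ‖iteratedFDeriv ℝ n a v‖) := by
    intro k' n _ _
    refine Continuous.integrable_of_hasCompactSupport ?_ ?_
    · have := ha.continuous_iteratedFDeriv (m := n) (by exact_mod_cast le_top)
      fun_prop
    · exact (hc.iteratedFDeriv n).norm.mul_left
  have key := VectorFourier.pow_mul_norm_iteratedFDeriv_fourierIntegral_le (μ := volume) L
    (K := ⊤) (N := ⊤) ha hint (k := 0) (n := N) le_top le_top w w
  have hFI : VectorFourier.fourierIntegral Real.fourierChar volume L.toLinearMap₁₂ a w = IF a y := by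
    simp only [VectorFourier.fourierIntegral, IF]
    congr 1; ext v
    have : ((Real.fourierChar (-(L.toLinearMap₁₂ v w)) : Circle) : ℂ) = ee y v := by
      rw [Real.fourierChar_apply]
      rw [show L.toLinearMap₁₂ v w = ip v w from hL v w, hw, ip_neg_right, ip_smul_right, ee,
        ip_comm v y]
      congr 1
      have : (Real.pi : ℂ) ≠ 0 := by exact_mod_cast Real.pi_ne_zero
      push_cast; field_simp
    rw [Circle.smul_def, this, smul_eq_mul, mul_comm]
  rw [norm_iteratedFDeriv_zero, hFI, hL] at key
  simp only [pow_zero, mul_one, zero_add, Finset.range_one, Finset.singleton_product,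
    Finset.sum_map, Function.Embedding.coeFn_mk, one_mul, CharP.cast_eq_zero, mul_zero] at key
  have hwn : ‖y‖ = (2 * Real.pi) * ‖w‖ := by
    rw [hw, norm_neg, norm_smul, Real.norm_of_nonneg (by positivity)]; field_simp
  rcases eq_or_ne N 0 with rfl | hN
  · simpa using key
  by_cases hw0 : ‖w‖ = 0
  · rw [hwn, hw0, mul_zero, zero_pow hN, zero_mul]
    positivity
  have hwp : 0 < ‖w‖ := lt_of_le_of_ne (norm_nonneg _) (Ne.symm hw0)
  have h5 : ‖w‖ ^ N * (‖w‖ ^ N * ‖IF a y‖) ≤ ‖w‖ ^ N * (2 ^ N * ∑ p ∈ Finset.range (N + 1),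
      ∫ v, ‖iteratedFDeriv ℝ p a v‖) := by
    calc _ = (‖w‖ ^ 2) ^ N * ‖IF a y‖ := by ring
      _ ≤ |ip w w| ^ N * ‖IF a y‖ := by
        gcongr; exact (norm_sq_le_ip w).trans (le_abs_self _)
      _ ≤ _ := by rw [← mul_assoc]; exact key
  have h6 := le_of_mul_le_mul_left h5 (by positivity)
  rw [hwn, mul_pow, mul_assoc, mul_assoc]
  gcongr

/-- Uniform kernel estimate for smooth families. -/
lemma kernel_family (A : ℝ × (Eu m × Eu k) → ℂ) (hA : ContDiff ℝ ∞ A) (ρ : ℝ)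
    (hρ : ∀ ε ξ, ρ < ‖ξ‖ → A (ε, ξ) = 0) (N : ℕ) :
    ∃ C : ℝ, 0 ≤ C ∧ ∀ ε ∈ Set.Icc (0 : ℝ) 1, ∀ y,
      ‖IF (fun ξ => A (ε, ξ)) y‖ ≤ C * ((1 + ‖y‖) ^ N)⁻¹ := by
  have hcd : ∀ ε, ContDiff ℝ ∞ (fun ξ => A (ε, ξ)) := fun ε =>
    hA.comp (contDiff_const.prodMk contDiff_id)
  have hcs : ∀ ε, tsupport (fun ξ => A (ε, ξ)) ⊆ Metric.closedBall 0 ρ := fun ε => by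
    refine closure_minimal (fun ξ h => ?_) Metric.isClosed_closedBall
    by_contra h'
    exact h (hρ ε ξ (by simpa using h'))
  have hcs' : ∀ ε, HasCompactSupport (fun ξ => A (ε, ξ)) := fun ε =>
    (isCompact_closedBall (0 : Eu m × Eu k) ρ).of_isClosed_subset (isClosed_tsupport _) (hcs ε)
  -- bound on derivatives
  have hder : ∀ p : ℕ, ∃ B : ℝ, ∀ ε ∈ Set.Icc (0 : ℝ) 1, ∀ ξ ∈ Metric.closedBall (0 : Eu m × Eu k) ρ,
      ‖iteratedFDeriv ℝ p (fun ξ => A (ε, ξ)) ξ‖ ≤ B := by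
    intro p
    have hcont : Continuous (fun q => ‖iteratedFDeriv ℝ p A q‖) :=
      (hA.continuous_iteratedFDeriv (m := p) (by exact_mod_cast le_top)).norm
    obtain ⟨B, hB⟩ := ((isCompact_Icc (a := (0:ℝ)) (b := 1)).prod
      (isCompact_closedBall (0 : Eu m × Eu k) ρ)).bddAbove_image hcont.continuousOn
    refine ⟨B, fun ε hε ξ hξ => ?_⟩
    have hle : ‖iteratedFDeriv ℝ p A (ε, ξ)‖ ≤ B := hB ⟨(ε, ξ), ⟨hε, hξ⟩, rfl⟩
    refine le_trans ?_ hle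
    have e1 : (fun ξ => A (ε, ξ)) = (fun q => A ((ε, 0) + q)) ∘
        (ContinuousLinearMap.inr ℝ ℝ (Eu m × Eu k)) := by
      ext ξ; simp
    have hA' : ContDiff ℝ ∞ (fun q => A ((ε, 0) + q)) := hA.comp (contDiff_const.add contDiff_id)
    rw [e1, ContinuousLinearMap.iteratedFDeriv_comp_right _ hA' ξ
      (i := p) (by exact_mod_cast le_top), iteratedFDeriv_comp_add_left]
    refine (ContinuousMultilinearMap.norm_compContinuousLinearMap_le _ _).trans ?_
    have : ∏ _i : Fin p, ‖ContinuousLinearMap.inr ℝ ℝ (Eu m × Eu k)‖ ≤ 1 :=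
      Finset.prod_le_one (fun _ _ => norm_nonneg _)
        (fun _ _ => ContinuousLinearMap.norm_inr_le_one _ _ _)
    refine (mul_le_mul_of_nonneg_left this (norm_nonneg _)).trans ?_
    simp
  choose B hB using hder
  have hint : ∀ p, ∀ ε ∈ Set.Icc (0 : ℝ) 1, ∫ v, ‖iteratedFDeriv ℝ p (fun ξ => A (ε, ξ)) v‖ ≤
      |B p| * (volume (Metric.closedBall (0 : Eu m × Eu k) ρ)).toReal := by
    intro p ε hε
    have h0 : ∀ v, v ∉ Metric.closedBall (0 : Eu m × Eu k) ρ →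
        ‖iteratedFDeriv ℝ p (fun ξ => A (ε, ξ)) v‖ = 0 := by
      intro v hv
      rw [norm_eq_zero]
      by_contra h
      exact hv (hcs ε (support_iteratedFDeriv_subset p h))
    rw [← setIntegral_eq_integral_of_forall_compl_eq_zero h0]
    refine (Real.le_norm_self _).trans ?_
    refine norm_setIntegral_le_of_norm_le_const measure_closedBall_lt_top fun v hv => ?_
    rw [norm_norm]
    exact (hB p ε hε v hv).trans (le_abs_self _)
  set D : ℕ → ℝ := fun N => (2 * Real.pi) ^ N * 2 ^ N * ∑ p ∈ Finset.range (N + 1),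
    |B p| * (volume (Metric.closedBall (0 : Eu m × Eu k) ρ)).toReal with hD
  have hD0 : ∀ N, 0 ≤ D N := fun N => by rw [hD]; positivity
  have hdec : ∀ N, ∀ ε ∈ Set.Icc (0 : ℝ) 1, ∀ y, ‖y‖ ^ N * ‖IF (fun ξ => A (ε, ξ)) y‖ ≤ D N := by
    intro N ε hε y
    refine (decay_IF N _ (hcd ε) (hcs' ε) y).trans ?_
    simp only [hD]
    gcongr with p hp
    exact hint p ε hε
  refine ⟨2 ^ N * (D 0 + D N), mul_nonneg (by positivity) (add_nonneg (hD0 _) (hD0 _)), fun ε hε y => ?_⟩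
  rw [← div_eq_mul_inv, le_div_iff₀ (by positivity)]
  have h0 := hdec 0 ε hε y
  have h1 := hdec N ε hε y
  have h2 : (1 + ‖y‖) ^ N ≤ 2 ^ N * (1 + ‖y‖ ^ N) := by
    rcases le_total ‖y‖ 1 with h | h
    · calc (1 + ‖y‖) ^ N ≤ 2 ^ N := by gcongr; linarith
        _ ≤ _ := le_mul_of_one_le_right (by positivity) (by linarith [pow_nonneg (norm_nonneg y) N])
    · calc (1 + ‖y‖) ^ N ≤ (2 * ‖y‖) ^ N := by gcongr; linarith
        _ = 2 ^ N * ‖y‖ ^ N := mul_pow _ _ _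
        _ ≤ _ := by gcongr; linarith
  calc ‖IF (fun ξ => A (ε, ξ)) y‖ * (1 + ‖y‖) ^ N
      ≤ ‖IF (fun ξ => A (ε, ξ)) y‖ * (2 ^ N * (1 + ‖y‖ ^ N)) := by gcongr
    _ = 2 ^ N * (‖y‖ ^ 0 * ‖IF (fun ξ => A (ε, ξ)) y‖ + ‖y‖ ^ N * ‖IF (fun ξ => A (ε, ξ)) y‖) := by
      ring
    _ ≤ _ := by gcongr

end KP
namespace KP

section norms
variable {X Y : Type*} [MeasurableSpace X] [MeasurableSpace Y]

/-- general Lebesgue norm -/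
def V (p : ℝ≥0∞) (ν : Measure X) (F : X → ℝ≥0∞) : ℝ≥0∞ :=
  if p = ∞ then essSup F ν else (∫⁻ x, F x ^ p.toReal ∂ν) ^ (1 / p.toReal)

lemma V_mono_ae {p : ℝ≥0∞} {ν : Measure X} {F G : X → ℝ≥0∞} (h : ∀ᵐ x ∂ν, F x ≤ G x) :
    V p ν F ≤ V p ν G := by
  unfold V
  split_ifs
  · exact essSup_mono_ae h
  · gcongr ?_ ^ _
    apply lintegral_mono_ae
    filter_upwards [h] with x hx
    gcongr

lemma V_mono {p : ℝ≥0∞} {ν : Measure X} {F G : X → ℝ≥0∞} (h : ∀ x, F x ≤ G x) :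
    V p ν F ≤ V p ν G := V_mono_ae (Filter.Eventually.of_forall h)

lemma V_const_mul {p : ℝ≥0∞} (hp : p ≠ 0) {ν : Measure X} {F : X → ℝ≥0∞} (hF : Measurable F)
    (c : ℝ≥0∞) : V p ν (fun x => c * F x) = c * V p ν F := by
  unfold V
  split_ifs with h
  · exact ENNReal.essSup_const_mul
  · have hp' : 0 < p.toReal := ENNReal.toReal_pos hp h
    simp_rw [ENNReal.mul_rpow_of_nonneg _ _ hp'.le]
    rw [lintegral_const_mul _ (hF.pow_const _), ENNReal.mul_rpow_of_nonneg _ _ (by positivity),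
      ← ENNReal.rpow_mul, mul_one_div_cancel hp'.ne', ENNReal.rpow_one]

lemma V_measurable {p : ℝ≥0∞} {ν : Measure X} [SFinite ν] {F : X × Y → ℝ≥0∞}
    (hF : Measurable F) : Measurable (fun y => V p ν (fun x => F (x, y))) := by
  unfold V
  split_ifs with h
  · apply measurable_of_Ioi
    intro c
    have : (fun y => essSup (fun x => F (x, y)) ν) ⁻¹' Set.Ioi c
        = {y | 0 < ν ((fun x => (x, y)) ⁻¹' (F ⁻¹' Set.Ioi c))} := by
      ext y
      simp only [Set.mem_preimage, Set.mem_Ioi, Set.mem_ofPred_eq]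
      rw [← not_iff_not]
      simp only [not_lt, nonpos_iff_eq_zero]
      constructor
      · intro hy
        have := ENNReal.ae_le_essSup (μ := ν) (fun x => F (x, y))
        rw [ae_iff] at this
        refine measure_mono_null ?_ this
        intro x hx
        simp only [Set.mem_preimage, Set.mem_Ioi] at hx
        simp only [Set.mem_ofPred_eq, not_le]
        exact lt_of_le_of_lt hy hx
      · intro hy
        refine essSup_le_of_ae_le c ?_
        rw [Filter.EventuallyLE, ae_iff]
        refine measure_mono_null ?_ hy
        intro x hx
        simpa using hx
    rw [this]
    exact measurableSet_lt measurable_const (measurable_measure_prodMk_right (hF measurableSet_Ioi))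
  · exact ((hF.pow_const _).lintegral_prod_left').pow_const _

lemma V_rpow {p : ℝ≥0∞} (hp : p ≠ 0) {r : ℝ} (hr : 0 < r) {ν : Measure X} {F : X → ℝ≥0∞} :
    V p ν F ^ r = V (p / ENNReal.ofReal r) ν (fun x => F x ^ r) := by
  unfold V
  by_cases h : p = ∞
  · have h2 : p / ENNReal.ofReal r = ∞ := by
      rw [h, ENNReal.top_div]; simp
    rw [if_pos h, if_pos h2]
    have := OrderIso.essSup_apply (f := F) (μ := ν) (ENNReal.orderIsoRpow r hr)
    simpa using this
  · have h2 : p / ENNReal.ofReal r ≠ ∞ := by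
      rw [Ne, ENNReal.div_eq_top]
      push Not
      refine ⟨fun _ => by simpa using hr, fun h' => absurd h' h⟩
    have hp' : 0 < p.toReal := ENNReal.toReal_pos hp h
    rw [if_neg h, if_neg h2]
    rw [ENNReal.toReal_div, ENNReal.toReal_ofReal hr.le]
    simp_rw [← ENNReal.rpow_mul]
    have e1 : r * (p.toReal / r) = p.toReal := by field_simp
    have e2 : 1 / p.toReal * r = 1 / (p.toReal / r) := by field_simp
    rw [e1, e2]

lemma minkowski {q : ℝ≥0∞} (hq : 1 ≤ q) {ν : Measure X} [SigmaFinite ν] {μ : Measure Y} [SFinite μ]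
    {F : X × Y → ℝ≥0∞} (hF : Measurable F) :
    V q ν (fun x => ∫⁻ y, F (x, y) ∂μ) ≤ ∫⁻ y, V q ν (fun x => F (x, y)) ∂μ := by
  by_cases hqt : q = ∞
  · unfold V
    simp only [if_pos hqt]
    refine essSup_le_of_ae_le _ ?_
    have hm := V_measurable (p := ∞) (ν := ν) hF
    simp only [V, if_true] at hm
    have h1 : ∀ᵐ x ∂ν, ∀ᵐ y ∂μ, F (x, y) ≤ essSup (fun x => F (x, y)) ν := by
      rw [Measure.ae_ae_comm]
      · exact Filter.Eventually.of_forall fun y => ENNReal.ae_le_essSup (fun x => F (x, y))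
      · exact measurableSet_le (by fun_prop) (hm.comp measurable_snd)
    filter_upwards [h1] with x hx
    exact lintegral_mono_ae hx
  · by_cases hq1 : q = 1
    · subst hq1
      simp only [V, ENNReal.one_ne_top, if_false, ENNReal.toReal_one, ENNReal.rpow_one, div_one]
      rw [lintegral_lintegral_swap]
      exact hF.aemeasurable
    have hq2 : 1 < q.toReal := by
      have := lt_of_le_of_ne hq (Ne.symm hq1)
      rw [← ENNReal.toReal_one]
      exact (ENNReal.toReal_lt_toReal (by simp) hqt).2 this
    set t := q.toReal with ht
    have hpq : t.HolderConjugate (t.conjExponent) := Real.HolderConjugate.conjExponent hq2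
    set t' := t.conjExponent
    unfold V
    simp only [if_neg hqt, ← ht]
    set Φ : X → ℝ≥0∞ := fun x => ∫⁻ y, F (x, y) ∂μ with hΦ
    have hΦm : Measurable Φ := hF.lintegral_prod_right'
    let T : ℕ → X → ℝ≥0∞ := fun n x => min (Φ x) ((spanningSets ν n).indicator (fun _ => (n : ℝ≥0∞)) x)
    have hTm : ∀ n, Measurable (T n) := fun n =>
      hΦm.min (measurable_const.indicator (measurableSet_spanningSets ν n))
    have hmono : Monotone T := by
      intro a b hab x
      refine min_le_min le_rfl ?_
      refine le_trans (Set.indicator_le_indicator_of_subset (monotone_spanningSets ν hab) (by simp) x) ?_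
      refine Set.indicator_le_indicator ?_
      exact_mod_cast hab
    have hsup : ∀ x, ⨆ n, T n x = Φ x := by
      intro x
      refine le_antisymm (iSup_le fun n => min_le_left _ _) ?_
      refine le_of_forall_lt fun c hc => ?_
      obtain ⟨n1, hn1⟩ := ENNReal.exists_nat_gt (ne_top_of_lt hc)
      have : x ∈ ⋃ i, spanningSets ν i := by rw [iUnion_spanningSets]; trivial
      obtain ⟨n2, hn2⟩ := Set.mem_iUnion.1 this
      refine lt_of_lt_of_le ?_ (le_iSup (fun n => T n x) (max n1 n2))
      refine lt_min hc ?_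
      rw [Set.indicator_of_mem (monotone_spanningSets ν (le_max_right n1 n2) hn2)]
      refine lt_of_lt_of_le hn1 ?_
      exact_mod_cast le_max_left _ _
    have key : ∀ n, (∫⁻ x, T n x ^ t ∂ν) ^ (1 / t) ≤ ∫⁻ y, (∫⁻ x, F (x, y) ^ t ∂ν) ^ (1 / t) ∂μ := by
      intro n
      set R := ∫⁻ y, (∫⁻ x, F (x, y) ^ t ∂ν) ^ (1 / t) ∂μ
      set A := ∫⁻ x, T n x ^ t ∂ν with hA
      have hAfin : A ≠ ∞ := by
        have : A ≤ ∫⁻ x, (spanningSets ν n).indicator (fun _ => (n : ℝ≥0∞) ^ t) x ∂ν := by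
          refine lintegral_mono fun x => ?_
          by_cases hx : x ∈ spanningSets ν n
          · simp only [T, Set.indicator_of_mem hx]; gcongr; exact min_le_right _ _
          · simp only [T, Set.indicator_of_notMem hx]
            simp [ENNReal.zero_rpow_of_pos hpq.pos]
        refine ne_top_of_le_ne_top ?_ this
        rw [lintegral_indicator_const (measurableSet_spanningSets ν n)]
        refine ENNReal.mul_ne_top ?_ (measure_spanningSets_lt_top ν n).ne
        exact ENNReal.rpow_ne_top_of_nonneg hpq.nonneg (by simp)
      have hle : A ≤ A ^ (1 / t') * R := by
        calc A ≤ ∫⁻ x, T n x ^ (t - 1) * Φ x ∂ν := by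
              refine lintegral_mono fun x => ?_
              have : T n x ^ t = T n x ^ (t - 1) * T n x := by
                conv_rhs => rw [← ENNReal.rpow_one (T n x), ← ENNReal.rpow_mul]
                rw [← ENNReal.rpow_add_of_nonneg _ _ (by linarith) (by norm_num)]
                congr 1; ring
              dsimp only
              rw [this]
              gcongr
              exact min_le_left _ _
          _ = ∫⁻ x, ∫⁻ y, T n x ^ (t - 1) * F (x, y) ∂μ ∂ν := by
              refine lintegral_congr fun x => ?_
              rw [lintegral_const_mul _ (by fun_prop)]
          _ = ∫⁻ y, ∫⁻ x, T n x ^ (t - 1) * F (x, y) ∂ν ∂μ := by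
              rw [lintegral_lintegral_swap]
              have := hTm n
              exact (Measurable.mul (by fun_prop) hF).aemeasurable
          _ ≤ ∫⁻ y, A ^ (1 / t') * (∫⁻ x, F (x, y) ^ t ∂ν) ^ (1 / t) ∂μ := by
              refine lintegral_mono fun y => ?_
              have := ENNReal.lintegral_mul_le_Lp_mul_Lq ν hpq.symm
                (f := fun x => T n x ^ (t - 1)) (g := fun x => F (x, y))
                ((hTm n).pow_const _).aemeasurable (by fun_prop)
              refine this.trans ?_
              refine mul_le_mul' (ENNReal.rpow_le_rpow ?_ (by have := hpq.symm.pos; positivity)) le_rfl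
              refine le_of_eq (lintegral_congr fun x => ?_)
              rw [← ENNReal.rpow_mul]
              congr 1
              rw [hpq.sub_one_mul_conj]
          _ = A ^ (1 / t') * R := by
              rw [lintegral_const_mul]
              exact ((hF.pow_const _).lintegral_prod_left').pow_const _
      by_cases hA0 : A = 0
      · rw [hA0, ENNReal.zero_rpow_of_pos (by have := hpq.pos; positivity)]; exact zero_le
      · have e : A = A ^ (1 / t') * A ^ (1 / t) := by
          rw [← ENNReal.rpow_add _ _ hA0 hAfin]
          have := hpq.inv_add_inv_eq_one
          rw [one_div, one_div, add_comm, this, ENNReal.rpow_one]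
        have h0 : A ^ (1 / t') ≠ 0 := by
          exact (ENNReal.rpow_pos (pos_iff_ne_zero.2 hA0) hAfin).ne'
        have h1 : A ^ (1 / t') ≠ ∞ := by
          exact ENNReal.rpow_ne_top_of_nonneg (by have := hpq.symm.pos; positivity) hAfin
        nth_rewrite 1 [e] at hle
        exact (ENNReal.mul_le_mul_iff_right h0 h1).1 hle
    have hfin : (∫⁻ x, Φ x ^ t ∂ν) = ⨆ n, ∫⁻ x, T n x ^ t ∂ν := by
      rw [← lintegral_iSup (fun n => (hTm n).pow_const _)]
      · refine lintegral_congr fun x => ?_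
        rw [← hsup x]
        exact (ENNReal.orderIsoRpow t hpq.pos).map_iSup _
      · intro a b hab x
        dsimp only
        gcongr
        exact hmono hab x
    rw [hfin]
    have : (⨆ n, ∫⁻ x, T n x ^ t ∂ν) ^ (1 / t) = ⨆ n, (∫⁻ x, T n x ^ t ∂ν) ^ (1 / t) :=
      (ENNReal.orderIsoRpow (1 / t) (by have := hpq.pos; positivity)).map_iSup _
    rw [this]
    exact iSup_le key

lemma minkowski_r {p : ℝ≥0∞} {r : ℝ} (hr : 0 < r) (hp : ENNReal.ofReal r ≤ p) {ν : Measure X}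
    [SigmaFinite ν] {μ : Measure Y} [SFinite μ] {F : X × Y → ℝ≥0∞} (hF : Measurable F) :
    V p ν (fun x => (∫⁻ y, F (x, y) ^ r ∂μ) ^ (1 / r)) ^ r
      ≤ ∫⁻ y, V p ν (fun x => F (x, y)) ^ r ∂μ := by
  have hr' : ENNReal.ofReal r ≠ 0 := by simpa using hr
  have hp0 : p ≠ 0 := (lt_of_lt_of_le (pos_iff_ne_zero.2 hr') hp).ne'
  simp_rw [V_rpow hp0 hr, ← ENNReal.rpow_mul, one_div_mul_cancel hr.ne', ENNReal.rpow_one]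
  refine minkowski (F := fun z => F z ^ r) ?_ (hF.pow_const _)
  rw [ENNReal.le_div_iff_mul_le (Or.inl hr') (Or.inl ENNReal.ofReal_ne_top), one_mul]
  exact hp
end norms
end KP
namespace KP

section wts
variable {n : ℕ}

/-- weighted measure -/
def nu (n : ℕ) (a : ℝ) : Measure (Eu n) := volume.withDensity (jweight a)

lemma jweight_measurable (a : ℝ) : Measurable (jweight (n := n) a) := by
  unfold jweight
  have : Measurable fun x : Eu n => (1 + ‖x‖ ^ 2 : ℝ) := by fun_prop
  exact (this.pow_const _).ennreal_ofReal

instance (a : ℝ) : SigmaFinite (nu n a) := by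
  unfold nu jweight
  exact SigmaFinite.withDensity_ofReal _

lemma lint_nu (a : ℝ) (F : Eu n → ℝ≥0∞) : ∫⁻ x, F x ∂(nu n a) = ∫⁻ x, F x * jweight a x := by
  rw [nu, lintegral_withDensity_eq_lintegral_mul_non_measurable _ (jweight_measurable a)
    (Filter.Eventually.of_forall fun x => by simp [jweight])]
  refine lintegral_congr fun x => ?_
  simp [mul_comm]

lemma ae_nu (a : ℝ) : ae (nu n a) = ae volume := by
  apply le_antisymm
  · exact Measure.AbsolutelyContinuous.ae_le (withDensity_absolutelyContinuous _ _)
  · refine Measure.AbsolutelyContinuous.ae_le (withDensity_absolutelyContinuous' (jweight_measurable a).aemeasurable ?_)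
    refine Filter.Eventually.of_forall fun x => ?_
    have : (0:ℝ) < 1 + ‖x‖ ^ 2 := by positivity
    simp only [jweight, ne_eq, ENNReal.ofReal_eq_zero, not_le]
    positivity

lemma essSup_nu (a : ℝ) (F : Eu n → ℝ≥0∞) : essSup F (nu n a) = essSup F volume := by
  rw [essSup, essSup, ae_nu]

lemma V_const_mul' {X : Type*} [MeasurableSpace X] {p : ℝ≥0∞} (hp : p ≠ 0) {ν : Measure X}
    {F : X → ℝ≥0∞} {c : ℝ≥0∞} (hc : c ≠ ∞) : V p ν (fun x => c * F x) = c * V p ν F := by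
  unfold V
  split_ifs with h
  · exact ENNReal.essSup_const_mul
  · have hp' : 0 < p.toReal := ENNReal.toReal_pos hp h
    simp_rw [ENNReal.mul_rpow_of_nonneg _ _ hp'.le]
    rw [lintegral_const_mul' _ _ (by exact ENNReal.rpow_ne_top_of_nonneg hp'.le hc),
      ENNReal.mul_rpow_of_nonneg _ _ (by positivity),
      ← ENNReal.rpow_mul, mul_one_div_cancel hp'.ne', ENNReal.rpow_one]

lemma V_trans {p : ℝ≥0∞} (hp : p ≠ 0) {a : ℝ} (ha : 0 ≤ a) : ∃ (M : ℕ) (C : ℝ), 0 ≤ C ∧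
    ∀ (F : Eu n → ℝ≥0∞) (h : Eu n), V p (nu n a) (fun x => F (x - h)) ≤
      ENNReal.ofReal (C * (1 + ‖h‖) ^ M) * V p (nu n a) F := by
  by_cases hpt : p = ∞
  · refine ⟨0, 1, zero_le_one, fun F h => ?_⟩
    simp only [V, if_pos hpt, essSup_nu, pow_zero, mul_one, ENNReal.ofReal_one, one_mul]
    have e : MeasurePreserving (fun x : Eu n => x - h) volume volume :=
      measurePreserving_sub_right volume h
    refine essSup_le_of_ae_le _ ?_
    exact e.quasiMeasurePreserving.ae (ENNReal.ae_le_essSup F)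
  · have hp' : 0 < p.toReal := ENNReal.toReal_pos hp hpt
    set t := p.toReal
    obtain ⟨M, hM⟩ := exists_nat_ge (a / t)
    refine ⟨M, 2 ^ M, by positivity, fun F h => ?_⟩
    simp only [V, if_neg hpt, lint_nu]
    set D : ℝ := (2 * (1 + ‖h‖)) ^ a with hD
    have hh : 0 ≤ ‖h‖ := norm_nonneg _
    have h1 : ∫⁻ x, F (x - h) ^ t * jweight a x ≤ ENNReal.ofReal D * ∫⁻ x, F x ^ t * jweight a x := by
      rw [← lintegral_add_right_eq_self _ h, ← lintegral_const_mul' _ _ ENNReal.ofReal_ne_top]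
      refine lintegral_mono fun x => ?_
      simp only [add_sub_cancel_right]
      rw [mul_left_comm]
      gcongr
      rw [jweight, jweight, ← ENNReal.ofReal_mul (by positivity)]
      refine ENNReal.ofReal_le_ofReal ?_
      have e1 : D = ((2 * (1 + ‖h‖)) ^ 2) ^ (a / 2) := by
        rw [hD, ← Real.rpow_natCast, ← Real.rpow_mul (by positivity)]
        congr 1; push_cast; ring
      rw [e1, ← Real.mul_rpow (by positivity) (by positivity)]
      refine Real.rpow_le_rpow (by positivity) ?_ (by positivity)
      have h3 := norm_add_le x h
      have h4 : ‖x + h‖ ^ 2 ≤ (‖x‖ + ‖h‖) ^ 2 := by gcongr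
      have h0 := norm_nonneg x
      nlinarith [sq_nonneg (‖x‖ - ‖h‖), mul_nonneg h0 hh, mul_nonneg hh (sq_nonneg ‖x‖), sq_nonneg (‖x‖*‖h‖)]
    calc _ ≤ (ENNReal.ofReal D * ∫⁻ x, F x ^ t * jweight a x) ^ (1 / t) := by gcongr
      _ = ENNReal.ofReal (D ^ (1 / t)) * (∫⁻ x, F x ^ t * jweight a x) ^ (1 / t) := by
        rw [ENNReal.mul_rpow_of_nonneg _ _ (by positivity),
          ENNReal.ofReal_rpow_of_nonneg (by positivity) (by positivity)]
      _ ≤ _ := by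
        gcongr
        rw [hD, ← mul_pow, ← Real.rpow_mul (by positivity), ← Real.rpow_natCast]
        refine Real.rpow_le_rpow_of_exponent_le (by linarith) ?_
        rw [mul_one_div]; exact hM

lemma V_holder {p p₁ p₂ : ℝ≥0∞} {a a₁ a₂ : ℝ} (hp : p ≠ 0) (hp1 : 1 ≤ p₁) (hp2 : 1 ≤ p₂)
    (ha : 0 ≤ a) (ha1 : 0 ≤ a₁) (ha2 : 0 ≤ a₂)
    (h : 1 / p = 1 / p₁ + 1 / p₂)
    (hw : ENNReal.ofReal a / p = ENNReal.ofReal a₁ / p₁ + ENNReal.ofReal a₂ / p₂)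
    {F G : Eu n → ℝ≥0∞} (hF : Measurable F) (hG : Measurable G) :
    V p (nu n a) (fun x => F x * G x) ≤ V p₁ (nu n a₁) F * V p₂ (nu n a₂) G := by
  have key : ∀ (q : ℝ≥0∞) (b a' : ℝ) (F G : Eu n → ℝ≥0∞), q ≠ 0 → Measurable G → 
      V q (nu n b) (fun x => F x * G x) ≤ V ∞ (nu n a') F * V q (nu n b) G := by
    intro q b a' F G hq hG
    rw [← V_const_mul hq hG]
    refine V_mono_ae ?_
    simp only [V, if_true, essSup_nu]
    rw [ae_nu]
    filter_upwards [ENNReal.ae_le_essSup F] with x hx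
    gcongr
  have aeq : ∀ {q : ℝ≥0∞} {b b' : ℝ}, 0 ≤ b → 0 ≤ b' → q ≠ 0 → q ≠ ∞ →
      ENNReal.ofReal b / q = ENNReal.ofReal b' / q → b = b' := by
    intro q b b' hb hb' h0 h1 e
    have := congrArg (fun z => (z * q).toReal) e
    simpa [ENNReal.div_mul_cancel h0 h1, ENNReal.toReal_ofReal, hb, hb'] using this
  have hp20 : p₂ ≠ 0 := (lt_of_lt_of_le one_pos hp2).ne'
  have hp10 : p₁ ≠ 0 := (lt_of_lt_of_le one_pos hp1).ne'
  by_cases h1 : p₁ = ∞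
  · subst h1
    have hpp : p = p₂ := by simpa using h
    subst hpp
    by_cases h2 : p = ∞
    · subst h2
      have := key ∞ a₂ a₁ F G hp hG
      simpa only [V, if_true, essSup_nu] using this
    · have : a = a₂ := aeq ha ha2 hp h2 (by simpa using hw)
      subst this
      exact key p a a₁ F G hp hG
  by_cases h2 : p₂ = ∞
  · subst h2
    have hpp : p = p₁ := by simpa using h
    subst hpp
    have : a = a₁ := aeq ha ha1 hp h1 (by simpa using hw)
    subst this
    have := key p a a₂ G F hp hF
    simpa only [mul_comm] using this
  have hpt : p ≠ ∞ := by
    rintro rfl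
    have := h.symm
    simp [h1, h2] at this
  set t := p.toReal with ht
  set t₁ := p₁.toReal with ht1
  set t₂ := p₂.toReal with ht2
  have t0 : 0 < t := ENNReal.toReal_pos hp hpt
  have t10 : 0 < t₁ := ENNReal.toReal_pos hp10 h1
  have t20 : 0 < t₂ := ENNReal.toReal_pos hp20 h2
  have hh : 1 / t = 1 / t₁ + 1 / t₂ := by
    have := congrArg ENNReal.toReal h
    rw [ENNReal.toReal_add (by simp [hp10]) (by simp [hp20])] at this
    simpa [ENNReal.toReal_div] using this
  have hhw : a / t = a₁ / t₁ + a₂ / t₂ := by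
    have := congrArg ENNReal.toReal hw
    rw [ENNReal.toReal_add (ENNReal.div_ne_top (by simp) hp10) (ENNReal.div_ne_top (by simp) hp20)] at this
    simpa [ENNReal.toReal_div, ENNReal.toReal_ofReal, ha, ha1, ha2] using this
  have hlt : t < t₁ := by
    have : 1 / t₁ < 1 / t := by rw [hh]; have : 0 < 1 / t₂ := by positivity
                                linarith
    exact (one_div_lt_one_div t10 t0).1 this
  simp only [V, if_neg hpt, if_neg h1, if_neg h2, lint_nu, ← ht, ← ht1, ← ht2]
  have jp : ∀ (c : ℝ) (q : ℝ), 0 < q → ∀ x : Eu n, (jweight (c / q) x) ^ q = jweight c x := by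
    intro c q hq x
    have : (0:ℝ) < 1 + ‖x‖ ^ 2 := by positivity
    rw [jweight, jweight, ENNReal.ofReal_rpow_of_pos (by positivity), ← Real.rpow_mul this.le]
    congr 2; field_simp
  have := ENNReal.lintegral_Lp_mul_le_Lq_mul_Lr t0 hlt hh (volume : Measure (Eu n))
    (f := fun x => F x * jweight (a₁ / t₁) x) (g := fun x => G x * jweight (a₂ / t₂) x)
    (hF.mul (jweight_measurable _)).aemeasurable (hG.mul (jweight_measurable _)).aemeasurable
  convert this using 3
  · ext x
    have : (0:ℝ) < 1 + ‖x‖ ^ 2 := by positivity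
    rw [← jp a t t0 x, ← ENNReal.mul_rpow_of_nonneg _ _ t0.le]
    have e : jweight (a / t) x = jweight (a₁ / t₁) x * jweight (a₂ / t₂) x := by
      rw [jweight, jweight, jweight, ← ENNReal.ofReal_mul (by positivity), ← Real.rpow_add this, hhw]
      congr 2; ring
    rw [e]
    simp only [Pi.mul_apply]
    congr 1; ring
  · refine lintegral_congr fun x => ?_
    rw [← jp a₁ t₁ t10 x, ← ENNReal.mul_rpow_of_nonneg _ _ t10.le]
  · refine lintegral_congr fun x => ?_
    rw [← jp a₂ t₂ t20 x, ← ENNReal.mul_rpow_of_nonneg _ _ t20.le]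
end wts

variable {m k : ℕ}

/-- mixed norm of a nonnegative function -/
def NN (Q : ℝ≥0∞) (B : ℝ) (q : ℝ≥0∞) (b : ℝ) (F : Eu m × Eu k → ℝ≥0∞) : ℝ≥0∞ :=
  V Q (nu k B) (fun y => V q (nu m b) (fun x => F (x, y)))

lemma mixedNorm_eq (Q : ℝ≥0∞) (B : ℝ) (q : ℝ≥0∞) (b : ℝ) (f : Eu m × Eu k → ℂ) :
    mixedNorm Q B q b f = NN Q B q b (fun x => ‖f x‖ₑ) := by
  unfold mixedNorm NN V
  simp only [lint_nu, essSup_nu]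
  rfl

/-- axiomatised lattice quasi-norm -/
structure LN (r : ℝ) (N : (Eu m × Eu k → ℝ≥0∞) → ℝ≥0∞) : Prop where
  mono : ∀ {F G : Eu m × Eu k → ℝ≥0∞}, (∀ x, F x ≤ G x) → N F ≤ N G
  cmul : ∀ {F : Eu m × Eu k → ℝ≥0∞} {c : ℝ≥0∞}, c ≠ ∞ → N (fun x => c * F x) = c * N F
  mink : ∀ {Y : Type} [MeasurableSpace Y] (μ : Measure Y) [SFinite μ]
    {F : (Eu m × Eu k) × Y → ℝ≥0∞}, Measurable F →
    N (fun x => (∫⁻ y, F (x, y) ^ r ∂μ) ^ (1 / r)) ^ r ≤ ∫⁻ y, N (fun x => F (x, y)) ^ r ∂μ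
  trans : ∃ (M : ℕ) (C : ℝ), 0 ≤ C ∧ ∀ (F : Eu m × Eu k → ℝ≥0∞) (h : Eu m × Eu k),
    N (fun x => F (x - h)) ≤ ENNReal.ofReal (C * (1 + ‖h‖) ^ M) * N F

lemma NN_LN {r : ℝ} (hr : 0 < r) {Q q : ℝ≥0∞} {B b : ℝ} (hQ : ENNReal.ofReal r ≤ Q)
    (hq : ENNReal.ofReal r ≤ q) (hB : 0 ≤ B) (hb : 0 ≤ b) :
    LN r (NN (m := m) (k := k) Q B q b) := by
  have hr' : ENNReal.ofReal r ≠ 0 := by simpa using hr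
  have hq0 : q ≠ 0 := (lt_of_lt_of_le (pos_iff_ne_zero.2 hr') hq).ne'
  have hQ0 : Q ≠ 0 := (lt_of_lt_of_le (pos_iff_ne_zero.2 hr') hQ).ne'
  refine ⟨fun h => V_mono fun y => V_mono fun x => h _, ?_, ?_, ?_⟩
  · intro F c hc
    unfold NN
    simp_rw [V_const_mul' hq0 hc, V_const_mul' hQ0 hc]
  · intro Y _ μ _ F hF
    have hm : Measurable (fun p : Eu k × Y => V q (nu m b) (fun x => F ((x, p.1), p.2))) :=
      V_measurable (F := fun z : Eu m × (Eu k × Y) => F ((z.1, z.2.1), z.2.2)) (by fun_prop)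
    have hmk := minkowski_r (μ := μ) (ν := nu k B) hr hQ hm
    unfold NN
    refine le_trans ?_ hmk
    refine ENNReal.rpow_le_rpow (V_mono fun y => ?_) hr.le
    have := minkowski_r (μ := μ) (ν := nu m b) hr hq (F := fun z => F ((z.1, y), z.2)) (by fun_prop)
    calc _ = ((V q (nu m b) fun x => (∫⁻ z, F ((x, y), z) ^ r ∂μ) ^ (1 / r)) ^ r) ^ (1 / r) := by
          rw [← ENNReal.rpow_mul, mul_one_div_cancel hr.ne', ENNReal.rpow_one]
      _ ≤ _ := by gcongr
  · obtain ⟨M1, C1, hC1, h1⟩ := V_trans (n := m) hq0 hb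
    obtain ⟨M2, C2, hC2, h2⟩ := V_trans (n := k) hQ0 hB
    refine ⟨M1 + M2, C1 * C2, by positivity, fun F h => ?_⟩
    unfold NN
    calc _ ≤ V Q (nu k B) (fun y => ENNReal.ofReal (C1 * (1 + ‖h.1‖) ^ M1) *
            V q (nu m b) (fun x => F (x, y - h.2))) :=
          V_mono fun y => h1 (fun x => F (x, y - h.2)) h.1
      _ = ENNReal.ofReal (C1 * (1 + ‖h.1‖) ^ M1) *
            V Q (nu k B) (fun y => V q (nu m b) (fun x => F (x, y - h.2))) :=
          V_const_mul' hQ0 ENNReal.ofReal_ne_top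
      _ ≤ ENNReal.ofReal (C1 * (1 + ‖h.1‖) ^ M1) * (ENNReal.ofReal (C2 * (1 + ‖h.2‖) ^ M2) *
            V Q (nu k B) (fun y => V q (nu m b) (fun x => F (x, y)))) := by
          gcongr
          exact h2 (fun y => V q (nu m b) (fun x => F (x, y))) h.2
      _ ≤ _ := by
          rw [← mul_assoc, ← ENNReal.ofReal_mul (by positivity)]
          refine mul_le_mul' (ENNReal.ofReal_le_ofReal ?_) le_rfl
          rw [pow_add]
          have e1 : ‖h.1‖ ≤ ‖h‖ := norm_fst_le h
          have e2 : ‖h.2‖ ≤ ‖h‖ := norm_snd_le h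
          calc _ = C1 * C2 * ((1 + ‖h.1‖) ^ M1 * (1 + ‖h.2‖) ^ M2) := by ring
            _ ≤ _ := by gcongr

lemma NN_holder {Q Q₁ Q₂ q q₁ q₂ : ℝ≥0∞} {B B₁ B₂ b b₁ b₂ : ℝ} (hQ : Q ≠ 0) (hq : q ≠ 0)
    (hQ1 : 1 ≤ Q₁) (hQ2 : 1 ≤ Q₂) (hq1 : 1 ≤ q₁) (hq2 : 1 ≤ q₂)
    (hB : 0 ≤ B) (hB1 : 0 ≤ B₁) (hB2 : 0 ≤ B₂) (hb : 0 ≤ b) (hb1 : 0 ≤ b₁) (hb2 : 0 ≤ b₂)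
    (h : 1 / Q = 1 / Q₁ + 1 / Q₂) (h' : 1 / q = 1 / q₁ + 1 / q₂)
    (hw : ENNReal.ofReal B / Q = ENNReal.ofReal B₁ / Q₁ + ENNReal.ofReal B₂ / Q₂)
    (hw' : ENNReal.ofReal b / q = ENNReal.ofReal b₁ / q₁ + ENNReal.ofReal b₂ / q₂)
    {F G : Eu m × Eu k → ℝ≥0∞} (hF : Measurable F) (hG : Measurable G) :
    NN Q B q b (fun x => F x * G x) ≤ NN Q₁ B₁ q₁ b₁ F * NN Q₂ B₂ q₂ b₂ G := by
  unfold NN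
  refine le_trans (V_mono fun y => ?_) (V_holder (n := k) hQ hQ1 hQ2 hB hB1 hB2 h hw
    (V_measurable hF) (V_measurable hG))
  exact V_holder hq hq1 hq2 hb hb1 hb2 h' hw' (by fun_prop) (by fun_prop)

lemma LN.cv {r : ℝ} (hr : 0 < r) {N : (Eu m × Eu k → ℝ≥0∞) → ℝ≥0∞} (hN : LN r N)
    {κ : Eu m × Eu k → ℝ≥0∞} (hκ : Measurable κ) {H : (Eu m × Eu k) × (Eu m × Eu k) → ℝ≥0∞}
    (hH : Measurable H) {u : Eu m × Eu k → ℝ≥0∞} (hu : ∀ x, u x ^ r ≤ ∫⁻ y, κ y * H (x, y) ^ r) :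
    N u ^ r ≤ ∫⁻ y, κ y * N (fun x => H (x, y)) ^ r := by
  refine le_trans ?_ (lintegral_withDensity_le_lintegral_mul volume hκ _)
  refine le_trans ?_ (hN.mink (volume.withDensity κ) hH)
  refine ENNReal.rpow_le_rpow (hN.mono fun x => ?_) hr.le
  have e : u x = (u x ^ r) ^ (1 / r) := by
    rw [← ENNReal.rpow_mul, mul_one_div_cancel hr.ne', ENNReal.rpow_one]
  rw [e]
  refine ENNReal.rpow_le_rpow ?_ (by positivity)
  rw [lintegral_withDensity_eq_lintegral_mul _ hκ (by fun_prop)]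
  exact hu x

lemma LN.tsum {r : ℝ} (hr : 0 < r) {N : (Eu m × Eu k → ℝ≥0∞) → ℝ≥0∞} (hN : LN r N)
    {ι : Type} [Countable ι] {H : ι → (Eu m × Eu k) → ℝ≥0∞}
    (hH : ∀ i, Measurable (H i)) {u : Eu m × Eu k → ℝ≥0∞} (hu : ∀ x, u x ^ r ≤ ∑' i, H i x ^ r) :
    N u ^ r ≤ ∑' i, N (H i) ^ r := by
  letI : MeasurableSpace ι := ⊤
  haveI : DiscreteMeasurableSpace ι := ⟨fun _ => trivial⟩
  have hm : Measurable (fun p : (Eu m × Eu k) × ι => H p.2 p.1) :=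
    measurable_from_prod_countable_left hH
  have := hN.mink (Measure.count (α := ι)) hm
  simp only [lintegral_count] at this
  refine le_trans ?_ this
  refine ENNReal.rpow_le_rpow (hN.mono fun x => ?_) hr.le
  have e : u x = (u x ^ r) ^ (1 / r) := by
    rw [← ENNReal.rpow_mul, mul_one_div_cancel hr.ne', ENNReal.rpow_one]
  rw [e]
  exact ENNReal.rpow_le_rpow (hu x) (by positivity)

lemma rpow_tsum_le {r : ℝ} (hr : 0 < r) (hr1 : r ≤ 1) {ι : Type} (a : ι → ℝ≥0∞) :
    (∑' i, a i) ^ r ≤ ∑' i, a i ^ r := by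
  have hfin : ∀ s : Finset ι, (∑ i ∈ s, a i) ^ r ≤ ∑ i ∈ s, a i ^ r := by
    classical
    intro s
    induction s using Finset.induction_on with
    | empty => simp [ENNReal.zero_rpow_of_pos hr]
    | insert i s hi ih =>
      rw [Finset.sum_insert hi, Finset.sum_insert hi]
      exact (ENNReal.rpow_add_le_add_rpow _ _ hr.le hr1).trans (by gcongr)
  rw [ENNReal.tsum_eq_iSup_sum]
  have : (⨆ s : Finset ι, ∑ i ∈ s, a i) ^ r = ⨆ s : Finset ι, (∑ i ∈ s, a i) ^ r :=
    (ENNReal.orderIsoRpow r hr).map_iSup _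
  rw [this]
  exact iSup_le fun s => (hfin s).trans (ENNReal.sum_le_tsum s)
end KP
namespace KP
variable {m k : ℕ}

lemma integrable_mul_ee {Ω : Type*} [MeasurableSpace Ω] {μ : Measure Ω} {c : Ω → ℂ}
    {ζ : Ω → Eu m × Eu k} (hc : Integrable c μ) (hζ : Measurable ζ) (y : Eu m × Eu k) :
    Integrable (fun ω => c ω * ee y (ζ ω)) μ := by
  refine hc.mul_bdd (c := 1) ?_ (Filter.Eventually.of_forall fun ω => by simp)
  exact (measurable_ee measurable_const hζ).aestronglyMeasurable

/-- convolution against a superposition of characters -/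
lemma conv_sp {Ω : Type*} [MeasurableSpace Ω] {μ : Measure Ω} [SFinite μ] {c : Ω → ℂ}
    {ζ : Ω → Eu m × Eu k} (hc : Integrable c μ) (hζ : Measurable ζ)
    {κ : Eu m × Eu k → ℂ} (hκ : Integrable κ) (x : Eu m × Eu k) :
    ∫ z, κ z * ∫ ω, c ω * ee (x - z) (ζ ω) ∂μ = ∫ ω, FT2 κ (ζ ω) * c ω * ee x (ζ ω) ∂μ := by
  simp_rw [← integral_const_mul]
  rw [integral_integral_swap]
  · congr 1; ext ω
    rw [FT2_eq, ← integral_mul_const, ← integral_mul_const]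
    congr 1; ext z
    rw [ee_sub_left]; ring
  · have h1 : Integrable (fun p : (Eu m × Eu k) × Ω => κ p.1 * c p.2) (volume.prod μ) := hκ.mul_prod hc
    have h2 := h1.mul_bdd (c := 1) (g := fun p => ee (x - p.1) (ζ p.2)) (by
      refine (measurable_ee (by fun_prop) (hζ.comp measurable_snd)).aestronglyMeasurable)
      (Filter.Eventually.of_forall fun ω => by simp)
    refine h2.congr (Filter.Eventually.of_forall fun p => ?_)
    simp [Function.uncurry]; ring

lemma conv_IF {u : Eu m × Eu k → ℂ} (hu : Integrable u) {κ : Eu m × Eu k → ℂ} (hκ : Integrable κ)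
    (x : Eu m × Eu k) : ∫ z, κ z * IF u (x - z) = IF (fun ξ => FT2 κ ξ * u ξ) x :=
  conv_sp hu measurable_id hκ x

/-- band-limited function, given as superposition of characters -/
def BL (R : ℝ) (Φ : Eu m × Eu k → ℂ) : Prop :=
  ∃ (Ω : Type) (_ : MeasurableSpace Ω) (μ : Measure Ω) (_ : SFinite μ) (c : Ω → ℂ)
    (ζ : Ω → Eu m × Eu k), Integrable c μ ∧ Measurable ζ ∧ (∀ ω, c ω ≠ 0 → ‖ζ ω‖ ≤ R) ∧
    ∀ y, Φ y = ∫ ω, c ω * ee y (ζ ω) ∂μ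

/-- reproduced by kernels -/
def Rep (R : ℝ) (Φ : Eu m × Eu k → ℂ) : Prop :=
  Continuous Φ ∧ (∃ B, ∀ y, ‖Φ y‖ ≤ B) ∧ ∀ κ : Eu m × Eu k → ℂ, Integrable κ →
    (∀ ξ, ‖ξ‖ ≤ R → FT2 κ ξ = 1) → ∀ y, ∫ z, κ z * Φ (y - z) = Φ y

lemma continuous_sp {Ω : Type*} [MeasurableSpace Ω] {μ : Measure Ω} {c : Ω → ℂ}
    {ζ : Ω → Eu m × Eu k} (hc : Integrable c μ) (hζ : Measurable ζ) :
    Continuous (fun y => ∫ ω, c ω * ee y (ζ ω) ∂μ) := by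
  refine continuous_of_dominated (bound := fun ω => ‖c ω‖)
    (fun y => (integrable_mul_ee hc hζ y).aestronglyMeasurable)
    (fun y => Filter.Eventually.of_forall fun ω => by simp) hc.norm
    (Filter.Eventually.of_forall fun ω => by fun_prop)

lemma continuous_IF {u : Eu m × Eu k → ℂ} (hu : Integrable u) : Continuous (IF u) :=
  continuous_sp hu measurable_id

lemma BL.rep {R : ℝ} {Φ : Eu m × Eu k → ℂ} (h : BL R Φ) : Rep R Φ := by
  obtain ⟨Ω, _, μ, _, c, ζ, hc, hζ, hR, hΦ⟩ := h
  have e : Φ = fun y => ∫ ω, c ω * ee y (ζ ω) ∂μ := funext hΦ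
  refine ⟨e ▸ continuous_sp hc hζ, ⟨∫ ω, ‖c ω‖ ∂μ, fun y => ?_⟩, fun κ hκ h1 y => ?_⟩
  · rw [e]
    refine (norm_integral_le_integral_norm _).trans (le_of_eq ?_)
    congr 1; ext ω; simp
  · simp_rw [e]
    rw [conv_sp hc hζ hκ]
    congr 1; ext ω
    by_cases h0 : c ω = 0
    · simp [h0]
    · rw [h1 _ (hR ω h0), one_mul]

lemma BL.mono {R R' : ℝ} {Φ : Eu m × Eu k → ℂ} (h : BL R Φ) (hR : R ≤ R') : BL R' Φ := by
  obtain ⟨Ω, _, μ, _, c, ζ, hc, hζ, hb, hΦ⟩ := h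
  exact ⟨Ω, _, μ, ‹_›, c, ζ, hc, hζ, fun ω h => (hb ω h).trans hR, hΦ⟩

lemma BL.mul {R R' : ℝ} {Φ Φ' : Eu m × Eu k → ℂ} (h : BL R Φ) (h' : BL R' Φ') :
    BL (R + R') (fun y => Φ y * Φ' y) := by
  obtain ⟨Ω, _, μ, _, c, ζ, hc, hζ, hb, hΦ⟩ := h
  obtain ⟨Ω', _, μ', _, c', ζ', hc', hζ', hb', hΦ'⟩ := h'
  refine ⟨Ω × Ω', _, μ.prod μ', inferInstance, fun p => c p.1 * c' p.2, fun p => ζ p.1 + ζ' p.2,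
    hc.mul_prod hc', by fun_prop, fun p hp => ?_, fun y => ?_⟩
  · exact (norm_add_le _ _).trans (add_le_add (hb _ (left_ne_zero_of_mul hp)) (hb' _ (right_ne_zero_of_mul hp)))
  · simp only [hΦ, hΦ', ← integral_prod_mul]
    congr 1; ext p
    rw [ee_add_right]; ring

lemma BL.const_mul {R : ℝ} {Φ : Eu m × Eu k → ℂ} (h : BL R Φ) (a : ℂ) :
    BL R (fun y => a * Φ y) := by
  obtain ⟨Ω, _, μ, _, c, ζ, hc, hζ, hb, hΦ⟩ := h
  refine ⟨Ω, _, μ, ‹_›, fun ω => a * c ω, ζ, hc.const_mul a, hζ,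
    fun ω h => hb ω (right_ne_zero_of_mul h), fun y => ?_⟩
  simp only [hΦ, ← integral_const_mul]; congr 1; ext ω; ring

lemma BL.refl {R : ℝ} {Φ : Eu m × Eu k → ℂ} (h : BL R Φ) (x : Eu m × Eu k) :
    BL R (fun y => Φ (x - y)) := by
  obtain ⟨Ω, _, μ, _, c, ζ, hc, hζ, hb, hΦ⟩ := h
  refine ⟨Ω, _, μ, ‹_›, fun ω => c ω * ee x (ζ ω), fun ω => - ζ ω, integrable_mul_ee hc hζ x, hζ.neg,
    fun ω h => by rw [norm_neg]; exact hb ω (left_ne_zero_of_mul h), fun y => ?_⟩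
  simp only [hΦ]; congr 1; ext ω
  rw [ee_sub_left, ee_neg_right]; ring

lemma BL.scale {R : ℝ} {Φ : Eu m × Eu k → ℂ} (h : BL R Φ) {a : ℝ} (ha : 0 ≤ a) :
    BL (R * a) (fun y => Φ (a • y)) := by
  obtain ⟨Ω, _, μ, _, c, ζ, hc, hζ, hb, hΦ⟩ := h
  refine ⟨Ω, _, μ, ‹_›, c, fun ω => a • ζ ω, hc, hζ.const_smul a,
    fun ω h => ?_, fun y => ?_⟩
  · rw [norm_smul, Real.norm_of_nonneg ha, mul_comm]
    exact mul_le_mul_of_nonneg_right (hb ω h) ha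
  · simp only [hΦ]; congr 1; ext ω
    simp only [ee, ip_smul_left, ip_smul_right]

lemma BL_IF {u : Eu m × Eu k → ℂ} (hu : Integrable u) {R : ℝ} (hR : ∀ ξ, u ξ ≠ 0 → ‖ξ‖ ≤ R) :
    BL R (IF u) :=
  ⟨_, _, volume, inferInstance, u, id, hu, measurable_id, hR, fun _ => rfl⟩

lemma Rep.sub {R : ℝ} {Φ Φ' : Eu m × Eu k → ℂ} (h : Rep R Φ) (h' : Rep R Φ') :
    Rep R (fun y => Φ y - Φ' y) := by
  obtain ⟨c1, ⟨B1, b1⟩, h1⟩ := h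
  obtain ⟨c2, ⟨B2, b2⟩, h2⟩ := h'
  refine ⟨c1.sub c2, ⟨B1 + B2, fun y => (norm_sub_le _ _).trans (add_le_add (b1 y) (b2 y))⟩,
    fun κ hκ hk y => ?_⟩
  have i1 : Integrable (fun z => κ z * Φ (y - z)) :=
    hκ.mul_bdd (c := B1) (by fun_prop) (Filter.Eventually.of_forall fun z => b1 _)
  have i2 : Integrable (fun z => κ z * Φ' (y - z)) :=
    hκ.mul_bdd (c := B2) (by fun_prop) (Filter.Eventually.of_forall fun z => b2 _)
  simp_rw [mul_sub]
  rw [integral_sub i1 i2, h1 κ hκ hk, h2 κ hκ hk]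

lemma FT2_scale (Ψ : Eu m × Eu k → ℂ) {R : ℝ} (hR : 0 < R) (ξ : Eu m × Eu k) :
    FT2 (fun y => ((R ^ (m + k) : ℝ) : ℂ) * Ψ (R • y)) ξ = FT2 Ψ (R⁻¹ • ξ) := by
  rw [FT2_eq, FT2_eq]
  have := Measure.integral_comp_smul (volume : Measure (Eu m × Eu k))
    (fun y => Ψ y * ee (-y) (R⁻¹ • ξ)) R
  have e : ∀ y : Eu m × Eu k, ee (-(R • y)) (R⁻¹ • ξ) = ee (-y) ξ := by
    intro y
    simp only [ee, ip_neg_left, ip_smul_left, ip_smul_right]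
    rw [mul_neg, inv_mul_cancel_left₀ hR.ne']
  simp_rw [e] at this
  simp_rw [mul_assoc]
  rw [integral_const_mul, this, finrankE, abs_of_pos (by positivity)]
  rw [Complex.real_smul, ← mul_assoc, ← Complex.ofReal_mul, mul_inv_cancel₀ (by positivity)]
  simp

lemma integrable_scale {Ψ : Eu m × Eu k → ℂ} (h : Integrable Ψ) {R : ℝ} (hR : 0 < R) (c : ℂ) :
    Integrable (fun y => c * Ψ (R • y)) :=
  ((integrable_comp_smul_iff volume Ψ hR.ne').2 h).const_mul c

/-- Nikolskii type inequality -/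
lemma nikolskii {r : ℝ} (hr : 0 < r) (hr1 : r ≤ 1) : ∃ C : ℝ, 0 < C ∧ ∀ (R : ℝ), 0 < R →
    ∀ Φ : Eu m × Eu k → ℂ, Rep R Φ → ∫⁻ y, ‖Φ y‖ₑ ≠ ∞ →
    (∫⁻ y, ‖Φ y‖ₑ) ^ r ≤ ENNReal.ofReal (C * (R ^ (m + k)) ^ (1 - r)) * ∫⁻ y, ‖Φ y‖ₑ ^ r := by
  let χ : ContDiffBump (0 : Eu m × Eu k) := ⟨1, 2, one_pos, one_lt_two⟩
  have hχs : ContDiff ℝ (⊤ : ℕ∞) (fun ξ => ((χ ξ : ℝ) : ℂ)) :=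
    Complex.ofRealCLM.contDiff.comp χ.contDiff
  have hχc : HasCompactSupport (fun ξ => ((χ ξ : ℝ) : ℂ)) :=
    χ.hasCompactSupport.comp_left (g := fun t : ℝ => (t : ℂ)) (by simp)
  obtain ⟨Ψ, -, h2⟩ := schwartz_IF (hχc.toSchwartzMap hχs)
  have h2' : ∀ ξ, FT2 Ψ ξ = χ ξ := fun ξ => h2 ξ
  obtain ⟨S, hS⟩ : ∃ S : ℝ, ∀ y, ‖Ψ y‖ ≤ S := by
    obtain ⟨S, hS⟩ := Ψ.decay 0 0
    exact ⟨S, fun y => by simpa using hS.2 y⟩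
  have hS0 : 0 ≤ S := (norm_nonneg _).trans (hS 0)
  refine ⟨(S + 1) ^ (1 - r), by positivity, fun R hR Φ hΦ hfin => ?_⟩
  set D : ℝ := R ^ (m + k) * (S + 1) with hD
  have hD0 : 0 < D := by positivity
  set I := ∫⁻ y, ‖Φ y‖ₑ with hI
  have hpt : ∀ y, ‖Φ y‖ₑ ≤ ENNReal.ofReal D * I := by
    intro y
    have e := hΦ.2.2 (fun y => ((R ^ (m + k) : ℝ) : ℂ) * Ψ (R • y)) (integrable_scale Ψ.integrable hR _)
      (fun ξ hξ => by
        rw [FT2_scale _ hR, h2', χ.one_of_mem_closedBall]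
        · simp
        · simp only [Metric.mem_closedBall, dist_zero_right, norm_smul, χ]
          rw [Real.norm_of_nonneg (by positivity)]
          rw [inv_mul_le_iff₀ hR]; simpa using hξ) y
    rw [← e]
    refine (enorm_integral_le_lintegral_enorm _).trans ?_
    calc ∫⁻ z, ‖((R ^ (m + k) : ℝ) : ℂ) * Ψ (R • z) * Φ (y - z)‖ₑ
        ≤ ∫⁻ z, ENNReal.ofReal D * ‖Φ (y - z)‖ₑ := by
          refine lintegral_mono fun z => ?_
          rw [enorm_mul]
          gcongr
          rw [← ofReal_norm]
          refine ENNReal.ofReal_le_ofReal ?_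
          rw [norm_mul, Complex.norm_real, Real.norm_of_nonneg (by positivity), hD]
          gcongr
          exact (hS _).trans (by linarith)
      _ = ENNReal.ofReal D * ∫⁻ z, ‖Φ (y - z)‖ₑ := lintegral_const_mul' _ _ (by simp)
      _ = _ := by rw [lintegral_sub_left_eq_self (fun z => ‖Φ z‖ₑ) y]
  by_cases hI0 : I = 0
  · rw [hI0, ENNReal.zero_rpow_of_pos hr]; exact zero_le
  have h3 : I ≤ (ENNReal.ofReal D * I) ^ (1 - r) * ∫⁻ y, ‖Φ y‖ₑ ^ r := by
    rw [← lintegral_const_mul' _ _ (ENNReal.rpow_ne_top_of_nonneg (by linarith) (ENNReal.mul_ne_top (by simp) hfin))]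
    rw [hI]
    refine lintegral_mono fun y => ?_
    dsimp only
    calc ‖Φ y‖ₑ = ‖Φ y‖ₑ ^ (1 - r) * ‖Φ y‖ₑ ^ r := by
          rw [← ENNReal.rpow_add_of_nonneg _ _ (by linarith) hr.le]; simp
      _ ≤ _ := by
          refine mul_le_mul' (ENNReal.rpow_le_rpow (hpt y) (by linarith)) le_rfl
  rw [ENNReal.mul_rpow_of_nonneg _ _ (by linarith)] at h3
  have e : I = I ^ (1 - r) * I ^ r := by
    rw [← ENNReal.rpow_add_of_nonneg _ _ (by linarith) hr.le]; simp
  have e2 : ENNReal.ofReal ((S + 1) ^ (1 - r) * (R ^ (m + k)) ^ (1 - r)) = ENNReal.ofReal D ^ (1 - r) := by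
    rw [ENNReal.ofReal_rpow_of_pos hD0, hD, Real.mul_rpow (by positivity) (by positivity), mul_comm]
  rw [e2]
  have h4 : I ^ (1 - r) * I ^ r ≤ I ^ (1 - r) * (ENNReal.ofReal D ^ (1 - r) * ∫⁻ y, ‖Φ y‖ₑ ^ r) := by
    rw [← e]; refine h3.trans (le_of_eq ?_); ring
  exact (ENNReal.mul_le_mul_iff_right (ENNReal.rpow_pos (pos_iff_ne_zero.2 hI0) hfin).ne'
    (ENNReal.rpow_ne_top_of_nonneg (by linarith) hfin)).1 h4
end KP
namespace KP
variable {m k : ℕ}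

lemma decay_int : ∃ C : ℝ, 0 < C ∧ ∀ q : ℝ, 0 < q →
    ∫⁻ y : Eu m × Eu k, ENNReal.ofReal (((1 + q * ‖y‖) ^ (m + k + 1))⁻¹) ≤
      ENNReal.ofReal (C * (q ^ (m + k))⁻¹) := by
  set φ : Eu m × Eu k → ℝ := fun y => ((1 + ‖y‖) ^ (m + k + 1))⁻¹ with hφ
  have hi : Integrable φ := by
    have := integrable_one_add_norm (E := Eu m × Eu k) (μ := volume) (r := (m + k + 1 : ℕ))
      (by rw [finrankE]; push_cast; linarith)
    refine this.congr (Filter.Eventually.of_forall fun y => ?_)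
    have : (0:ℝ) < 1 + ‖y‖ := by positivity
    simp only [hφ]
    rw [Real.rpow_neg this.le, Real.rpow_natCast]
  refine ⟨(∫ y, φ y) + 1, by have : 0 ≤ ∫ y, φ y := integral_nonneg fun y => by positivity
                             linarith, fun q hq => ?_⟩
  have e : ∀ y : Eu m × Eu k, ((1 + q * ‖y‖) ^ (m + k + 1))⁻¹ = φ (q • y) := by
    intro y; simp only [hφ, norm_smul, Real.norm_of_nonneg hq.le]
  simp_rw [e]
  rw [← ofReal_integral_eq_lintegral_ofReal ((integrable_comp_smul_iff volume φ hq.ne').2 hi)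
    (Filter.Eventually.of_forall fun y => by simp only [hφ]; positivity)]
  refine ENNReal.ofReal_le_ofReal ?_
  rw [Measure.integral_comp_smul, finrankE, abs_of_pos (by positivity), smul_eq_mul, mul_comm]
  gcongr; linarith

lemma main_est {r : ℝ} (hr : 0 < r) {N : (Eu m × Eu k → ℝ≥0∞) → ℝ≥0∞} (hN : LN r N) (M L : ℕ)
    (hL : (M : ℝ) * r + (m + k + 1 : ℕ) ≤ L * r) : ∃ C : ℝ, 0 < C ∧
    ∀ (i : ℕ) (t C0 : ℝ) (K : Eu m × Eu k → ℂ) (H : (Eu m × Eu k) × (Eu m × Eu k) → ℂ)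
      (D Λ : ℝ≥0∞), 0 ≤ C0 → Continuous K →
      (∀ y, ‖K y‖ ≤ C0 * ((2:ℝ) ^ i) ^ t * ((2:ℝ) ^ i) ^ (m + k) * ((1 + 2 ^ i * ‖y‖) ^ L)⁻¹) →
      Measurable H →
      (∀ x, (∫⁻ y, ‖K y * H (x, y)‖ₑ) ^ r ≤ Λ * ∫⁻ y, ‖K y * H (x, y)‖ₑ ^ r) →
      (∀ y, N (fun x => ‖H (x, y)‖ₑ) ≤ ENNReal.ofReal ((1 + 2 ^ i * ‖y‖) ^ M) * D) →
      N (fun x => ‖∫ y, K y * H (x, y)‖ₑ) ^ r ≤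
        Λ * ENNReal.ofReal (C * (C0 * ((2:ℝ) ^ i) ^ t) ^ r * ((((2:ℝ) ^ i) ^ (m + k)) ^ (1 - r))⁻¹)
          * D ^ r := by
  obtain ⟨C, hC, hint⟩ := decay_int (m := m) (k := k)
  refine ⟨C, hC, fun i t C0 K H D Λ hC0 hK hKb hH hΛ hD => ?_⟩
  set q : ℝ := 2 ^ i with hq
  have hq0 : 0 < q := by positivity
  have h1 := hN.cv hr (κ := fun y => Λ * ‖K y‖ₑ ^ r) (H := fun p => ‖H p‖ₑ)
    (u := fun x => ‖∫ y, K y * H (x, y)‖ₑ) (by have := hK.measurable; fun_prop) hH.enorm (fun x => by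
      calc ‖∫ y, K y * H (x, y)‖ₑ ^ r ≤ (∫⁻ y, ‖K y * H (x, y)‖ₑ) ^ r := by
            gcongr; exact enorm_integral_le_lintegral_enorm _
        _ ≤ Λ * ∫⁻ y, ‖K y * H (x, y)‖ₑ ^ r := hΛ x
        _ = _ := by
            have := hK.measurable
            rw [← lintegral_const_mul _ (by fun_prop)]
            refine lintegral_congr fun y => ?_
            rw [enorm_mul, ENNReal.mul_rpow_of_nonneg _ _ hr.le, mul_assoc])
  refine h1.trans ?_
  have h2 : ∀ y, Λ * ‖K y‖ₑ ^ r * N (fun x => ‖H (x, y)‖ₑ) ^ r ≤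
      (Λ * ENNReal.ofReal ((C0 * q ^ t) ^ r * (q ^ (m + k)) ^ r) * D ^ r) *
        ENNReal.ofReal (((1 + q * ‖y‖) ^ (m + k + 1))⁻¹) := by
    intro y
    have hy : 1 ≤ 1 + q * ‖y‖ := by have : 0 ≤ q * ‖y‖ := by positivity
                                    linarith
    set z := 1 + q * ‖y‖
    have hz : 0 < z := by linarith
    have a1 : ‖K y‖ₑ ^ r ≤ ENNReal.ofReal ((C0 * q ^ t) ^ r * (q ^ (m + k)) ^ r * (z ^ (L * r : ℝ))⁻¹) := by
      rw [← ofReal_norm, ENNReal.ofReal_rpow_of_nonneg (norm_nonneg _) hr.le]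
      refine ENNReal.ofReal_le_ofReal ?_
      calc ‖K y‖ ^ r ≤ (C0 * q ^ t * q ^ (m + k) * (z ^ L)⁻¹) ^ r := by gcongr; exact hKb y
        _ = _ := by
          rw [Real.mul_rpow (by positivity) (by positivity), Real.mul_rpow (by positivity) (by positivity),
            Real.inv_rpow (by positivity), Real.rpow_mul hz.le, Real.rpow_natCast]
    have a2 : N (fun x => ‖H (x, y)‖ₑ) ^ r ≤ ENNReal.ofReal (z ^ (M * r : ℝ)) * D ^ r := by
      calc _ ≤ (ENNReal.ofReal (z ^ M) * D) ^ r := by gcongr; exact hD y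
        _ = _ := by
          rw [ENNReal.mul_rpow_of_nonneg _ _ hr.le, ENNReal.ofReal_rpow_of_nonneg (by positivity) hr.le,
            Real.rpow_mul hz.le, Real.rpow_natCast]
    calc _ ≤ Λ * ENNReal.ofReal ((C0 * q ^ t) ^ r * (q ^ (m + k)) ^ r * (z ^ (L * r : ℝ))⁻¹) *
          (ENNReal.ofReal (z ^ (M * r : ℝ)) * D ^ r) := by gcongr
      _ = Λ * ENNReal.ofReal ((C0 * q ^ t) ^ r * (q ^ (m + k)) ^ r) * D ^ r *
          ENNReal.ofReal ((z ^ (L * r : ℝ))⁻¹ * z ^ (M * r : ℝ)) := by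
          rw [ENNReal.ofReal_mul (p := (C0 * q ^ t) ^ r * (q ^ (m + k)) ^ r) (by positivity),
            ENNReal.ofReal_mul (p := (z ^ (L * r : ℝ))⁻¹) (by positivity)]
          ring
      _ ≤ _ := by
          refine mul_le_mul' le_rfl (ENNReal.ofReal_le_ofReal ?_)
          rw [← Real.rpow_neg hz.le, ← Real.rpow_add hz, ← Real.rpow_natCast, ← Real.rpow_neg hz.le]
          refine Real.rpow_le_rpow_of_exponent_le hy ?_
          linarith
  refine (lintegral_mono h2).trans ?_
  rw [lintegral_const_mul _ (by fun_prop)]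
  calc _ ≤ Λ * ENNReal.ofReal ((C0 * q ^ t) ^ r * (q ^ (m + k)) ^ r) * D ^ r *
        ENNReal.ofReal (C * (q ^ (m + k))⁻¹) := by gcongr; exact hint q hq0
    _ = Λ * (ENNReal.ofReal ((C0 * q ^ t) ^ r * (q ^ (m + k)) ^ r) * ENNReal.ofReal (C * (q ^ (m + k))⁻¹))
        * D ^ r := by ring
    _ = _ := by
        rw [← ENNReal.ofReal_mul (by positivity)]
        congr 3
        rw [Real.rpow_sub (by positivity), Real.rpow_one]
        field_simp

/-- kernel data -/
structure Ker (L : ℕ) (t ρ C0 : ℝ) (j : ℕ) (σ K : Eu m × Eu k → ℂ) : Prop where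
  cont : Continuous K
  int : Integrable K
  bl : BL (ρ * 2 ^ j) K
  ft : ∀ ξ, FT2 K ξ = σ ξ
  bd : ∀ y, ‖K y‖ ≤ C0 * ((2:ℝ) ^ j) ^ t * ((2:ℝ) ^ j) ^ (m + k) * ((1 + 2 ^ j * ‖y‖) ^ L)⁻¹

lemma Ker.mono {L : ℕ} {t ρ C0 C1 ρ' : ℝ} {j : ℕ} {σ K : Eu m × Eu k → ℂ} (h : Ker L t ρ C0 j σ K)
    (hC : C0 ≤ C1) (hρ : ρ ≤ ρ') : Ker L t ρ' C1 j σ K :=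
  ⟨h.cont, h.int, h.bl.mono (by gcongr), h.ft, fun y => (h.bd y).trans (by gcongr)⟩

lemma dyadic (A : ℝ × (Eu m × Eu k) → ℂ) (hA : ContDiff ℝ (⊤ : ℕ∞) A) (ρ : ℝ)
    (hρ : ∀ ε ξ, ρ < ‖ξ‖ → A (ε, ξ) = 0) (L : ℕ) (t : ℝ) : ∃ C0, 0 ≤ C0 ∧ ∀ j : ℕ, ∃ K,
    Ker L t ρ C0 j
      (fun ξ => ((((2:ℝ) ^ j) ^ t : ℝ) : ℂ) * A (((2:ℝ) ^ j)⁻¹, ((2:ℝ) ^ j)⁻¹ • ξ)) K := by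
  obtain ⟨C, hC, hb⟩ := kernel_family A hA ρ hρ L
  refine ⟨C * cn m k, by have := cn_pos (m := m) (k := k); positivity, fun j => ?_⟩
  set q : ℝ := 2 ^ j with hq
  have hq0 : 0 < q := by positivity
  have hs : ContDiff ℝ (⊤ : ℕ∞) (fun ξ => A (q⁻¹, ξ)) := hA.comp (contDiff_const.prodMk contDiff_id)
  have hc : HasCompactSupport (fun ξ => A (q⁻¹, ξ)) := by
    refine HasCompactSupport.of_support_subset_isCompact (isCompact_closedBall 0 ρ) ?_
    intro ξ hξ
    simp only [Function.mem_support] at hξ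
    simp only [Metric.mem_closedBall, dist_zero_right]
    by_contra h
    exact hξ (hρ _ _ (not_le.1 h))
  obtain ⟨Ψ, h1, h2⟩ := schwartz_IF (hc.toSchwartzMap hs)
  have h1' : ∀ y, Ψ y = (cn m k : ℂ) * IF (fun ξ => A (q⁻¹, ξ)) y := h1
  have h2' : ∀ ξ, FT2 Ψ ξ = A (q⁻¹, ξ) := h2
  have hint : Integrable (fun ξ => A (q⁻¹, ξ)) := (hc.toSchwartzMap hs).integrable
  have hqt : 0 < q ^ t := by positivity
  refine ⟨fun y => ((q ^ t : ℝ) : ℂ) * (((q ^ (m + k) : ℝ) : ℂ) * Ψ (q • y)), ?_, ?_, ?_, ?_, ?_⟩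
  · have := Ψ.continuous
    fun_prop
  · exact (integrable_scale Ψ.integrable hq0 _).const_mul _
  · refine BL.const_mul (BL.const_mul ?_ _) _
    refine BL.scale (Φ := Ψ) ?_ hq0.le
    rw [show (Ψ : Eu m × Eu k → ℂ) = fun y => (cn m k : ℂ) * IF (fun ξ => A (q⁻¹, ξ)) y from funext h1']
    refine BL.const_mul (BL_IF hint fun ξ hξ => ?_) _
    by_contra h
    exact hξ (hρ _ _ (not_le.1 h))
  · intro ξ
    rw [FT2_eq]
    simp_rw [mul_assoc]
    rw [integral_const_mul]
    congr 1
    have := FT2_scale (Ψ : Eu m × Eu k → ℂ) hq0 ξ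
    rw [h2', FT2_eq] at this
    rw [← this]
    simp_rw [mul_assoc]
  · intro y
    rw [norm_mul, norm_mul, Complex.norm_real, Complex.norm_real, Real.norm_of_nonneg hqt.le,
      Real.norm_of_nonneg (by positivity), h1', norm_mul, Complex.norm_real,
      Real.norm_of_nonneg cn_pos.le]
    have := hb q⁻¹ ⟨by positivity, inv_le_one_of_one_le₀ (one_le_pow₀ one_le_two)⟩ (q • y)
    rw [norm_smul, Real.norm_of_nonneg hq0.le] at this
    have hcn := cn_pos (m := m) (k := k)
    calc _ ≤ q ^ t * (q ^ (m + k) * (cn m k * (C * ((1 + q * ‖y‖) ^ L)⁻¹))) := by gcongr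
      _ = _ := by ring

lemma jb_pos (ξ : Eu m × Eu k) : 0 < jb ξ := by unfold jb; positivity

/-- dyadic sequence of cutoffs -/
def cut (φ₀ φ : Eu m × Eu k → ℝ) (j : ℕ) (ξ : Eu m × Eu k) : ℝ :=
  if j = 0 then φ₀ ξ else φ (((2:ℝ) ^ j)⁻¹ • ξ)

lemma ker_cut {φ₀ φ : Eu m × Eu k → ℝ} (h0 : ContDiff ℝ (⊤ : ℕ∞) φ₀) (h1 : ContDiff ℝ (⊤ : ℕ∞) φ)
    {ρ δ : ℝ} (hδ : 0 < δ) (hφ0 : ∀ ξ, ρ < ‖ξ‖ → φ₀ ξ = 0) (hφ : ∀ ξ, ρ < ‖ξ‖ → φ ξ = 0)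
    (hφ' : ∀ ξ, ‖ξ‖ < δ → φ ξ = 0) (L : ℕ) (t : ℝ) :
    ∃ C0, 0 ≤ C0 ∧ ∀ j : ℕ, ∃ K, Ker L t ρ C0 j (fun ξ => ((jb ξ ^ (t / 2) * cut φ₀ φ j ξ : ℝ) : ℂ)) K := by
  have hbase : ContDiff ℝ (⊤ : ℕ∞) (fun p : ℝ × (Eu m × Eu k) => p.1 ^ 2 + ‖p.2.1‖ ^ 2 + ‖p.2.2‖ ^ 2) := by
    refine ((contDiff_fst.pow 2).add ?_).add ?_
    · exact (contDiff_norm_sq ℝ).comp (contDiff_fst.comp contDiff_snd)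
    · exact (contDiff_norm_sq ℝ).comp (contDiff_snd.comp contDiff_snd)
  have hjb : ContDiff ℝ (⊤ : ℕ∞) (fun ξ : Eu m × Eu k => jb ξ ^ (t / 2)) := by
    have : ContDiff ℝ (⊤ : ℕ∞) (fun ξ : Eu m × Eu k => jb ξ) := by
      have := hbase.comp (contDiff_const (c := (1:ℝ)).prodMk contDiff_id)
      simpa [jb, Function.comp_def] using this
    exact this.rpow_const_of_ne fun ξ => (jb_pos ξ).ne'
  obtain ⟨C1, hC1, hk1⟩ := dyadic (fun p : ℝ × (Eu m × Eu k) => ((jb p.2 ^ (t / 2) * φ₀ p.2 : ℝ) : ℂ))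
    (Complex.ofRealCLM.contDiff.comp ((hjb.mul h0).comp contDiff_snd)) ρ
    (fun ε ξ h => by simp [hφ0 ξ h]) L t
  have hsm : ContDiff ℝ (⊤ : ℕ∞) (fun p : ℝ × (Eu m × Eu k) =>
      (p.1 ^ 2 + ‖p.2.1‖ ^ 2 + ‖p.2.2‖ ^ 2) ^ (t / 2) * φ p.2) := by
    rw [contDiff_iff_contDiffAt]
    intro p
    by_cases hp : ‖p.2‖ < δ
    · refine (contDiffAt_const (c := (0:ℝ))).congr_of_eventuallyEq ?_
      have : ∀ᶠ p' : ℝ × (Eu m × Eu k) in nhds p, ‖p'.2‖ < δ :=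
        (continuous_snd.norm).continuousAt.eventually (gt_mem_nhds hp)
      filter_upwards [this] with p' hp'
      rw [hφ' _ hp', mul_zero]
    · refine ContDiffAt.mul (hbase.contDiffAt.rpow_const_of_ne ?_) (h1.comp contDiff_snd).contDiffAt
      have h2 : 0 < ‖p.2‖ := hδ.trans_le (not_lt.1 hp)
      have h3 := norm_sq_le_ip p.2
      simp only [ip, real_inner_self_eq_norm_sq] at h3
      have : 0 < ‖p.2‖ ^ 2 := by positivity
      have : 0 ≤ p.1 ^ 2 := sq_nonneg _
      exact ne_of_gt (by linarith)
  obtain ⟨C2, hC2, hk2⟩ := dyadic (fun p : ℝ × (Eu m × Eu k) =>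
      (((p.1 ^ 2 + ‖p.2.1‖ ^ 2 + ‖p.2.2‖ ^ 2) ^ (t / 2) * φ p.2 : ℝ) : ℂ))
    (Complex.ofRealCLM.contDiff.comp hsm) ρ
    (fun ε ξ h => by simp [hφ ξ h]) L t
  refine ⟨max C1 C2, le_max_of_le_left hC1, fun j => ?_⟩
  by_cases hj : j = 0
  · subst hj
    obtain ⟨K, hK⟩ := hk1 0
    refine ⟨K, ?_⟩
    convert hK.mono (le_max_left C1 C2) le_rfl using 2 with ξ
    simp [cut]
  · obtain ⟨K, hK⟩ := hk2 j
    refine ⟨K, ?_⟩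
    convert hK.mono (le_max_right C1 C2) le_rfl using 2 with ξ
    simp only [cut, if_neg hj]
    rw [← Complex.ofReal_mul, ← mul_assoc]
    congr 2
    set q : ℝ := 2 ^ j
    have hq0 : 0 < q := by positivity
    have e : q ^ t = (q ^ 2) ^ (t / 2) := by
      rw [← Real.rpow_natCast, ← Real.rpow_mul hq0.le]; congr 1; push_cast; ring
    rw [e, ← Real.mul_rpow (by positivity) (by positivity)]
    congr 1
    simp only [jb, Prod.smul_fst, Prod.smul_snd, norm_smul, Real.norm_of_nonneg (inv_nonneg.2 hq0.le)]
    field_simp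

/-- kernels for even exponent -/
lemma ker_even {φ : Eu m × Eu k → ℝ} (h1 : ContDiff ℝ (⊤ : ℕ∞) φ)
    {ρ : ℝ} (hφ : ∀ ξ, ρ < ‖ξ‖ → φ ξ = 0) (L : ℕ) (a : ℕ) :
    ∃ C0, 0 ≤ C0 ∧ ∀ j : ℕ, ∃ K, Ker L (2 * a) ρ C0 j
      (fun ξ => ((jb ξ ^ ((2 * a : ℝ) / 2) * φ (((2:ℝ) ^ j)⁻¹ • ξ) : ℝ) : ℂ)) K := by
  have hbase : ContDiff ℝ (⊤ : ℕ∞) (fun p : ℝ × (Eu m × Eu k) => p.1 ^ 2 + ‖p.2.1‖ ^ 2 + ‖p.2.2‖ ^ 2) := by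
    refine ((contDiff_fst.pow 2).add ?_).add ?_
    · exact (contDiff_norm_sq ℝ).comp (contDiff_fst.comp contDiff_snd)
    · exact (contDiff_norm_sq ℝ).comp (contDiff_snd.comp contDiff_snd)
  obtain ⟨C2, hC2, hk2⟩ := dyadic (fun p : ℝ × (Eu m × Eu k) =>
      (((p.1 ^ 2 + ‖p.2.1‖ ^ 2 + ‖p.2.2‖ ^ 2) ^ a * φ p.2 : ℝ) : ℂ))
    (Complex.ofRealCLM.contDiff.comp ((hbase.pow a).mul (h1.comp contDiff_snd))) ρ
    (fun ε ξ h => by simp [hφ ξ h]) L (2 * a)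
  refine ⟨C2, hC2, fun j => ?_⟩
  obtain ⟨K, hK⟩ := hk2 j
  refine ⟨K, ?_⟩
  convert hK using 2 with ξ
  rw [← Complex.ofReal_mul, ← mul_assoc]
  congr 2
  set q : ℝ := 2 ^ j
  have hq0 : 0 < q := by positivity
  have e : q ^ (2 * a : ℝ) = (q ^ 2) ^ a := by
    rw [← pow_mul, ← Real.rpow_natCast]; push_cast; rfl
  rw [e, ← mul_pow, mul_div_cancel_left₀ _ two_ne_zero, Real.rpow_natCast]
  congr 1
  simp only [jb, Prod.smul_fst, Prod.smul_snd, norm_smul, Real.norm_of_nonneg (inv_nonneg.2 hq0.le)]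
  field_simp
end KP
namespace KP
variable {m k : ℕ}

lemma conv_est {N : (Eu m × Eu k → ℝ≥0∞) → ℝ≥0∞} (hN : LN 1 N) : ∃ (L : ℕ) (C : ℝ), 0 < C ∧
    ∀ (t C0 : ℝ) (j : ℕ) (K f : Eu m × Eu k → ℂ), 0 ≤ C0 → Continuous K →
      (∀ y, ‖K y‖ ≤ C0 * ((2:ℝ) ^ j) ^ t * ((2:ℝ) ^ j) ^ (m + k) * ((1 + 2 ^ j * ‖y‖) ^ L)⁻¹) →
      Measurable f →
      N (fun x => ‖∫ y, K y * f (x - y)‖ₑ) ≤ ENNReal.ofReal (C * (C0 * ((2:ℝ) ^ j) ^ t)) * N (fun x => ‖f x‖ₑ) := by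
  obtain ⟨M, C1, hC1, htr⟩ := hN.trans
  obtain ⟨C, hC, hm⟩ := main_est one_pos hN M (M + (m + k + 1)) (by push_cast; linarith)
  refine ⟨M + (m + k + 1), C * (C1 + 1), by positivity, fun t C0 j K f hC0 hK hb hf => ?_⟩
  have := hm j t C0 K (fun p => f (p.1 - p.2)) (ENNReal.ofReal C1 * N (fun x => ‖f x‖ₑ)) 1 hC0 hK hb
    (by fun_prop) (fun x => by simp) (fun y => by
      refine (htr (fun x => ‖f x‖ₑ) y).trans ?_
      rw [← mul_assoc, ← ENNReal.ofReal_mul (by positivity), mul_comm C1]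
      gcongr
      have : (1:ℝ) ≤ 2 ^ j := one_le_pow₀ one_le_two
      nlinarith [norm_nonneg y])
  simp only [ENNReal.rpow_one, one_mul, sub_self, Real.rpow_zero, inv_one, mul_one, Real.rpow_one] at this
  refine this.trans ?_
  rw [← mul_assoc, ← ENNReal.ofReal_mul (by positivity)]
  have h0 : 0 ≤ C0 * ((2:ℝ) ^ j) ^ t := by positivity
  refine mul_le_mul' (ENNReal.ofReal_le_ofReal ?_) le_rfl
  nlinarith [mul_nonneg hC.le h0]

lemma mult_est {N : (Eu m × Eu k → ℝ≥0∞) → ℝ≥0∞} (hN : LN 1 N) : ∃ (L : ℕ) (C : ℝ), 0 < C ∧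
    ∀ (t ρ C0 : ℝ) (j : ℕ) (σ K u : Eu m × Eu k → ℂ), 0 ≤ C0 → Ker L t ρ C0 j σ K → Integrable u →
      N (fun x => ‖IF (fun ξ => σ ξ * u ξ) x‖ₑ) ≤
        ENNReal.ofReal (C * (C0 * ((2:ℝ) ^ j) ^ t)) * N (fun x => ‖IF u x‖ₑ) := by
  obtain ⟨L, C, hC, h⟩ := conv_est hN
  refine ⟨L, C, hC, fun t ρ C0 j σ K u hC0 hK hu => ?_⟩
  have := h t C0 j K (IF u) hC0 hK.cont hK.bd (continuous_IF hu).measurable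
  simp_rw [conv_IF hu hK.int, hK.ft] at this
  exact this

/-- bump -/
def chiB (m k : ℕ) : ContDiffBump (0 : Eu m × Eu k) := ⟨1, 2, one_pos, one_lt_two⟩
/-- bump function -/
def chi (ξ : Eu m × Eu k) : ℝ := chiB m k ξ

lemma chi_cd : ContDiff ℝ (⊤ : ℕ∞) (chi : Eu m × Eu k → ℝ) := (chiB m k).contDiff
lemma chi_one {ξ : Eu m × Eu k} (h : ‖ξ‖ ≤ 1) : chi ξ = 1 :=
  (chiB m k).one_of_mem_closedBall (by rw [Metric.mem_closedBall, dist_zero_right]; exact h)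
lemma chi_zero {ξ : Eu m × Eu k} (h : 2 ≤ ‖ξ‖) : chi ξ = 0 :=
  (chiB m k).zero_of_le_dist (by rw [dist_zero_right]; exact h)
lemma chi_nonneg (ξ : Eu m × Eu k) : 0 ≤ chi ξ := (chiB m k).nonneg
lemma chi_le (ξ : Eu m × Eu k) : chi ξ ≤ 1 := (chiB m k).le_one
lemma chi_zero' {ξ : Eu m × Eu k} {a : ℝ} (ha : 0 ≤ a) (h : 2 ≤ a * ‖ξ‖) : chi (a • ξ) = 0 :=
  chi_zero (by rwa [norm_smul, Real.norm_of_nonneg ha])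
lemma chi_one' {ξ : Eu m × Eu k} {a : ℝ} (ha : 0 ≤ a) (h : a * ‖ξ‖ ≤ 1) : chi (a • ξ) = 1 :=
  chi_one (by rwa [norm_smul, Real.norm_of_nonneg ha])
lemma chi_cd' (a : ℝ) : ContDiff ℝ (⊤ : ℕ∞) (fun ξ : Eu m × Eu k => chi (a • ξ)) :=
  chi_cd.comp (contDiff_const_smul a)

/-- Littlewood–Paley pieces -/
def psi (j : ℕ) (ξ : Eu m × Eu k) : ℝ := cut chi (fun ξ => chi ξ - chi ((2:ℝ) • ξ)) j ξ
/-- fattened pieces -/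
def th (j : ℕ) (ξ : Eu m × Eu k) : ℝ :=
  cut (fun ξ => chi ((4⁻¹:ℝ) • ξ)) (fun ξ => chi ((4⁻¹:ℝ) • ξ) - chi ((8:ℝ) • ξ)) j ξ

lemma psi_ker (L : ℕ) (t : ℝ) : ∃ C0, 0 ≤ C0 ∧ ∀ j : ℕ, ∃ K : Eu m × Eu k → ℂ,
    Ker L t 8 C0 j (fun ξ => ((jb ξ ^ (t / 2) * psi j ξ : ℝ) : ℂ)) K := by
  refine ker_cut (δ := 2⁻¹) chi_cd (chi_cd.sub (chi_cd' 2)) (by norm_num) (fun ξ h => chi_zero (by linarith))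
    (fun ξ h => ?_) (fun ξ h => ?_) L t
  · rw [chi_zero (by linarith), chi_zero' (by norm_num) (by linarith), sub_zero]
  · rw [chi_one (by linarith), chi_one' (by norm_num) (by linarith), sub_self]

lemma th_aux (ξ : Eu m × Eu k) (h : 8 < ‖ξ‖) :
    chi ((4⁻¹:ℝ) • ξ) = 0 ∧ chi ((4⁻¹:ℝ) • ξ) - chi ((8:ℝ) • ξ) = 0 := by
  rw [chi_zero' (by norm_num) (by linarith), chi_zero' (by norm_num) (by linarith)]; simp

lemma th_ker (L : ℕ) (t : ℝ) : ∃ C0, 0 ≤ C0 ∧ ∀ j : ℕ, ∃ K : Eu m × Eu k → ℂ,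
    Ker L t 8 C0 j (fun ξ => ((jb ξ ^ (t / 2) * th j ξ : ℝ) : ℂ)) K := by
  refine ker_cut (δ := 8⁻¹) (chi_cd' _) ((chi_cd' _).sub (chi_cd' _)) (by norm_num) (fun ξ h => (th_aux ξ h).1)
    (fun ξ h => (th_aux ξ h).2) (fun ξ h => ?_) L t
  rw [chi_one' (by norm_num) (by linarith), chi_one' (by norm_num) (by linarith), sub_self]

lemma norm_dil (j : ℕ) (ξ : Eu m × Eu k) : ‖((2:ℝ) ^ j)⁻¹ • ξ‖ = ‖ξ‖ / 2 ^ j := by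
  rw [norm_smul, Real.norm_of_nonneg (by positivity)]; ring

lemma psi_supp {j : ℕ} {ξ : Eu m × Eu k} (h : psi j ξ ≠ 0) :
    ‖ξ‖ ≤ 2 * 2 ^ j ∧ (j ≠ 0 → (2:ℝ) ^ j / 2 ≤ ‖ξ‖) := by
  have hq : (0:ℝ) < 2 ^ j := by positivity
  unfold psi cut at h
  split_ifs at h with hj
  · subst hj
    refine ⟨?_, by simp⟩
    by_contra h2
    exact h (chi_zero (by simp at h2; linarith))
  · refine ⟨?_, fun _ => ?_⟩
    · by_contra h2
      refine h ?_
      have : 2 ≤ ‖((2:ℝ) ^ j)⁻¹ • ξ‖ := by rw [norm_dil, le_div_iff₀ hq]; linarith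
      simp only
      rw [chi_zero this, chi_zero' (by norm_num) (by linarith), sub_zero]
    · by_contra h2
      refine h ?_
      have : ‖((2:ℝ) ^ j)⁻¹ • ξ‖ ≤ 1 / 2 := by rw [norm_dil, div_le_iff₀ hq]; linarith
      simp only
      rw [chi_one (by linarith), chi_one' (by norm_num) (by linarith), sub_self]

lemma th_one {j : ℕ} {ξ : Eu m × Eu k} (h1 : ‖ξ‖ ≤ 4 * 2 ^ j) (h2 : j ≠ 0 → (2:ℝ) ^ j / 4 ≤ ‖ξ‖) :
    th j ξ = 1 := by
  have hq : (0:ℝ) < 2 ^ j := by positivity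
  unfold th cut
  split_ifs with hj
  · subst hj
    exact chi_one' (by norm_num) (by simp at h1; linarith)
  · have h2 := h2 hj
    have a : ‖((2:ℝ) ^ j)⁻¹ • ξ‖ ≤ 4 := by rw [norm_dil, div_le_iff₀ hq]; linarith
    have b : 1 / 4 ≤ ‖((2:ℝ) ^ j)⁻¹ • ξ‖ := by rw [norm_dil, le_div_iff₀ hq]; linarith
    simp only
    rw [chi_one' (by norm_num) (by linarith), chi_zero' (by norm_num) (by linarith), sub_zero]

lemma th_psi (j : ℕ) (ξ : Eu m × Eu k) : th j ξ * psi j ξ = psi j ξ := by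
  by_cases h : psi j ξ = 0
  · simp [h]
  · obtain ⟨h1, h2⟩ := psi_supp h
    have hq : (0:ℝ) < 2 ^ j := by positivity
    rw [th_one (by linarith) (fun hj => by have := h2 hj; linarith), one_mul]

lemma sum_psi (J : ℕ) (ξ : Eu m × Eu k) :
    ∑ j ∈ Finset.range (J + 1), psi j ξ = chi (((2:ℝ) ^ J)⁻¹ • ξ) := by
  induction J with
  | zero => simp [psi, cut]
  | succ J ih =>
    rw [Finset.sum_range_succ, ih]
    simp only [psi, cut, Nat.succ_ne_zero, if_false, smul_smul]
    rw [show (2:ℝ) * (2 ^ (J + 1))⁻¹ = (2 ^ J)⁻¹ by rw [pow_succ]; field_simp]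
    ring

lemma continuous_chi : Continuous (chi : Eu m × Eu k → ℝ) := chi_cd.continuous
@[fun_prop] lemma continuous_psi (j : ℕ) : Continuous (psi j : Eu m × Eu k → ℝ) := by
  have := continuous_chi (m := m) (k := k)
  unfold psi cut
  split_ifs <;> fun_prop
lemma psi_le (j : ℕ) (ξ : Eu m × Eu k) : ‖((psi j ξ : ℝ) : ℂ)‖ ≤ 1 := by
  rw [Complex.norm_real, Real.norm_eq_abs]
  unfold psi cut
  have h1 := chi_nonneg (m := m) (k := k)
  have h2 := chi_le (m := m) (k := k)
  split_ifs
  · rw [abs_of_nonneg (h1 _)]; exact h2 _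
  · exact abs_le.2 ⟨by linarith [h1 ((((2:ℝ) ^ j)⁻¹) • ξ), h2 ((2:ℝ) • (((2:ℝ) ^ j)⁻¹) • ξ)],
      by linarith [h2 ((((2:ℝ) ^ j)⁻¹) • ξ), h1 ((2:ℝ) • (((2:ℝ) ^ j)⁻¹) • ξ)]⟩

lemma psi_int (j : ℕ) {u : Eu m × Eu k → ℂ} (hu : Integrable u) :
    Integrable (fun ξ => ((psi j ξ : ℝ) : ℂ) * u ξ) := by
  refine hu.bdd_mul (c := 1) ?_ (Filter.Eventually.of_forall fun ξ => psi_le j ξ)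
  exact Continuous.aestronglyMeasurable (by fun_prop)

/-- bracket power as a complex number -/
def jc (s : ℝ) (ξ : Eu m × Eu k) : ℂ := ((jb ξ ^ (s / 2) : ℝ) : ℂ)

@[fun_prop] lemma continuous_jb : Continuous (jb : Eu m × Eu k → ℝ) := by unfold jb; fun_prop
@[fun_prop] lemma continuous_jc (s : ℝ) : Continuous (jc s : Eu m × Eu k → ℂ) := by
  unfold jc
  refine Complex.continuous_ofReal.comp (Continuous.rpow_const (by fun_prop) fun ξ => Or.inl (jb_pos ξ).ne')

/-- (i) -/
lemma est_i {N : (Eu m × Eu k → ℝ≥0∞) → ℝ≥0∞} (hN : LN 1 N) : ∃ C : ℝ, 0 < C ∧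
    ∀ (j : ℕ) (u : Eu m × Eu k → ℂ), Integrable u →
      N (fun x => ‖IF (fun ξ => ((psi j ξ : ℝ) : ℂ) * u ξ) x‖ₑ) ≤ ENNReal.ofReal C * N (fun x => ‖IF u x‖ₑ) := by
  obtain ⟨L, C, hC, h⟩ := mult_est hN
  obtain ⟨C0, hC0, hk⟩ := psi_ker (m := m) (k := k) L 0
  refine ⟨C * (C0 + 1), by positivity, fun j u hu => ?_⟩
  obtain ⟨K, hK⟩ := hk j
  have := h _ _ _ j _ K u hC0 hK hu
  simp only [zero_div, Real.rpow_zero, one_mul, mul_one] at this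
  refine this.trans ?_
  gcongr; linarith

/-- (ii) -/
lemma est_ii {N : (Eu m × Eu k → ℝ≥0∞) → ℝ≥0∞} (hN : LN 1 N) (s : ℝ) : ∃ C : ℝ, 0 < C ∧
    ∀ (j : ℕ) (u : Eu m × Eu k → ℂ), Integrable (fun ξ => jc s ξ * u ξ) →
      N (fun x => ‖IF (fun ξ => ((psi j ξ : ℝ) : ℂ) * u ξ) x‖ₑ) ≤
        ENNReal.ofReal (C * (((2:ℝ) ^ j) ^ s)⁻¹) * N (fun x => ‖IF (fun ξ => jc s ξ * u ξ) x‖ₑ) := by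
  obtain ⟨L, C, hC, h⟩ := mult_est hN
  obtain ⟨C0, hC0, hk⟩ := psi_ker (m := m) (k := k) L (-s)
  refine ⟨C * (C0 + 1), by positivity, fun j u hu => ?_⟩
  obtain ⟨K, hK⟩ := hk j
  have := h _ _ _ j _ K _ hC0 hK hu
  have e : ∀ ξ : Eu m × Eu k, ((jb ξ ^ (-s / 2) * psi j ξ : ℝ) : ℂ) * (jc s ξ * u ξ) =
      ((psi j ξ : ℝ) : ℂ) * u ξ := by
    intro ξ
    have : (((jb ξ ^ (-s / 2) : ℝ)) : ℂ) * jc s ξ = 1 := by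
      rw [jc, ← Complex.ofReal_mul, ← Real.rpow_add (jb_pos ξ)]; ring_nf; simp
    push_cast
    linear_combination (((psi j ξ : ℝ) : ℂ) * u ξ) * this
  simp_rw [e] at this
  refine this.trans ?_
  rw [Real.rpow_neg (by positivity), mul_assoc]
  gcongr; linarith

/-- (iii) -/
lemma est_iii {N : (Eu m × Eu k → ℝ≥0∞) → ℝ≥0∞} (hN : LN 1 N) (s : ℝ) : ∃ C : ℝ, 0 < C ∧
    ∀ (j : ℕ) (u : Eu m × Eu k → ℂ), Integrable u →
      N (fun x => ‖IF (fun ξ => jc s ξ * (((psi j ξ : ℝ) : ℂ) * u ξ)) x‖ₑ) ≤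
        ENNReal.ofReal (C * ((2:ℝ) ^ j) ^ s) * N (fun x => ‖IF (fun ξ => ((psi j ξ : ℝ) : ℂ) * u ξ) x‖ₑ) := by
  obtain ⟨L, C, hC, h⟩ := mult_est hN
  obtain ⟨C0, hC0, hk⟩ := th_ker (m := m) (k := k) L s
  refine ⟨C * (C0 + 1), by positivity, fun j u hu => ?_⟩
  obtain ⟨K, hK⟩ := hk j
  have := h _ _ _ j _ K _ hC0 hK (psi_int j hu)
  have e : ∀ ξ : Eu m × Eu k, ((jb ξ ^ (s / 2) * th j ξ : ℝ) : ℂ) * (((psi j ξ : ℝ) : ℂ) * u ξ) =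
      jc s ξ * (((psi j ξ : ℝ) : ℂ) * u ξ) := by
    intro ξ
    have : ((th j ξ : ℝ) : ℂ) * ((psi j ξ : ℝ) : ℂ) = ((psi j ξ : ℝ) : ℂ) := by
      rw [← Complex.ofReal_mul, th_psi]
    push_cast
    rw [jc]
    linear_combination (((jb ξ ^ (s / 2) : ℝ) : ℂ) * u ξ) * this
  simp_rw [e] at this
  refine this.trans ?_
  rw [mul_assoc]
  gcongr; linarith

lemma schwartz_diff (Ψ : SchwartzMap (Eu m × Eu k) ℂ) (L : ℕ) : ∃ C : ℝ, 0 ≤ C ∧ ∀ y z,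
    ‖Ψ (z - y) - Ψ z‖ ≤ C * (‖y‖ * (1 + ‖y‖) ^ L) * ((1 + ‖z‖) ^ L)⁻¹ := by
  obtain ⟨C, hC⟩ : ∃ C : ℝ, ∀ z, (1 + ‖z‖) ^ L * ‖fderiv ℝ Ψ z‖ ≤ C := by
    refine ⟨2 ^ L * ((Finset.Iic (L, 1)).sup fun m' => SchwartzMap.seminorm ℝ m'.1 m'.2) Ψ, fun z => ?_⟩
    have := SchwartzMap.one_add_le_sup_seminorm_apply (𝕜 := ℝ) (m := (L, 1)) (k := L) (n := 1)
      le_rfl le_rfl Ψ z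
    rwa [norm_iteratedFDeriv_one] at this
  have hC0 : 0 ≤ C := le_trans (by positivity) (hC 0)
  refine ⟨C, hC0, fun y z => ?_⟩
  have hz : 0 < (1 + ‖z‖) := by positivity
  have hmv := (convex_segment (𝕜 := ℝ) z (z - y)).norm_image_sub_le_of_norm_fderiv_le (𝕜 := ℝ) (f := Ψ)
    (C := C * (1 + ‖y‖) ^ L * ((1 + ‖z‖) ^ L)⁻¹)
    (fun w _ => Ψ.differentiableAt) (fun w hw => ?_) (left_mem_segment ℝ z (z - y))
    (right_mem_segment ℝ z (z - y))
  · refine hmv.trans (le_of_eq ?_)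
    rw [sub_sub_cancel_left, norm_neg]; ring
  · have hw1 : ‖w - z‖ ≤ ‖y‖ := by
      obtain ⟨a, ha, rfl⟩ := (segment_eq_image' ℝ z (z - y)).subset hw
      simp only [sub_sub_cancel_left, add_sub_cancel_left, smul_neg, norm_neg, norm_smul,
        Real.norm_of_nonneg ha.1]
      exact mul_le_of_le_one_left (norm_nonneg y) ha.2
    have hzw : 1 + ‖z‖ ≤ (1 + ‖y‖) * (1 + ‖w‖) := by
      have : ‖z‖ ≤ ‖w‖ + ‖w - z‖ := by
        have := norm_sub_le w (w - z); simpa using this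
      nlinarith [norm_nonneg y, norm_nonneg w]
    have h3 := hC w
    rw [← div_eq_mul_inv, le_div_iff₀ (by positivity)]
    calc ‖fderiv ℝ Ψ w‖ * (1 + ‖z‖) ^ L ≤ ‖fderiv ℝ Ψ w‖ * ((1 + ‖y‖) * (1 + ‖w‖)) ^ L := by gcongr
      _ = ((1 + ‖w‖) ^ L * ‖fderiv ℝ Ψ w‖) * (1 + ‖y‖) ^ L := by rw [mul_pow]; ring
      _ ≤ _ := by gcongr

lemma diff_aux {φ : Eu m × Eu k → ℝ} (h1 : ContDiff ℝ (⊤ : ℕ∞) φ) {ρ : ℝ}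
    (hφ : ∀ ξ, ρ < ‖ξ‖ → φ ξ = 0) (L : ℕ) : ∃ C : ℝ, 0 ≤ C ∧ ∀ l : ℕ, ∃ κ : Eu m × Eu k → ℂ,
    Continuous κ ∧ Integrable κ ∧ (∀ ξ, FT2 κ ξ = ((φ (((2:ℝ) ^ l)⁻¹ • ξ) : ℝ) : ℂ)) ∧ ∀ y z,
      ‖κ (z - y) - κ z‖ ≤ C * ((2 ^ l * ‖y‖) * (1 + 2 ^ l * ‖y‖) ^ L) * ((2:ℝ) ^ l) ^ (m + k) *
        ((1 + 2 ^ l * ‖z‖) ^ L)⁻¹ := by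
  have hs : ContDiff ℝ (⊤ : ℕ∞) (fun ξ => ((φ ξ : ℝ) : ℂ)) := Complex.ofRealCLM.contDiff.comp h1
  have hc : HasCompactSupport (fun ξ => ((φ ξ : ℝ) : ℂ)) := by
    refine HasCompactSupport.of_support_subset_isCompact (isCompact_closedBall 0 ρ) ?_
    intro ξ hξ
    simp only [Function.mem_support] at hξ
    simp only [Metric.mem_closedBall, dist_zero_right]
    by_contra h
    exact hξ (by rw [hφ _ (not_le.1 h)]; simp)
  obtain ⟨Ψ, -, h2⟩ := schwartz_IF (hc.toSchwartzMap hs)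
  have h2' : ∀ ξ, FT2 Ψ ξ = ((φ ξ : ℝ) : ℂ) := h2
  obtain ⟨C, hC, hd⟩ := schwartz_diff Ψ L
  refine ⟨C, hC, fun l => ?_⟩
  have hq0 : (0:ℝ) < 2 ^ l := by positivity
  refine ⟨fun y => ((((2:ℝ) ^ l) ^ (m + k) : ℝ) : ℂ) * Ψ ((2:ℝ) ^ l • y), ?_, integrable_scale Ψ.integrable hq0 _,
    fun ξ => ?_, fun y z => ?_⟩
  · have := Ψ.continuous
    fun_prop
  · rw [FT2_scale _ hq0, h2']
  · simp only [← mul_sub]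
    rw [norm_mul, Complex.norm_real, Real.norm_of_nonneg (by positivity), smul_sub]
    have := hd ((2:ℝ) ^ l • y) ((2:ℝ) ^ l • z)
    simp only [norm_smul, Real.norm_of_nonneg hq0.le] at this
    calc _ ≤ ((2:ℝ) ^ l) ^ (m + k) * (C * (2 ^ l * ‖y‖ * (1 + 2 ^ l * ‖y‖) ^ L) * ((1 + 2 ^ l * ‖z‖) ^ L)⁻¹) := by gcongr
      _ = _ := by ring

/-- (iv) -/
lemma est_iv {N : (Eu m × Eu k → ℝ≥0∞) → ℝ≥0∞} (hN : LN 1 N) : ∃ (L : ℕ) (C : ℝ), 0 < C ∧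
    ∀ (l : ℕ) (u : Eu m × Eu k → ℂ), Integrable u → ∀ y,
      N (fun x => ‖IF (fun ξ => ((psi l ξ : ℝ) : ℂ) * u ξ) (x - y) - IF (fun ξ => ((psi l ξ : ℝ) : ℂ) * u ξ) x‖ₑ) ≤
        ENNReal.ofReal (C * ((2 ^ l * ‖y‖) * (1 + 2 ^ l * ‖y‖) ^ L)) *
          N (fun x => ‖IF (fun ξ => ((psi l ξ : ℝ) : ℂ) * u ξ) x‖ₑ) := by
  obtain ⟨L, C, hC, h⟩ := conv_est hN
  obtain ⟨C1, hC1, hk1⟩ := diff_aux (m := m) (k := k) (ρ := 8) (chi_cd' (4⁻¹:ℝ)) (fun ξ h => (th_aux ξ h).1) L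
  obtain ⟨C2, hC2, hk2⟩ := diff_aux (m := m) (k := k) (ρ := 8) ((chi_cd' (4⁻¹:ℝ)).sub (chi_cd' 8))
    (fun ξ h => (th_aux ξ h).2) L
  refine ⟨L, C * (max C1 C2 + 1), by positivity, fun l u hu y => ?_⟩
  obtain ⟨κ, hκc, hκi, hκf, hκd⟩ : ∃ κ : Eu m × Eu k → ℂ,
    Continuous κ ∧ Integrable κ ∧ (∀ ξ, FT2 κ ξ = ((th l ξ : ℝ) : ℂ)) ∧ ∀ y z,
      ‖κ (z - y) - κ z‖ ≤ max C1 C2 * ((2 ^ l * ‖y‖) * (1 + 2 ^ l * ‖y‖) ^ L) * ((2:ℝ) ^ l) ^ (m + k) *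
        ((1 + 2 ^ l * ‖z‖) ^ L)⁻¹ := by
    by_cases hl : l = 0
    · subst hl
      obtain ⟨κ, h1, h2, h3, h4⟩ := hk1 0
      refine ⟨κ, h1, h2, fun ξ => ?_, fun y z => (h4 y z).trans ?_⟩
      · rw [h3]; simp [th, cut]
      · gcongr; exact le_max_left _ _
    · obtain ⟨κ, h1, h2, h3, h4⟩ := hk2 l
      refine ⟨κ, h1, h2, fun ξ => ?_, fun y z => (h4 y z).trans ?_⟩
      · rw [h3]; simp [th, cut, hl]
      · gcongr; exact le_max_right _ _
  set w : Eu m × Eu k → ℂ := fun ξ => ((psi l ξ : ℝ) : ℂ) * u ξ with hw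
  have hwi : Integrable w := psi_int l hu
  have hrep : ∀ x, ∫ z, κ z * IF w (x - z) = IF w x := by
    intro x
    rw [conv_IF hwi hκi]
    congr 1; ext ξ
    rw [hκf, hw]
    simp only
    rw [← mul_assoc, ← Complex.ofReal_mul, th_psi]
  have hbd : ∃ B, ∀ x, ‖IF w x‖ ≤ B := by
    refine ⟨∫ ω, ‖w ω‖, fun y => ?_⟩
    refine (norm_integral_le_integral_norm _).trans (le_of_eq ?_)
    congr 1; ext ω; simp
  obtain ⟨B, hB⟩ := hbd
  have hcw := continuous_IF hwi
  have hint : ∀ (κ' : Eu m × Eu k → ℂ) x, Integrable κ' → Integrable (fun z => κ' z * IF w (x - z)) :=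
    fun κ' x hκ' => hκ'.mul_bdd (c := B) (by fun_prop) (Filter.Eventually.of_forall fun z => hB _)
  have hκy : Integrable (fun z => κ (z - y)) := hκi.comp_sub_right y
  have hmain : ∀ x, ∫ z, (κ (z - y) - κ z) * IF w (x - z) = IF w (x - y) - IF w x := by
    intro x
    simp_rw [sub_mul]
    rw [integral_sub (hint _ x hκy) (hint _ x hκi), hrep x, ← hrep (x - y)]
    congr 1
    rw [← integral_sub_right_eq_self (fun z => κ z * IF w (x - y - z)) y]
    congr 1; ext z
    rw [sub_sub_sub_cancel_right]
  have := h 0 (max C1 C2 * ((2 ^ l * ‖y‖) * (1 + 2 ^ l * ‖y‖) ^ L)) l (fun z => κ (z - y) - κ z) (IF w)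
    (by positivity) (by fun_prop) (fun z => by simpa using hκd y z) hcw.measurable
  simp_rw [hmain] at this
  refine this.trans ?_
  rw [Real.rpow_zero, mul_one, mul_assoc C]
  gcongr; linarith
end KP
namespace KP
variable {m k : ℕ}

lemma LN.tri {r : ℝ} (hr : 0 < r) (hr1 : r ≤ 1) {N : (Eu m × Eu k → ℝ≥0∞) → ℝ≥0∞} (hN : LN r N)
    {ι : Type} [Fintype ι] {u : Eu m × Eu k → ℝ≥0∞} {H : ι → Eu m × Eu k → ℝ≥0∞}
    (hH : ∀ i, Measurable (H i)) (hu : ∀ x, u x ≤ ∑ i, H i x) : N u ^ r ≤ ∑ i, N (H i) ^ r := by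
  have := hN.tsum hr (u := u) hH (fun x => by
    refine le_trans ?_ (rpow_tsum_le hr hr1 _)
    rw [tsum_fintype]
    gcongr; exact hu x)
  rwa [tsum_fintype] at this

lemma LN.add {r : ℝ} (hr : 0 < r) (hr1 : r ≤ 1) {N : (Eu m × Eu k → ℝ≥0∞) → ℝ≥0∞} (hN : LN r N)
    {u A B : Eu m × Eu k → ℂ} (hA : Continuous A) (hB : Continuous B) (hu : ∀ x, u x = A x - B x) :
    N (fun x => ‖u x‖ₑ) ^ r ≤ N (fun x => ‖A x‖ₑ) ^ r + N (fun x => ‖B x‖ₑ) ^ r := by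
  have := hN.tri hr hr1 (u := fun x => ‖u x‖ₑ) (H := fun (b : Bool) x => if b then ‖A x‖ₑ else ‖B x‖ₑ)
    (fun b => by cases b <;> simp <;> fun_prop) (fun x => by
      rw [hu x]; simp only [Fintype.sum_bool]; exact enorm_sub_le)
  simpa using this

lemma bil_est {r : ℝ} (hr : 0 < r) (hr1 : r ≤ 1) {N : (Eu m × Eu k → ℝ≥0∞) → ℝ≥0∞} (hN : LN r N) (M L : ℕ)
    (hL : (M : ℝ) * r + (m + k + 1 : ℕ) ≤ L * r) : ∃ C : ℝ, 0 < C ∧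
    ∀ (i j : ℕ) (t C0 : ℝ) (K : Eu m × Eu k → ℂ) (H : (Eu m × Eu k) × (Eu m × Eu k) → ℂ)
      (D : ℝ≥0∞), 0 ≤ C0 → Continuous K →
      (∀ y, ‖K y‖ ≤ C0 * ((2:ℝ) ^ i) ^ t * ((2:ℝ) ^ i) ^ (m + k) * ((1 + 2 ^ i * ‖y‖) ^ L)⁻¹) →
      Measurable H →
      (∀ x, Integrable (fun y => K y * H (x, y))) →
      (∀ x, Rep (64 * 2 ^ j) (fun y => K y * H (x, y))) →
      (∀ y, N (fun x => ‖H (x, y)‖ₑ) ≤ ENNReal.ofReal ((1 + 2 ^ i * ‖y‖) ^ M) * D) →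
      N (fun x => ‖∫ y, K y * H (x, y)‖ₑ) ^ r ≤
        ENNReal.ofReal (C * (C0 * ((2:ℝ) ^ i) ^ t) ^ r * ((2:ℝ) ^ j / 2 ^ i) ^ (((m + k : ℕ) : ℝ) * (1 - r)))
          * D ^ r := by
  obtain ⟨C1, hC1, h1⟩ := main_est hr hN M L hL
  obtain ⟨C2, hC2, h2⟩ := nikolskii (m := m) (k := k) hr hr1
  refine ⟨C1 * (C2 * ((64:ℝ) ^ (m + k)) ^ (1 - r)), by positivity, fun i j t C0 K H D hC0 hK hb hH hi hrep hD => ?_⟩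
  have := h1 i t C0 K H D _ hC0 hK hb hH (fun x => h2 (64 * 2 ^ j) (by positivity) _ (hrep x) (hi x).2.ne) hD
  refine this.trans (le_of_eq ?_)
  rw [← ENNReal.ofReal_mul (by positivity)]
  congr 2
  rw [Real.div_rpow (by positivity) (by positivity), Real.rpow_mul (by positivity), Real.rpow_mul (by positivity),
    Real.rpow_natCast, Real.rpow_natCast, mul_pow, Real.mul_rpow (by positivity) (by positivity)]
  field_simp

lemma jb_add (ξ η : Eu m × Eu k) : jb (ξ + η) ≤ 2 * (jb ξ * jb η) := by
  unfold jb
  have h1 := norm_add_le ξ.1 η.1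
  have h2 := norm_add_le ξ.2 η.2
  simp only [Prod.fst_add, Prod.snd_add]
  have h3 : ‖ξ.1 + η.1‖ ^ 2 ≤ 2 * ‖ξ.1‖ ^ 2 + 2 * ‖η.1‖ ^ 2 := by
    nlinarith [norm_nonneg (ξ.1 + η.1), sq_nonneg (‖ξ.1‖ - ‖η.1‖)]
  have h4 : ‖ξ.2 + η.2‖ ^ 2 ≤ 2 * ‖ξ.2‖ ^ 2 + 2 * ‖η.2‖ ^ 2 := by
    nlinarith [norm_nonneg (ξ.2 + η.2), sq_nonneg (‖ξ.2‖ - ‖η.2‖)]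
  have h5 : 0 ≤ (‖ξ.1‖ ^ 2 + ‖ξ.2‖ ^ 2) * (‖η.1‖ ^ 2 + ‖η.2‖ ^ 2) := by positivity
  nlinarith

lemma norm_jc (s : ℝ) (ξ : Eu m × Eu k) : ‖jc s ξ‖ = jb ξ ^ (s / 2) := by
  rw [jc, Complex.norm_real, Real.norm_of_nonneg (Real.rpow_nonneg (jb_pos ξ).le _)]

lemma jc_add {s : ℝ} (hs : 0 ≤ s) (ξ η : Eu m × Eu k) :
    ‖jc s (ξ + η)‖ ≤ 2 ^ (s / 2) * (‖jc s ξ‖ * ‖jc s η‖) := by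
  simp only [norm_jc]
  have h1 := jb_pos ξ; have h2 := jb_pos η; have h3 := jb_pos (ξ + η)
  rw [← Real.mul_rpow h1.le h2.le, ← Real.mul_rpow (by norm_num) (by positivity)]
  exact Real.rpow_le_rpow h3.le (jb_add ξ η) (by linarith)

/-- spectral data -/
structure Gd (s : ℝ) (v : Eu m × Eu k → ℂ) : Prop where
  i0 : Integrable v
  i1 : Integrable (fun ξ => jc s ξ * v ξ)

/-- localised data -/
def pv (j : ℕ) (v : Eu m × Eu k → ℂ) (ξ : Eu m × Eu k) : ℂ := ((psi j ξ : ℝ) : ℂ) * v ξ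

lemma Gd.psi {s : ℝ} {v : Eu m × Eu k → ℂ} (h : Gd s v) (j : ℕ) : Gd s (pv j v) := by
  refine ⟨psi_int j h.i0, (psi_int j h.i1).congr (Filter.Eventually.of_forall fun ξ => ?_)⟩
  simp only [pv]; ring

lemma pv_supp {j : ℕ} {v : Eu m × Eu k → ℂ} {ξ : Eu m × Eu k} (h : pv j v ξ ≠ 0) :
    ‖ξ‖ ≤ 2 * 2 ^ j ∧ (j ≠ 0 → (2:ℝ) ^ j / 2 ≤ ‖ξ‖) :=
  psi_supp (fun h0 => h (by simp [pv, h0]))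

/-- bilinear operator -/
def TT (s : ℝ) (u w : Eu m × Eu k → ℂ) (x : Eu m × Eu k) : ℂ :=
  ∫ p : (Eu m × Eu k) × (Eu m × Eu k), jc s (p.1 + p.2) * (u p.1 * w p.2) * ee x (p.1 + p.2)

lemma TT_int {s : ℝ} (hs : 0 ≤ s) {u w : Eu m × Eu k → ℂ} (hu : Gd s u) (hw : Gd s w) :
    Integrable (fun p : (Eu m × Eu k) × (Eu m × Eu k) => jc s (p.1 + p.2) * (u p.1 * w p.2)) := by
  have h1 : Integrable (fun p : (Eu m × Eu k) × (Eu m × Eu k) => (jc s p.1 * u p.1) * (jc s p.2 * w p.2)) :=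
    hu.i1.mul_prod hw.i1
  have h2 : Integrable (fun p : (Eu m × Eu k) × (Eu m × Eu k) => u p.1 * w p.2) :=
    hu.i0.mul_prod hw.i0
  refine (h1.const_mul (((2:ℝ) ^ (s / 2) : ℝ) : ℂ)).mono ?_ (Filter.Eventually.of_forall fun p => ?_)
  · exact (Continuous.aestronglyMeasurable (by fun_prop)).mul h2.aestronglyMeasurable
  · have := jc_add hs p.1 p.2
    simp only [norm_mul, Complex.norm_real, Real.norm_of_nonneg (show (0:ℝ) ≤ 2 ^ (s / 2) by positivity)]
    calc _ ≤ (2 ^ (s / 2) * (‖jc s p.1‖ * ‖jc s p.2‖)) * (‖u p.1‖ * ‖w p.2‖) := by gcongr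
      _ = _ := by ring

lemma IF_mul {u w : Eu m × Eu k → ℂ} (y : Eu m × Eu k) :
    IF u y * IF w y = ∫ p : (Eu m × Eu k) × (Eu m × Eu k), (u p.1 * w p.2) * ee y (p.1 + p.2) := by
  simp only [IF, Measure.volume_eq_prod]
  rw [← integral_prod_mul]
  congr 1; ext p; rw [ee_add_right]; ring

lemma conv2 {u w K : Eu m × Eu k → ℂ} (hu : Integrable u) (hw : Integrable w) (hK : Integrable K)
    (x : Eu m × Eu k) : ∫ y, K y * (IF u (x - y) * IF w (x - y)) =
      ∫ p : (Eu m × Eu k) × (Eu m × Eu k), FT2 K (p.1 + p.2) * (u p.1 * w p.2) * ee x (p.1 + p.2) := by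
  have h2 : Integrable (fun p : (Eu m × Eu k) × (Eu m × Eu k) => u p.1 * w p.2) := hu.mul_prod hw
  simp_rw [IF_mul]
  have hζ : Measurable (fun p : (Eu m × Eu k) × (Eu m × Eu k) => p.1 + p.2) := by fun_prop
  have := conv_sp (μ := (volume : Measure ((Eu m × Eu k) × (Eu m × Eu k)))) (c := fun p => u p.1 * w p.2)
    (ζ := fun p => p.1 + p.2) h2 hζ hK x
  exact this

lemma TT_conv {s : ℝ} {u w K : Eu m × Eu k → ℂ} (hu : Integrable u) (hw : Integrable w) (hK : Integrable K)
    (h : ∀ ξ η, u ξ ≠ 0 → w η ≠ 0 → FT2 K (ξ + η) = jc s (ξ + η)) (x : Eu m × Eu k) :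
    ∫ y, K y * (IF u (x - y) * IF w (x - y)) = TT s u w x := by
  rw [conv2 hu hw hK, TT]
  congr 1; ext p
  by_cases h0 : u p.1 * w p.2 = 0
  · simp [h0]
  · rw [h _ _ (left_ne_zero_of_mul h0) (right_ne_zero_of_mul h0)]

lemma TT_cont {s : ℝ} (hs : 0 ≤ s) {u w : Eu m × Eu k → ℂ} (hu : Gd s u) (hw : Gd s w) :
    Continuous (TT s u w) :=
  have hζ : Measurable (fun p : (Eu m × Eu k) × (Eu m × Eu k) => p.1 + p.2) := by fun_prop
  continuous_sp (μ := (volume : Measure ((Eu m × Eu k) × (Eu m × Eu k))))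
    (c := fun p => jc s (p.1 + p.2) * (u p.1 * w p.2)) (ζ := fun p => p.1 + p.2) (TT_int hs hu hw) hζ

lemma TT_swap (s : ℝ) (u w : Eu m × Eu k → ℂ) (x : Eu m × Eu k) : TT s u w x = TT s w u x := by
  unfold TT
  rw [Measure.volume_eq_prod, ← integral_prod_swap]
  congr 1; ext p
  simp only [Prod.fst_swap, Prod.snd_swap, add_comm p.2 p.1, mul_comm (u p.2)]

lemma IF_bdd {u : Eu m × Eu k → ℂ} : ∃ B, ∀ x, ‖IF u x‖ ≤ B := by
  refine ⟨∫ ω, ‖u ω‖, fun y => ?_⟩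
  refine (norm_integral_le_integral_norm _).trans (le_of_eq ?_)
  congr 1; ext ω; simp

lemma bdd_int {K F : Eu m × Eu k → ℂ} (hK : Integrable K) (hF : Continuous F) (hB : ∃ B, ∀ x, ‖F x‖ ≤ B) :
    Integrable (fun y => K y * F y) := by
  obtain ⟨B, hB⟩ := hB
  exact hK.mul_bdd (c := B) (by fun_prop) (Filter.Eventually.of_forall fun z => hB _)

lemma geo {β : ℝ} (hβ : 0 < β) : ∃ C : ℝ, 0 < C ∧ ∀ J : ℕ,
    ∑ i ∈ Finset.range (J + 1), ((2:ℝ) ^ i) ^ β ≤ C * ((2:ℝ) ^ J) ^ β := by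
  have h2 : 1 < (2:ℝ) ^ β := Real.one_lt_rpow one_lt_two hβ
  have h3 : 0 < (2:ℝ) ^ β - 1 := by linarith
  have hC : 1 ≤ (2:ℝ) ^ β / (2 ^ β - 1) := by rw [le_div_iff₀ h3]; linarith
  refine ⟨2 ^ β / (2 ^ β - 1), by positivity, fun J => ?_⟩
  induction J with
  | zero => simpa using hC
  | succ J ih =>
    rw [Finset.sum_range_succ]
    refine (add_le_add_left ih _).trans (le_of_eq ?_)
    rw [pow_succ, Real.mul_rpow (by positivity) (by positivity)]
    field_simp
    ring

/-- high-high interaction -/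
lemma hihi {r s : ℝ} (hr : 0 < r) (hr1 : r ≤ 1) (hs0 : 0 ≤ s)
    (hs : ((m + k : ℕ) : ℝ) * (1 - r) < s * r ∨ ∃ a : ℕ, s = 2 * a)
    {N N1 N2 : (Eu m × Eu k → ℝ≥0∞) → ℝ≥0∞} (hN : LN r N) (hN1 : LN 1 N1) (hN2 : LN 1 N2)
    (hH : ∀ F G : Eu m × Eu k → ℝ≥0∞, Measurable F → Measurable G → N (fun x => F x * G x) ≤ N1 F * N2 G) :
    ∃ C : ℝ, 0 < C ∧ ∀ (j l : ℕ) (u w : Eu m × Eu k → ℂ), l ≤ j → Gd s u → Gd s w →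
      N (fun x => ‖TT s (pv j u) (pv l w) x‖ₑ) ^ r ≤ ENNReal.ofReal (C * (((2:ℝ) ^ j) ^ s) ^ r) *
        (N1 (fun x => ‖IF (pv j u) x‖ₑ) * N2 (fun x => ‖IF (pv l w) x‖ₑ)) ^ r := by
  obtain ⟨M1, C1, hC1, htr1⟩ := hN1.trans
  obtain ⟨M2, C2, hC2, htr2⟩ := hN2.trans
  obtain ⟨L, hL⟩ : ∃ L : ℕ, ((M1 + M2 : ℕ) : ℝ) * r + (m + k + 1 : ℕ) ≤ L * r := by
    obtain ⟨L, hL⟩ := exists_nat_ge ((((M1 + M2 : ℕ) : ℝ) * r + (m + k + 1 : ℕ)) / r)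
    exact ⟨L, by rwa [div_le_iff₀ hr] at hL⟩
  obtain ⟨C3, hC3, hbil⟩ := bil_est hr hr1 hN (M1 + M2) L hL
  -- one kernel
  have key : ∀ (i j l : ℕ) (C0 : ℝ) (u w K σ : Eu m × Eu k → ℂ), l ≤ j → i ≤ j + 2 → 0 ≤ C0 → Gd s u → Gd s w →
      Ker L s 8 C0 i σ K →
      N (fun x => ‖∫ y, K y * (IF (pv j u) (x - y) * IF (pv l w) (x - y))‖ₑ) ^ r ≤
        ENNReal.ofReal (C3 * (C0 * ((2:ℝ) ^ i) ^ s) ^ r * ((2:ℝ) ^ j / 2 ^ i) ^ (((m + k : ℕ) : ℝ) * (1 - r)) *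
          (C1 * C2) ^ r) *
        (N1 (fun x => ‖IF (pv j u) x‖ₑ) * N2 (fun x => ‖IF (pv l w) x‖ₑ)) ^ r := by
    intro i j l C0 u w K σ hlj hij hC0 hu hw hK
    have cu := continuous_IF (hu.psi j).i0
    have cw := continuous_IF (hw.psi l).i0
    have := hbil i j s C0 K (fun p => IF (pv j u) (p.1 - p.2) * IF (pv l w) (p.1 - p.2))
      (ENNReal.ofReal (C1 * C2) * (N1 (fun x => ‖IF (pv j u) x‖ₑ) * N2 (fun x => ‖IF (pv l w) x‖ₑ))) hC0
      hK.cont hK.bd (Continuous.measurable (by fun_prop)) (fun x => ?_) (fun x => ?_) (fun y => ?_)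
    · refine this.trans (le_of_eq ?_)
      rw [ENNReal.mul_rpow_of_nonneg _ _ hr.le, ENNReal.ofReal_rpow_of_nonneg (by positivity) hr.le, ← mul_assoc,
        ← ENNReal.ofReal_mul (by positivity)]
    · obtain ⟨B1, hB1⟩ := IF_bdd (u := pv j u)
      obtain ⟨B2, hB2⟩ := IF_bdd (u := pv l w)
      refine bdd_int hK.int (by fun_prop) ⟨B1 * B2, fun y => ?_⟩
      rw [norm_mul]
      exact mul_le_mul (hB1 _) (hB2 _) (norm_nonneg _) (le_trans (norm_nonneg _) (hB1 0))
    · refine (BL.mono ((hK.bl).mul (((BL_IF (hu.psi j).i0 fun ξ h => (pv_supp h).1).refl x).mul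
        ((BL_IF (hw.psi l).i0 fun ξ h => (pv_supp h).1).refl x))) ?_).rep
      have h1 : (2:ℝ) ^ i ≤ 2 ^ (j + 2) := pow_le_pow_right₀ one_le_two hij
      have h2 : (2:ℝ) ^ l ≤ 2 ^ j := pow_le_pow_right₀ one_le_two hlj
      rw [pow_add] at h1
      have : (0:ℝ) < 2 ^ j := by positivity
      linarith
    · simp only [enorm_mul]
      refine (hH _ _ (Continuous.measurable (by fun_prop)) (Continuous.measurable (by fun_prop))).trans ?_
      have e1 : (1 + ‖y‖) ≤ 1 + 2 ^ i * ‖y‖ := by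
        have : (1:ℝ) ≤ 2 ^ i := one_le_pow₀ one_le_two
        nlinarith [norm_nonneg y]
      calc _ ≤ (ENNReal.ofReal (C1 * (1 + ‖y‖) ^ M1) * N1 (fun x => ‖IF (pv j u) x‖ₑ)) *
            (ENNReal.ofReal (C2 * (1 + ‖y‖) ^ M2) * N2 (fun x => ‖IF (pv l w) x‖ₑ)) :=
            mul_le_mul' (htr1 (fun x => ‖IF (pv j u) x‖ₑ) y) (htr2 (fun x => ‖IF (pv l w) x‖ₑ) y)
        _ = ENNReal.ofReal ((1 + ‖y‖) ^ (M1 + M2)) * (ENNReal.ofReal (C1 * C2) *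
            (N1 (fun x => ‖IF (pv j u) x‖ₑ) * N2 (fun x => ‖IF (pv l w) x‖ₑ))) := by
          rw [ENNReal.ofReal_mul hC1, ENNReal.ofReal_mul hC2, ENNReal.ofReal_mul hC1, pow_add,
            ENNReal.ofReal_mul (by positivity)]
          ring
        _ ≤ _ := by gcongr
  have hz : ∀ (j l : ℕ) (u w : Eu m × Eu k → ℂ) (ξ η : Eu m × Eu k), l ≤ j → pv j u ξ ≠ 0 → pv l w η ≠ 0 →
      (4⁻¹:ℝ) * ‖((2:ℝ) ^ j)⁻¹ • (ξ + η)‖ ≤ 1 := by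
    intro j l u w ξ η hlj h1 h2
    have h1 := (pv_supp h1).1
    have h2 := (pv_supp h2).1
    have h3 := norm_add_le ξ η
    have h4 : (2:ℝ) ^ l ≤ 2 ^ j := pow_le_pow_right₀ one_le_two hlj
    have h5 : (0:ℝ) < 2 ^ j := by positivity
    rw [norm_dil]
    have : ‖ξ + η‖ / 2 ^ j ≤ 4 := by rw [div_le_iff₀ h5]; linarith
    linarith
  rcases hs with hs | ⟨a, ha⟩
  · set β := s * r - ((m + k : ℕ) : ℝ) * (1 - r) with hβ
    obtain ⟨C4, hC4, hgeo⟩ := geo (β := β) (by linarith)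
    obtain ⟨C0, hC0, hk⟩ := psi_ker (m := m) (k := k) L s
    choose K hK using hk
    refine ⟨C3 * C0 ^ r * (C1 * C2) ^ r * C4 * ((2:ℝ) ^ 2) ^ β + 1, by positivity, fun j l u w hlj hu hw => ?_⟩
    have hT : ∀ x, TT s (pv j u) (pv l w) x =
        ∑ i : Fin (j + 3), ∫ y, K i y * (IF (pv j u) (x - y) * IF (pv l w) (x - y)) := by
      intro x
      rw [Fin.sum_univ_eq_sum_range (fun i => ∫ y, K i y * (IF (pv j u) (x - y) * IF (pv l w) (x - y))) (j + 3)]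
      simp_rw [conv2 (hu.psi j).i0 (hw.psi l).i0 (hK _).int, (hK _).ft]
      rw [← integral_finset_sum]
      · rw [TT]
        congr 1; ext p
        simp_rw [← Finset.sum_mul]
        congr 1
        by_cases h0 : pv j u p.1 * pv l w p.2 = 0
        · simp [h0]
        congr 1
        rw [← Complex.ofReal_sum, ← Finset.mul_sum, sum_psi (j + 2), jc]
        have := hz j l u w p.1 p.2 hlj (left_ne_zero_of_mul h0) (right_ne_zero_of_mul h0)
        rw [norm_dil] at this
        rw [chi_one' (by positivity), mul_one]
        rw [pow_add]
        have h5 : (0:ℝ) < 2 ^ j := by positivity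
        calc _ = (4⁻¹:ℝ) * (‖p.1 + p.2‖ / 2 ^ j) := by field_simp; ring
          _ ≤ 1 := this
      · intro i _
        have h1 := (TT_int hs0 (hu.psi j) (hw.psi l))
        have h2 := h1.bdd_mul (c := 1) (f := fun p => ((psi i (p.1 + p.2) : ℝ) : ℂ))
          (Continuous.aestronglyMeasurable (by fun_prop)) (Filter.Eventually.of_forall fun p => psi_le i _)
        refine (integrable_mul_ee h2 (ζ := fun p => p.1 + p.2) (by fun_prop) x).congr
          (Filter.Eventually.of_forall fun p => ?_)
        simp only [jc, Complex.ofReal_mul]; ring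
    have hm : ∀ i, Measurable (fun x => ‖∫ y, K i y * (IF (pv j u) (x - y) * IF (pv l w) (x - y))‖ₑ) := by
      intro i
      have cu := continuous_IF (hu.psi j).i0
      have cw := continuous_IF (hw.psi l).i0
      have cK := (hK i).cont
      have : StronglyMeasurable (fun p : (Eu m × Eu k) × (Eu m × Eu k) =>
        K i p.2 * (IF (pv j u) (p.1 - p.2) * IF (pv l w) (p.1 - p.2))) :=
        Continuous.stronglyMeasurable (by fun_prop)
      exact this.integral_prod_right'.measurable.enorm
    have h1 := hN.tri hr hr1 (u := fun x => ‖TT s (pv j u) (pv l w) x‖ₑ) (fun i : Fin (j + 3) => hm i) (fun x => by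
      simp only [hT x]; exact enorm_sum_le _ _)
    refine h1.trans ?_
    calc _ ≤ ∑ i : Fin (j + 3), ENNReal.ofReal (C3 * (C0 * ((2:ℝ) ^ (i:ℕ)) ^ s) ^ r *
          ((2:ℝ) ^ j / 2 ^ (i:ℕ)) ^ (((m + k : ℕ) : ℝ) * (1 - r)) * (C1 * C2) ^ r) *
        (N1 (fun x => ‖IF (pv j u) x‖ₑ) * N2 (fun x => ‖IF (pv l w) x‖ₑ)) ^ r := by
          refine Finset.sum_le_sum fun i _ => ?_
          exact key i j l C0 u w (K i) _ hlj (by omega) hC0 hu hw (hK i)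
      _ ≤ _ := by
          rw [← Finset.sum_mul, ← ENNReal.ofReal_sum_of_nonneg (fun i _ => by positivity)]
          gcongr
          rw [Fin.sum_univ_eq_sum_range (fun i => C3 * (C0 * ((2:ℝ) ^ i) ^ s) ^ r *
          ((2:ℝ) ^ j / 2 ^ i) ^ (((m + k : ℕ) : ℝ) * (1 - r)) * (C1 * C2) ^ r) (j + 3)]
          have e : ∀ i : ℕ, C3 * (C0 * ((2:ℝ) ^ i) ^ s) ^ r *
              ((2:ℝ) ^ j / 2 ^ i) ^ (((m + k : ℕ) : ℝ) * (1 - r)) * (C1 * C2) ^ r =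
              (C3 * C0 ^ r * (C1 * C2) ^ r * ((2:ℝ) ^ j) ^ (((m + k : ℕ) : ℝ) * (1 - r))) * ((2:ℝ) ^ i) ^ β := by
            intro i
            rw [hβ, Real.rpow_sub (by positivity), Real.mul_rpow hC0 (by positivity), Real.div_rpow (by positivity)
              (by positivity), ← Real.rpow_mul (by positivity)]
            field_simp
          simp_rw [e]
          rw [← Finset.mul_sum]
          calc _ ≤ (C3 * C0 ^ r * (C1 * C2) ^ r * ((2:ℝ) ^ j) ^ (((m + k : ℕ) : ℝ) * (1 - r))) *
                (C4 * ((2:ℝ) ^ (j + 2)) ^ β) := by gcongr; exact hgeo (j + 2)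
            _ = (C3 * C0 ^ r * (C1 * C2) ^ r * C4 * ((2:ℝ) ^ 2) ^ β) * (((2:ℝ) ^ j) ^ s) ^ r := by
              have e2 : ((2:ℝ) ^ j) ^ (((m + k : ℕ) : ℝ) * (1 - r)) * ((2:ℝ) ^ j) ^ β = (((2:ℝ) ^ j) ^ s) ^ r := by
                rw [← Real.rpow_add (by positivity), ← Real.rpow_mul (by positivity), hβ]; ring_nf
              have e3 : ((2:ℝ) ^ (j + 2)) ^ β = ((2:ℝ) ^ j) ^ β * ((2:ℝ) ^ 2) ^ β := by
                rw [pow_add, Real.mul_rpow (by positivity) (by positivity)]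
              rw [← e2, e3]
              ring
            _ ≤ _ := by gcongr; linarith
  · obtain ⟨C0, hC0, hk⟩ := ker_even (m := m) (k := k) (ρ := 8) (chi_cd' (4⁻¹:ℝ)) (fun ξ h => (th_aux ξ h).1) L a
    rw [← ha] at hk
    refine ⟨C3 * C0 ^ r * (C1 * C2) ^ r + 1, by positivity, fun j l u w hlj hu hw => ?_⟩
    obtain ⟨K, hK⟩ := hk j
    have h1 := key j j l C0 u w K _ hlj (by omega) hC0 hu hw hK
    simp_rw [TT_conv (s := s) (hu.psi j).i0 (hw.psi l).i0 hK.int (fun ξ η h1 h2 => by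
      rw [hK.ft, chi_one' (by norm_num) (hz j l u w ξ η hlj h1 h2), mul_one]; rfl)] at h1
    refine h1.trans ?_
    rw [div_self (by positivity), Real.one_rpow, mul_one, Real.mul_rpow hC0 (by positivity)]
    have : 0 ≤ (((2:ℝ) ^ j) ^ s) ^ r := by positivity
    refine mul_le_mul' (ENNReal.ofReal_le_ofReal ?_) le_rfl
    nlinarith
end KP
namespace KP
variable {m k : ℕ}

/-- high-low commutator -/
lemma hilo {r s : ℝ} (hr : 0 < r) (hr1 : r ≤ 1)
    {N N1 N2 : (Eu m × Eu k → ℝ≥0∞) → ℝ≥0∞} (hN : LN r N) (hN1 : LN 1 N1) (hN2 : LN 1 N2)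
    (hH : ∀ F G : Eu m × Eu k → ℝ≥0∞, Measurable F → Measurable G → N (fun x => F x * G x) ≤ N1 F * N2 G) :
    ∃ C : ℝ, 0 < C ∧ ∀ (j l : ℕ) (u w : Eu m × Eu k → ℂ), l + 3 ≤ j → Gd s u → Gd s w →
      N (fun x => ‖TT s (pv j u) (pv l w) x - IF (pv l w) x * IF (fun ξ => jc s ξ * pv j u ξ) x‖ₑ) ^ r ≤
        ENNReal.ofReal (C * (((2:ℝ) ^ j) ^ s * (2 ^ l / 2 ^ j)) ^ r) *
        (N1 (fun x => ‖IF (pv j u) x‖ₑ) * N2 (fun x => ‖IF (pv l w) x‖ₑ)) ^ r := by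
  obtain ⟨M1, C1, hC1, htr1⟩ := hN1.trans
  obtain ⟨M2, C2, hC2, htr2⟩ := est_iv hN2
  obtain ⟨L, hL⟩ : ∃ L : ℕ, ((M1 + (1 + M2) : ℕ) : ℝ) * r + (m + k + 1 : ℕ) ≤ L * r := by
    obtain ⟨L, hL⟩ := exists_nat_ge ((((M1 + (1 + M2) : ℕ) : ℝ) * r + (m + k + 1 : ℕ)) / r)
    exact ⟨L, by rwa [div_le_iff₀ hr] at hL⟩
  obtain ⟨C3, hC3, hbil⟩ := bil_est hr hr1 hN (M1 + (1 + M2)) L hL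
  obtain ⟨C0, hC0, hk⟩ := th_ker (m := m) (k := k) L s
  refine ⟨C3 * C0 ^ r * (C1 * C2) ^ r + 1, by positivity, fun j l u w hlj hu hw => ?_⟩
  obtain ⟨K, hK⟩ := hk j
  have cu := continuous_IF (hu.psi j).i0
  have cw := continuous_IF (hw.psi l).i0
  have cK := hK.cont
  have h2j : (0:ℝ) < 2 ^ j := by positivity
  have h2l : (0:ℝ) < 2 ^ l := by positivity
  have h8 : (8:ℝ) * 2 ^ l ≤ 2 ^ j := by
    have : (2:ℝ) ^ (l + 3) ≤ 2 ^ j := pow_le_pow_right₀ one_le_two hlj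
    rw [pow_add] at this; linarith
  obtain ⟨B1, hB1⟩ := IF_bdd (u := pv j u)
  obtain ⟨B2, hB2⟩ := IF_bdd (u := pv l w)
  have hB1' : 0 ≤ B1 := le_trans (norm_nonneg _) (hB1 0)
  have i1 : ∀ x, Integrable (fun y => K y * (IF (pv j u) (x - y) * IF (pv l w) (x - y))) := fun x => by
    refine bdd_int hK.int (by fun_prop) ⟨B1 * B2, fun y => ?_⟩
    rw [norm_mul]
    exact mul_le_mul (hB1 _) (hB2 _) (norm_nonneg _) hB1'
  have i2 : ∀ x, Integrable (fun y => K y * IF (pv j u) (x - y)) := fun x =>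
    bdd_int hK.int (by fun_prop) ⟨B1, fun y => hB1 _⟩
  have eH : ∀ x y, K y * (IF (pv j u) (x - y) * (IF (pv l w) (x - y) - IF (pv l w) x)) =
    K y * (IF (pv j u) (x - y) * IF (pv l w) (x - y)) - IF (pv l w) x * (K y * IF (pv j u) (x - y)) := by
    intro x y; ring
  have hT : ∀ x, TT s (pv j u) (pv l w) x - IF (pv l w) x * IF (fun ξ => jc s ξ * pv j u ξ) x =
      ∫ y, K y * (IF (pv j u) (x - y) * (IF (pv l w) (x - y) - IF (pv l w) x)) := by
    intro x
    simp_rw [eH]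
    rw [integral_sub (i1 x) ((i2 x).const_mul _), integral_const_mul, conv_IF (hu.psi j).i0 hK.int,
      TT_conv (s := s) (hu.psi j).i0 (hw.psi l).i0 hK.int]
    · congr 3
      ext ξ
      rw [hK.ft, jc, pv, ← mul_assoc, ← mul_assoc, ← Complex.ofReal_mul, ← Complex.ofReal_mul, mul_assoc, th_psi]
    · intro ξ η h1 h2
      have h1 := pv_supp h1
      have h2 := (pv_supp h2).1
      have h3 := norm_add_le ξ η
      have h4 := norm_sub_le (ξ + η) η
      rw [add_sub_cancel_right] at h4
      have h5 := h1.2 (by omega)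
      rw [hK.ft, th_one (by linarith [h1.1]) (fun _ => by linarith), mul_one]; rfl
  simp_rw [hT]
  have := hbil j j s C0 K (fun p => IF (pv j u) (p.1 - p.2) * (IF (pv l w) (p.1 - p.2) - IF (pv l w) p.1))
      (ENNReal.ofReal (C1 * C2 * (2 ^ l / 2 ^ j)) *
        (N1 (fun x => ‖IF (pv j u) x‖ₑ) * N2 (fun x => ‖IF (pv l w) x‖ₑ))) hC0
      hK.cont hK.bd (Continuous.measurable (by fun_prop)) (fun x => ?_) (fun x => ?_) (fun y => ?_)
  · refine this.trans ?_
    rw [ENNReal.mul_rpow_of_nonneg _ _ hr.le, ENNReal.ofReal_rpow_of_nonneg (by positivity) hr.le, ← mul_assoc,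
        ← ENNReal.ofReal_mul (by positivity)]
    refine mul_le_mul' (ENNReal.ofReal_le_ofReal ?_) le_rfl
    rw [div_self (by positivity), Real.one_rpow, mul_one, Real.mul_rpow hC0 (by positivity),
      Real.mul_rpow (x := C1 * C2) (by positivity) (by positivity),
      Real.mul_rpow (x := ((2:ℝ) ^ j) ^ s) (by positivity) (by positivity)]
    have : 0 ≤ (((2:ℝ) ^ j) ^ s) ^ r * ((2:ℝ) ^ l / 2 ^ j) ^ r := by positivity
    nlinarith
  · simp only [eH]
    exact (i1 x).sub ((i2 x).const_mul _)
  · simp only [eH]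
    have b1 := (BL_IF (hu.psi j).i0 fun ξ h => (pv_supp h).1).refl x
    have b2 := (BL_IF (hw.psi l).i0 fun ξ h => (pv_supp h).1).refl x
    refine Rep.sub ((BL.mono ((hK.bl).mul (b1.mul b2)) ?_).rep) ((BL.mono (((hK.bl).mul b1).const_mul _) ?_).rep)
    · linarith
    · linarith
  · simp only [enorm_mul]
    refine (hH _ _ (Continuous.measurable (by fun_prop)) (Continuous.measurable (by fun_prop))).trans ?_
    have e1 : (1 + ‖y‖) ≤ 1 + 2 ^ j * ‖y‖ := by
      have : (1:ℝ) ≤ 2 ^ j := one_le_pow₀ one_le_two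
      nlinarith [norm_nonneg y]
    have e2 : 1 + 2 ^ l * ‖y‖ ≤ 1 + 2 ^ j * ‖y‖ := by
      nlinarith [norm_nonneg y]
    have hy := norm_nonneg y
    calc _ ≤ (ENNReal.ofReal (C1 * (1 + ‖y‖) ^ M1) * N1 (fun x => ‖IF (pv j u) x‖ₑ)) *
          (ENNReal.ofReal (C2 * ((2 ^ l * ‖y‖) * (1 + 2 ^ l * ‖y‖) ^ M2)) * N2 (fun x => ‖IF (pv l w) x‖ₑ)) :=
          mul_le_mul' (htr1 (fun x => ‖IF (pv j u) x‖ₑ) y) (htr2 l w hw.i0 y)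
      _ = ENNReal.ofReal (C1 * (1 + ‖y‖) ^ M1 * (C2 * ((2 ^ l * ‖y‖) * (1 + 2 ^ l * ‖y‖) ^ M2))) *
          (N1 (fun x => ‖IF (pv j u) x‖ₑ) * N2 (fun x => ‖IF (pv l w) x‖ₑ)) := by
        rw [ENNReal.ofReal_mul (p := C1 * (1 + ‖y‖) ^ M1) (by positivity)]
        ring
      _ ≤ ENNReal.ofReal ((1 + 2 ^ j * ‖y‖) ^ (M1 + (1 + M2)) * (C1 * C2 * (2 ^ l / 2 ^ j))) *
          (N1 (fun x => ‖IF (pv j u) x‖ₑ) * N2 (fun x => ‖IF (pv l w) x‖ₑ)) := by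
        refine mul_le_mul' (ENNReal.ofReal_le_ofReal ?_) le_rfl
        calc C1 * (1 + ‖y‖) ^ M1 * (C2 * ((2 ^ l * ‖y‖) * (1 + 2 ^ l * ‖y‖) ^ M2))
            = C1 * (1 + ‖y‖) ^ M1 * (C2 * (((2 ^ l / 2 ^ j) * (2 ^ j * ‖y‖)) * (1 + 2 ^ l * ‖y‖) ^ M2)) := by
              field_simp
          _ ≤ C1 * (1 + 2 ^ j * ‖y‖) ^ M1 * (C2 * (((2 ^ l / 2 ^ j) * (1 + 2 ^ j * ‖y‖)) * (1 + 2 ^ j * ‖y‖) ^ M2)) := by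
              gcongr
              linarith
          _ = _ := by ring
      _ = _ := by rw [ENNReal.ofReal_mul (by positivity), mul_assoc]

/-- remainder -/
def RR (s : ℝ) (u w : Eu m × Eu k → ℂ) (x : Eu m × Eu k) : ℂ :=
  TT s u w x - IF w x * IF (fun ξ => jc s ξ * u ξ) x - IF u x * IF (fun ξ => jc s ξ * w ξ) x

lemma RR_swap (s : ℝ) (u w : Eu m × Eu k → ℂ) (x : Eu m × Eu k) : RR s u w x = RR s w u x := by
  rw [RR, RR, TT_swap]; ring

lemma est_R {r s : ℝ} (hr : 0 < r) (hr1 : r ≤ 1) (hs0 : 0 < s)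
    (hs : ((m + k : ℕ) : ℝ) * (1 - r) < s * r ∨ ∃ a : ℕ, s = 2 * a)
    {N N1 N2 : (Eu m × Eu k → ℝ≥0∞) → ℝ≥0∞} (hN : LN r N) (hN1 : LN 1 N1) (hN2 : LN 1 N2)
    (hH : ∀ F G : Eu m × Eu k → ℝ≥0∞, Measurable F → Measurable G → N (fun x => F x * G x) ≤ N1 F * N2 G) :
    ∃ C : ℝ, 0 < C ∧ ∀ (j l : ℕ) (u w : Eu m × Eu k → ℂ), l ≤ j → Gd s u → Gd s w →
      N (fun x => ‖RR s (pv j u) (pv l w) x‖ₑ) ^ r ≤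
        ENNReal.ofReal (C * (((2:ℝ) ^ j) ^ s * (2 ^ l / 2 ^ j) ^ (min s 1)) ^ r) *
        (N1 (fun x => ‖IF (pv j u) x‖ₑ) * N2 (fun x => ‖IF (pv l w) x‖ₑ)) ^ r := by
  obtain ⟨C1, hC1, h1⟩ := hihi hr hr1 hs0.le hs hN hN1 hN2 hH
  obtain ⟨C2, hC2, h2⟩ := hilo (s := s) hr hr1 hN hN1 hN2 hH
  obtain ⟨C3, hC3, h3⟩ := est_iii hN1 s
  obtain ⟨C4, hC4, h4⟩ := est_iii hN2 s
  set ε := min s 1 with hε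
  have hε0 : 0 < ε := lt_min hs0 one_pos
  have hε1 : ε ≤ 1 := min_le_right _ _
  have hεs : ε ≤ s := min_le_left _ _
  refine ⟨C2 + C4 ^ r + (C1 + C3 ^ r + C4 ^ r) * (4:ℝ) ^ r, by positivity, fun j l u w hlj hu hw => ?_⟩
  set a := N1 (fun x => ‖IF (pv j u) x‖ₑ) with ha
  set b := N2 (fun x => ‖IF (pv l w) x‖ₑ) with hb
  have cu := continuous_IF (hu.psi j).i0
  have cw := continuous_IF (hw.psi l).i0
  have cu1 := continuous_IF (hu.psi j).i1
  have cw1 := continuous_IF (hw.psi l).i1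
  have cT := TT_cont hs0.le (hu.psi j) (hw.psi l)
  have h2j : (0:ℝ) < 2 ^ j := by positivity
  have h2l : (0:ℝ) < 2 ^ l := by positivity
  have hlj' : (2:ℝ) ^ l ≤ 2 ^ j := pow_le_pow_right₀ one_le_two hlj
  have hq1 : (2:ℝ) ^ l / 2 ^ j ≤ 1 := by rw [div_le_one h2j]; exact hlj'
  have hq0 : 0 < (2:ℝ) ^ l / 2 ^ j := by positivity
  -- products
  have p1 : N (fun x => ‖IF (pv l w) x * IF (fun ξ => jc s ξ * pv j u ξ) x‖ₑ) ^ r ≤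
      ENNReal.ofReal (C3 ^ r * (((2:ℝ) ^ j) ^ s) ^ r) * (a * b) ^ r := by
    have : N (fun x => ‖IF (pv l w) x * IF (fun ξ => jc s ξ * pv j u ξ) x‖ₑ) ≤
        ENNReal.ofReal (C3 * ((2:ℝ) ^ j) ^ s) * (a * b) := by
      simp_rw [enorm_mul, mul_comm ‖IF (pv l w) _‖ₑ]
      refine (hH _ _ (Continuous.measurable (by fun_prop)) (Continuous.measurable (by fun_prop))).trans ?_
      rw [← mul_assoc]
      exact mul_le_mul' (h3 j u hu.i0) le_rfl
    refine (ENNReal.rpow_le_rpow this hr.le).trans (le_of_eq ?_)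
    rw [ENNReal.mul_rpow_of_nonneg _ _ hr.le, ENNReal.ofReal_rpow_of_nonneg (by positivity) hr.le,
      Real.mul_rpow (by positivity) (by positivity)]
  have p2 : N (fun x => ‖IF (pv j u) x * IF (fun ξ => jc s ξ * pv l w ξ) x‖ₑ) ^ r ≤
      ENNReal.ofReal (C4 ^ r * (((2:ℝ) ^ l) ^ s) ^ r) * (a * b) ^ r := by
    have : N (fun x => ‖IF (pv j u) x * IF (fun ξ => jc s ξ * pv l w ξ) x‖ₑ) ≤
        ENNReal.ofReal (C4 * ((2:ℝ) ^ l) ^ s) * (a * b) := by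
      simp_rw [enorm_mul]
      refine (hH _ _ (Continuous.measurable (by fun_prop)) (Continuous.measurable (by fun_prop))).trans ?_
      rw [mul_left_comm]
      exact mul_le_mul' le_rfl (h4 l w hw.i0)
    refine (ENNReal.rpow_le_rpow this hr.le).trans (le_of_eq ?_)
    rw [ENNReal.mul_rpow_of_nonneg _ _ hr.le, ENNReal.ofReal_rpow_of_nonneg (by positivity) hr.le,
      Real.mul_rpow (by positivity) (by positivity)]
  have q1 := hN.add hr hr1 (u := RR s (pv j u) (pv l w))
    (A := fun x => TT s (pv j u) (pv l w) x - IF (pv l w) x * IF (fun ξ => jc s ξ * pv j u ξ) x)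
    (B := fun x => IF (pv j u) x * IF (fun ξ => jc s ξ * pv l w ξ) x) (by fun_prop) (by fun_prop) (fun x => rfl)
  have q2 := hN.add hr hr1 (u := fun x => TT s (pv j u) (pv l w) x - IF (pv l w) x * IF (fun ξ => jc s ξ * pv j u ξ) x)
    cT (B := fun x => IF (pv l w) x * IF (fun ξ => jc s ξ * pv j u ξ) x) (by fun_prop) (fun x => rfl)
  set X := ((2:ℝ) ^ j) ^ s with hX
  have hX0 : 0 < X := by positivity
  have e1 : ((2:ℝ) ^ l) ^ s ≤ X * (2 ^ l / 2 ^ j) ^ ε := by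
    calc ((2:ℝ) ^ l) ^ s = X * (2 ^ l / 2 ^ j) ^ s := by
          rw [hX, ← Real.mul_rpow (by positivity) (by positivity)]; congr 1; field_simp
      _ ≤ _ := by
        gcongr X * ?_
        exact Real.rpow_le_rpow_of_exponent_ge hq0 hq1 hεs
  have e1' : (((2:ℝ) ^ l) ^ s) ^ r ≤ (X * (2 ^ l / 2 ^ j) ^ ε) ^ r := by gcongr
  set Y := (X * (2 ^ l / 2 ^ j) ^ ε) ^ r with hY
  have hY0 : 0 < Y := by positivity
  have h4r : (0:ℝ) < 4 ^ r := by positivity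
  have hC3r : (0:ℝ) < C3 ^ r := by positivity
  have hC4r : (0:ℝ) < C4 ^ r := by positivity
  by_cases hc : l + 3 ≤ j
  · have e2 : (X * (2 ^ l / 2 ^ j)) ^ r ≤ Y := by
      rw [hY]
      gcongr
      have := Real.rpow_le_rpow_of_exponent_ge hq0 hq1 hε1
      rwa [Real.rpow_one] at this
    calc _ ≤ _ := q1
      _ ≤ ENNReal.ofReal (C2 * (X * (2 ^ l / 2 ^ j)) ^ r) * (a * b) ^ r +
          ENNReal.ofReal (C4 ^ r * (((2:ℝ) ^ l) ^ s) ^ r) * (a * b) ^ r := add_le_add (h2 j l u w hc hu hw) p2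
      _ = ENNReal.ofReal (C2 * (X * (2 ^ l / 2 ^ j)) ^ r + C4 ^ r * (((2:ℝ) ^ l) ^ s) ^ r) * (a * b) ^ r := by
        rw [ENNReal.ofReal_add (by positivity) (by positivity), add_mul]
      _ ≤ _ := by
        refine mul_le_mul' (ENNReal.ofReal_le_ofReal ?_) le_rfl
        calc _ ≤ C2 * Y + C4 ^ r * Y := by gcongr
          _ ≤ _ := by
            have : 0 ≤ (C1 + C3 ^ r + C4 ^ r) * (4:ℝ) ^ r * Y := by positivity
            linarith
  · have e2 : X ^ r ≤ 4 ^ r * Y := by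
      rw [hY, ← Real.mul_rpow (by norm_num) (by positivity)]
      gcongr
      have h5 : (4⁻¹:ℝ) ≤ 2 ^ l / 2 ^ j := by
        rw [le_div_iff₀ h2j]
        have : (2:ℝ) ^ j ≤ 2 ^ (l + 2) := pow_le_pow_right₀ one_le_two (by omega)
        rw [pow_add] at this; linarith
      have := Real.rpow_le_rpow_of_exponent_ge hq0 hq1 hε1
      rw [Real.rpow_one] at this
      nlinarith
    have e3 : (((2:ℝ) ^ l) ^ s) ^ r ≤ X ^ r := by rw [hX]; gcongr
    calc _ ≤ _ := q1
      _ ≤ (ENNReal.ofReal (C1 * X ^ r) * (a * b) ^ r + ENNReal.ofReal (C3 ^ r * X ^ r) * (a * b) ^ r) +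
          ENNReal.ofReal (C4 ^ r * (((2:ℝ) ^ l) ^ s) ^ r) * (a * b) ^ r :=
          add_le_add (q2.trans (add_le_add (h1 j l u w hlj hu hw) p1)) p2
      _ = ENNReal.ofReal (C1 * X ^ r + C3 ^ r * X ^ r + C4 ^ r * (((2:ℝ) ^ l) ^ s) ^ r) * (a * b) ^ r := by
        rw [ENNReal.ofReal_add (by positivity) (by positivity), ENNReal.ofReal_add (by positivity) (by positivity),
          add_mul, add_mul]
      _ ≤ _ := by
        refine mul_le_mul' (ENNReal.ofReal_le_ofReal ?_) le_rfl
        calc _ ≤ C1 * (4 ^ r * Y) + C3 ^ r * (4 ^ r * Y) + C4 ^ r * (4 ^ r * Y) := by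
              gcongr; exact e3.trans e2
          _ ≤ _ := by
            have : 0 ≤ (C2 + C4 ^ r) * Y := by positivity
            linarith
end KP
namespace KP
variable {m k : ℕ}

lemma sum_dist {t : ℝ} (ht : 0 < t) (ht1 : t < 1) (L : ℕ) :
    ∑' l : ℕ, ENNReal.ofReal (t ^ (Nat.dist l L)) ≤ ENNReal.ofReal (2 * (1 - t)⁻¹) := by
  have hg : ∑' l : ℕ, ENNReal.ofReal (t ^ l) = ENNReal.ofReal ((1 - t)⁻¹) := by
    rw [← ENNReal.ofReal_tsum_of_nonneg (fun n => by positivity) (summable_geometric_of_lt_one ht.le ht1),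
      tsum_geometric_of_lt_one ht.le ht1]
  rw [← Summable.sum_add_tsum_nat_add' (k := L) ENNReal.summable, two_mul, ENNReal.ofReal_add (by rw [inv_nonneg]; linarith) (by rw [inv_nonneg]; linarith), ← hg]
  refine add_le_add ?_ ?_
  · rw [← Finset.sum_range_reflect]
    refine le_trans (Finset.sum_le_sum (g := fun l => ENNReal.ofReal (t ^ l)) fun l hl => ?_) (ENNReal.sum_le_tsum _)
    refine ENNReal.ofReal_le_ofReal (pow_le_pow_of_le_one ht.le ht1.le ?_)
    rw [Finset.mem_range] at hl
    unfold Nat.dist; omega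
  · refine ENNReal.tsum_le_tsum fun l => ENNReal.ofReal_le_ofReal (pow_le_pow_of_le_one ht.le ht1.le ?_)
    unfold Nat.dist; omega

lemma sum_min {z p : ℝ} (hz : 1 < z) (hp : 0 < p) :
    ∑' l : ℕ, ENNReal.ofReal (min (z ^ l * p) (z ^ l * p)⁻¹) ≤ ENNReal.ofReal (z * (2 * (1 - z⁻¹)⁻¹)) := by
  have hz0 : 0 < z := by linarith
  obtain ⟨L, hL⟩ : ∃ L : ℕ, ∀ l : ℕ, min (z ^ l * p) (z ^ l * p)⁻¹ ≤ z * z⁻¹ ^ (Nat.dist l L) := by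
    by_cases h1 : 1 ≤ p
    · refine ⟨0, fun l => (min_le_right _ _).trans ?_⟩
      rw [Nat.dist_zero_right, mul_inv, inv_pow]
      have : p⁻¹ ≤ 1 := inv_le_one_of_one_le₀ h1
      have : 0 < (z ^ l)⁻¹ := by positivity
      nlinarith
    · push Not at h1
      obtain ⟨L, hL1, hL2⟩ := exists_nat_pow_near (x := p⁻¹) ((one_le_inv₀ hp).2 h1.le) hz
      refine ⟨L, fun l => ?_⟩
      rcases le_total l L with h | h
      · obtain ⟨d, rfl⟩ := Nat.exists_eq_add_of_le h
        have hd : Nat.dist l (l + d) = d := by unfold Nat.dist; omega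
        refine (min_le_left _ _).trans ?_
        rw [hd, inv_pow, ← div_eq_mul_inv, le_div_iff₀ (by positivity)]
        rw [pow_add] at hL1
        have : z ^ l * z ^ d * p ≤ p⁻¹ * p := by gcongr
        rw [inv_mul_cancel₀ hp.ne'] at this
        linarith
      · obtain ⟨d, rfl⟩ := Nat.exists_eq_add_of_le h
        have hd : Nat.dist (L + d) L = d := by unfold Nat.dist; omega
        refine (min_le_right _ _).trans ?_
        rw [hd, inv_pow, ← div_eq_mul_inv, mul_inv, pow_add, le_div_iff₀ (by positivity)]
        rw [pow_succ] at hL2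
        have : (z ^ L)⁻¹ * p⁻¹ ≤ z := by
          rw [inv_mul_le_iff₀ (by positivity)]; exact hL2.le
        calc _ = (z ^ L)⁻¹ * p⁻¹ := by field_simp
          _ ≤ z := this
  have hz1 : z⁻¹ < 1 := inv_lt_one_of_one_lt₀ hz
  calc _ ≤ ∑' l : ℕ, ENNReal.ofReal z * ENNReal.ofReal (z⁻¹ ^ (Nat.dist l L)) := by
        refine ENNReal.tsum_le_tsum fun l => ?_
        rw [← ENNReal.ofReal_mul hz0.le]
        exact ENNReal.ofReal_le_ofReal (hL l)
    _ ≤ _ := by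
        rw [ENNReal.tsum_mul_left, ENNReal.ofReal_mul hz0.le]
        exact mul_le_mul' le_rfl (sum_dist (by positivity) hz1 L)

lemma pt_est {s ε r κ τ : ℝ} (hs : 0 < s) (hε : 0 < ε) (hεs : ε ≤ s) (hr : 0 < r) (hκ : 0 < κ) (hτ : 0 ≤ τ)
    {j l : ℕ} (hlj : l ≤ j) (h1 : τ ≤ 1) (h2 : τ ≤ ((2:ℝ) ^ j) ^ s * κ) (h3 : τ ≤ (((2:ℝ) ^ l) ^ s * κ)⁻¹) :
    (τ * ((2:ℝ) ^ l / 2 ^ j) ^ ε) ^ r ≤ ((2:ℝ) ^ (ε / 2 * r))⁻¹ ^ (Nat.dist j l) *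
      min (((2:ℝ) ^ (ε / 2 * r)) ^ l * κ ^ (ε / (2 * s) * r)) (((2:ℝ) ^ (ε / 2 * r)) ^ l * κ ^ (ε / (2 * s) * r))⁻¹ := by
  set θ := ε / (2 * s) with hθ
  have hθ0 : 0 < θ := by positivity
  have hθ1 : θ ≤ 1 := by rw [hθ, div_le_one (by positivity)]; linarith
  have hsθ : s * θ = ε / 2 := by rw [hθ]; field_simp
  have hττ : τ ≤ τ ^ θ := by
    rcases hτ.eq_or_lt with h0 | h0
    · rw [← h0, Real.zero_rpow hθ0.ne']
    · have := Real.rpow_le_rpow_of_exponent_ge h0 h1 hθ1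
      rwa [Real.rpow_one] at this
  set q := (2:ℝ) ^ l / 2 ^ j with hq
  have hq0 : 0 < q := by positivity
  have hq1 : q ≤ 1 := by
    rw [hq, div_le_one (by positivity)]; exact pow_le_pow_right₀ one_le_two hlj
  have hqε : q ^ ε = q ^ (ε / 2) * q ^ (ε / 2) := by rw [← Real.rpow_add hq0]; ring_nf
  have e1 : τ * q ^ ε ≤ q ^ (ε / 2) * (((2:ℝ) ^ l) ^ (ε / 2) * κ ^ θ) := by
    calc τ * q ^ ε ≤ (((2:ℝ) ^ j) ^ s * κ) ^ θ * q ^ ε := by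
          gcongr; exact hττ.trans (Real.rpow_le_rpow hτ h2 hθ0.le)
      _ = q ^ (ε / 2) * ((((2:ℝ) ^ j) ^ (ε / 2) * q ^ (ε / 2)) * κ ^ θ) := by
        rw [Real.mul_rpow (by positivity) hκ.le, ← Real.rpow_mul (by positivity), hsθ, hqε]; ring
      _ = _ := by
        rw [← Real.mul_rpow (by positivity) hq0.le]
        congr 4
        rw [hq]; field_simp
  have e2 : τ * q ^ ε ≤ q ^ (ε / 2) * (((2:ℝ) ^ l) ^ (ε / 2) * κ ^ θ)⁻¹ := by
    calc τ * q ^ ε ≤ ((((2:ℝ) ^ l) ^ s * κ)⁻¹) ^ θ * q ^ ε := by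
          gcongr; exact hττ.trans (Real.rpow_le_rpow hτ h3 hθ0.le)
      _ = (q ^ (ε / 2) * (((2:ℝ) ^ l) ^ (ε / 2) * κ ^ θ)⁻¹) * q ^ (ε / 2) := by
        rw [Real.inv_rpow (by positivity), Real.mul_rpow (by positivity) hκ.le, ← Real.rpow_mul (by positivity),
          hsθ, hqε]; ring
      _ ≤ _ := mul_le_of_le_one_right (by positivity) (Real.rpow_le_one hq0.le hq1 (by positivity))
  have eq1 : (q ^ (ε / 2)) ^ r = ((2:ℝ) ^ (ε / 2 * r))⁻¹ ^ (Nat.dist j l) := by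
    obtain ⟨d, rfl⟩ := Nat.exists_eq_add_of_le hlj
    have hd : Nat.dist (l + d) l = d := by unfold Nat.dist; omega
    have : q = (2 ^ d)⁻¹ := by rw [hq, pow_add]; field_simp
    rw [hd, this, ← Real.rpow_mul (by positivity), Real.inv_rpow (by positivity), inv_pow,
      ← Real.rpow_natCast, ← Real.rpow_natCast, ← Real.rpow_mul (by norm_num), ← Real.rpow_mul (by norm_num), mul_comm]
  have eq2 : (((2:ℝ) ^ l) ^ (ε / 2) * κ ^ θ) ^ r = ((2:ℝ) ^ (ε / 2 * r)) ^ l * κ ^ (θ * r) := by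
    rw [Real.mul_rpow (by positivity) (by positivity), ← Real.rpow_mul (by positivity), ← Real.rpow_mul hκ.le,
      ← Real.rpow_natCast, ← Real.rpow_natCast, ← Real.rpow_mul (by norm_num), ← Real.rpow_mul (by norm_num),
      mul_comm (l:ℝ)]
  rw [mul_min_of_nonneg _ _ (by positivity), ← eq1, ← eq2]
  refine le_min ?_ ?_
  · rw [← Real.mul_rpow (by positivity) (by positivity)]
    exact Real.rpow_le_rpow (by positivity) e1 hr.le
  · rw [← Real.inv_rpow (by positivity), ← Real.mul_rpow (by positivity) (by positivity)]
    exact Real.rpow_le_rpow (by positivity) e2 hr.le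

lemma sum_main {s ε r c C1 C2 : ℝ} (hs : 0 < s) (hε : 0 < ε) (hεs : ε ≤ s) (hr : 0 < r) (hc : 0 < c)
    (hC1 : 0 < C1) (hC2 : 0 < C2) : ∃ C : ℝ, 0 < C ∧ ∀ (A0 A1 B0 B1 : ℝ≥0∞) (a b : ℕ → ℝ≥0∞) (T : ℕ × ℕ → ℝ≥0∞),
    (∀ j, a j ≤ ENNReal.ofReal C1 * A0) → (∀ j, a j ≤ ENNReal.ofReal (C1 * (((2:ℝ) ^ j) ^ s)⁻¹) * A1) →
    (∀ j, b j ≤ ENNReal.ofReal C2 * B0) → (∀ j, b j ≤ ENNReal.ofReal (C2 * (((2:ℝ) ^ j) ^ s)⁻¹) * B1) →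
    (∀ j l, l ≤ j → T (j, l) ≤ ENNReal.ofReal (c * (((2:ℝ) ^ j) ^ s * (2 ^ l / 2 ^ j) ^ ε) ^ r) * (a j * b l) ^ r) →
    (∀ j l, l ≤ j → T (l, j) ≤ ENNReal.ofReal (c * (((2:ℝ) ^ j) ^ s * (2 ^ l / 2 ^ j) ^ ε) ^ r) * (a l * b j) ^ r) →
    ∑' q, T q ≤ ENNReal.ofReal C * (A1 * B0 + A0 * B1) ^ r := by
  set z := (2:ℝ) ^ (ε / 2 * r) with hz
  have hz1 : 1 < z := Real.one_lt_rpow one_lt_two (by positivity)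
  have hz0 : 0 < z := by linarith
  have hzi : z⁻¹ < 1 := inv_lt_one_of_one_lt₀ hz1
  set S := 2 * (1 - z⁻¹)⁻¹ with hS
  have hS0 : 0 < S := by have : 0 < 1 - z⁻¹ := by linarith
                         positivity
  refine ⟨c * (C1 * C2) ^ r * (2 * (S * (z * S))), by positivity, fun A0 A1 B0 B1 a b T a0 a1 b0 b1 hT1 hT2 => ?_⟩
  by_cases hM : A1 * B0 + A0 * B1 = ∞
  · rw [hM, ENNReal.top_rpow_of_pos hr, ENNReal.mul_top (by simp; positivity)]; exact le_top
  by_cases hz : ∀ j l, a j * b l = 0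
  · have : ∑' q, T q = 0 := by
      rw [ENNReal.tsum_eq_zero]
      rintro ⟨j, l⟩
      rcases le_total l j with h | h
      · have := hT1 j l h
        rwa [hz, ENNReal.zero_rpow_of_pos hr, mul_zero, nonpos_iff_eq_zero] at this
      · have := hT2 l j h
        rwa [hz, ENNReal.zero_rpow_of_pos hr, mul_zero, nonpos_iff_eq_zero] at this
    rw [this]; exact zero_le
  push Not at hz
  obtain ⟨j0, l0, h00⟩ := hz
  have nA0 : A0 ≠ 0 := fun h => left_ne_zero_of_mul h00 (by have := a0 j0; simpa [h] using this)
  have nA1 : A1 ≠ 0 := fun h => left_ne_zero_of_mul h00 (by have := a1 j0; simpa [h] using this)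
  have nB0 : B0 ≠ 0 := fun h => right_ne_zero_of_mul h00 (by have := b0 l0; simpa [h] using this)
  have nB1 : B1 ≠ 0 := fun h => right_ne_zero_of_mul h00 (by have := b1 l0; simpa [h] using this)
  rw [ENNReal.add_eq_top, not_or] at hM
  have tA1 : A1 ≠ ∞ := fun h => hM.1 (by rw [h, ENNReal.top_mul nB0])
  have tB0 : B0 ≠ ∞ := fun h => hM.1 (by rw [h, ENNReal.mul_top nA1])
  have tA0 : A0 ≠ ∞ := fun h => hM.2 (by rw [h, ENNReal.top_mul nB1])
  have tB1 : B1 ≠ ∞ := fun h => hM.2 (by rw [h, ENNReal.mul_top nA0])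
  have key : ∀ X : ℝ≥0∞, X ≠ 0 → X ≠ ∞ → ∃ x : ℝ, 0 < x ∧ X = ENNReal.ofReal x := fun X h h' =>
    ⟨X.toReal, ENNReal.toReal_pos h h', (ENNReal.ofReal_toReal h').symm⟩
  obtain ⟨A0, pA0, rfl⟩ := key A0 nA0 tA0
  obtain ⟨A1, pA1, rfl⟩ := key A1 nA1 tA1
  obtain ⟨B0, pB0, rfl⟩ := key B0 nB0 tB0
  obtain ⟨B1, pB1, rfl⟩ := key B1 nB1 tB1
  have key2 : ∀ X : ℕ → ℝ≥0∞, (∀ j, X j ≠ ∞) → ∃ x : ℕ → ℝ, (∀ j, 0 ≤ x j) ∧ X = fun j => ENNReal.ofReal (x j) :=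
    fun X h => ⟨fun j => (X j).toReal, fun j => ENNReal.toReal_nonneg, funext fun j => (ENNReal.ofReal_toReal (h j)).symm⟩
  obtain ⟨a, pa, rfl⟩ := key2 a (fun j => ((a0 j).trans_lt (ENNReal.mul_lt_top (by simp) (by simp))).ne)
  obtain ⟨b, pb, rfl⟩ := key2 b (fun j => ((b0 j).trans_lt (ENNReal.mul_lt_top (by simp) (by simp))).ne)
  have hx : ∀ j : ℕ, (0:ℝ) < ((2:ℝ) ^ j) ^ s := fun j => by positivity
  simp only [← ENNReal.ofReal_mul hC1.le] at a0
  simp only [← ENNReal.ofReal_mul hC2.le] at b0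
  simp only [fun j => (ENNReal.ofReal_mul (p := C1 * (((2:ℝ) ^ j) ^ s)⁻¹) (q := A1)
    (mul_nonneg hC1.le (inv_nonneg.2 (hx j).le))).symm] at a1
  simp only [fun j => (ENNReal.ofReal_mul (p := C2 * (((2:ℝ) ^ j) ^ s)⁻¹) (q := B1)
    (mul_nonneg hC2.le (inv_nonneg.2 (hx j).le))).symm] at b1
  replace a0 : ∀ j, a j ≤ C1 * A0 := fun j => (ENNReal.ofReal_le_ofReal_iff (by positivity)).1 (a0 j)
  replace b0 : ∀ j, b j ≤ C2 * B0 := fun j => (ENNReal.ofReal_le_ofReal_iff (by positivity)).1 (b0 j)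
  replace a1 : ∀ j, ((2:ℝ) ^ j) ^ s * a j ≤ C1 * A1 := fun j => by
    have := (ENNReal.ofReal_le_ofReal_iff (by positivity)).1 (a1 j)
    have := mul_le_mul_of_nonneg_left this (hx j).le
    refine this.trans (le_of_eq ?_)
    have := (hx j).ne'
    field_simp
  replace b1 : ∀ j, ((2:ℝ) ^ j) ^ s * b j ≤ C2 * B1 := fun j => by
    have := (ENNReal.ofReal_le_ofReal_iff (by positivity)).1 (b1 j)
    have := mul_le_mul_of_nonneg_left this (hx j).le
    refine this.trans (le_of_eq ?_)
    have := (hx j).ne'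
    field_simp
  set M := A1 * B0 + A0 * B1 with hMd
  have hM0 : 0 < M := by positivity
  set κ := A0 * B0 / M with hκ
  have hκ0 : 0 < κ := by positivity
  have hQ : A1 * B1 ≤ M * κ⁻¹ := by
    rw [hκ, inv_div, ← mul_div_assoc, le_div_iff₀ (by positivity)]
    have : 0 ≤ A1 * B0 := by positivity
    have : 0 ≤ A0 * B1 := by positivity
    nlinarith
  set g : ℕ → ℝ := fun l => min (z ^ l * κ ^ (ε / (2 * s) * r)) (z ^ l * κ ^ (ε / (2 * s) * r))⁻¹ with hg
  have hg0 : ∀ l, 0 ≤ g l := fun l => le_min (by positivity) (by positivity)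
  set c' := c * (C1 * C2 * M) ^ r with hc'
  have hc'0 : 0 < c' := by positivity
  have main : ∀ (j l : ℕ) (σ : ℝ), l ≤ j → 0 ≤ σ → ((2:ℝ) ^ j) ^ s * σ ≤ C1 * C2 * M → σ ≤ C1 * C2 * (A0 * B0) →
      (((2:ℝ) ^ j) ^ s * ((2:ℝ) ^ l) ^ s) * σ ≤ C1 * C2 * (A1 * B1) →
      c * (((2:ℝ) ^ j) ^ s * (2 ^ l / 2 ^ j) ^ ε) ^ r * σ ^ r ≤ c' * (z⁻¹ ^ (Nat.dist j l) * g l) := by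
    intro j l σ hlj hσ h1 h2 h3
    have hD : 0 < C1 * C2 * M := by positivity
    have hxj := hx j
    have hxl := hx l
    have := pt_est (τ := ((2:ℝ) ^ j) ^ s * σ / (C1 * C2 * M)) hs hε hεs hr hκ0 (by positivity) hlj
      (by rw [div_le_one hD]; exact h1)
      (by
        rw [div_le_iff₀ hD]
        calc _ ≤ ((2:ℝ) ^ j) ^ s * (C1 * C2 * (A0 * B0)) := by gcongr
          _ = _ := by rw [hκ]; field_simp)
      (by
        rw [div_le_iff₀ hD, mul_inv, mul_assoc, ← div_eq_inv_mul, le_div_iff₀ hxl]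
        calc _ = (((2:ℝ) ^ j) ^ s * ((2:ℝ) ^ l) ^ s) * σ := by ring
          _ ≤ C1 * C2 * (A1 * B1) := h3
          _ ≤ C1 * C2 * (M * κ⁻¹) := by gcongr
          _ = _ := by ring)
    calc _ = c' * ((((2:ℝ) ^ j) ^ s * σ / (C1 * C2 * M)) * (2 ^ l / 2 ^ j) ^ ε) ^ r := by
          rw [hc', mul_assoc c, mul_assoc c, ← Real.mul_rpow (by positivity) (by positivity),
            ← Real.mul_rpow (by positivity) (by positivity)]
          congr 2
          field_simp
      _ ≤ _ := by gcongr
  have fin : ∀ q : ℕ × ℕ, T q ≤ ENNReal.ofReal c' * (ENNReal.ofReal (z⁻¹ ^ (Nat.dist q.1 q.2)) * ENNReal.ofReal (g q.2) +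
      ENNReal.ofReal (z⁻¹ ^ (Nat.dist q.2 q.1)) * ENNReal.ofReal (g q.1)) := by
    rintro ⟨j, l⟩
    have hA : 0 ≤ A1 * B0 := by positivity
    have hB : 0 ≤ A0 * B1 := by positivity
    rcases le_total l j with h | h
    · refine le_trans ?_ (mul_le_mul' le_rfl le_self_add)
      refine (hT1 j l h).trans ?_
      rw [← ENNReal.ofReal_mul (pa j), ENNReal.ofReal_rpow_of_nonneg (mul_nonneg (pa j) (pb l)) hr.le,
        ← ENNReal.ofReal_mul (by positivity), ← ENNReal.ofReal_mul (by positivity), ← ENNReal.ofReal_mul hc'0.le]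
      refine ENNReal.ofReal_le_ofReal (main j l _ h (mul_nonneg (pa j) (pb l)) ?_ ?_ ?_)
      · calc _ = (((2:ℝ) ^ j) ^ s * a j) * b l := by ring
          _ ≤ (C1 * A1) * (C2 * B0) := mul_le_mul (a1 j) (b0 l) (pb l) (by positivity)
          _ = C1 * C2 * (A1 * B0) := by ring
          _ ≤ _ := by gcongr; linarith
      · calc _ ≤ (C1 * A0) * (C2 * B0) := mul_le_mul (a0 j) (b0 l) (pb l) (by positivity)
          _ = _ := by ring
      · calc _ = (((2:ℝ) ^ j) ^ s * a j) * (((2:ℝ) ^ l) ^ s * b l) := by ring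
          _ ≤ (C1 * A1) * (C2 * B1) := mul_le_mul (a1 j) (b1 l) (mul_nonneg (hx l).le (pb l)) (by positivity)
          _ = _ := by ring
    · refine le_trans ?_ (mul_le_mul' le_rfl le_add_self)
      refine (hT2 l j h).trans ?_
      rw [← ENNReal.ofReal_mul (pa j), ENNReal.ofReal_rpow_of_nonneg (mul_nonneg (pa j) (pb l)) hr.le,
        ← ENNReal.ofReal_mul (by positivity), ← ENNReal.ofReal_mul (by positivity), ← ENNReal.ofReal_mul hc'0.le]
      refine ENNReal.ofReal_le_ofReal (main l j _ h (mul_nonneg (pa j) (pb l)) ?_ ?_ ?_)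
      · calc _ = a j * (((2:ℝ) ^ l) ^ s * b l) := by ring
          _ ≤ (C1 * A0) * (C2 * B1) := mul_le_mul (a0 j) (b1 l) (mul_nonneg (hx l).le (pb l)) (by positivity)
          _ = C1 * C2 * (A0 * B1) := by ring
          _ ≤ _ := by gcongr; linarith
      · calc _ ≤ (C1 * A0) * (C2 * B0) := mul_le_mul (a0 j) (b0 l) (pb l) (by positivity)
          _ = _ := by ring
      · calc _ = (((2:ℝ) ^ j) ^ s * a j) * (((2:ℝ) ^ l) ^ s * b l) := by ring
          _ ≤ (C1 * A1) * (C2 * B1) := mul_le_mul (a1 j) (b1 l) (mul_nonneg (hx l).le (pb l)) (by positivity)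
          _ = _ := by ring
  have hsum : ∑' q : ℕ × ℕ, ENNReal.ofReal (z⁻¹ ^ (Nat.dist q.2 q.1)) * ENNReal.ofReal (g q.1) ≤
      ENNReal.ofReal (S * (z * S)) := by
    rw [ENNReal.tsum_prod (f := fun j l => ENNReal.ofReal (z⁻¹ ^ (Nat.dist l j)) * ENNReal.ofReal (g j))]
    simp_rw [ENNReal.tsum_mul_right]
    calc _ ≤ ∑' j, ENNReal.ofReal S * ENNReal.ofReal (g j) :=
          ENNReal.tsum_le_tsum fun j => mul_le_mul' (sum_dist (by positivity) hzi j) le_rfl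
      _ ≤ _ := by
        rw [ENNReal.tsum_mul_left, ENNReal.ofReal_mul hS0.le]
        exact mul_le_mul' le_rfl (sum_min hz1 (by positivity))
  have hsum2 : ∑' q : ℕ × ℕ, ENNReal.ofReal (z⁻¹ ^ (Nat.dist q.1 q.2)) * ENNReal.ofReal (g q.2) ≤
      ENNReal.ofReal (S * (z * S)) := by
    rw [← (Equiv.prodComm ℕ ℕ).tsum_eq]
    exact hsum
  refine (ENNReal.tsum_le_tsum fin).trans ?_
  rw [ENNReal.tsum_mul_left, ENNReal.tsum_add]
  calc _ ≤ ENNReal.ofReal c' * (ENNReal.ofReal (S * (z * S)) + ENNReal.ofReal (S * (z * S))) := by gcongr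
    _ = _ := by
      rw [← ENNReal.ofReal_add (by positivity) (by positivity), ← ENNReal.ofReal_mul pA1.le, ← ENNReal.ofReal_mul pA0.le,
        ← ENNReal.ofReal_add (by positivity) (by positivity), ENNReal.ofReal_rpow_of_nonneg hM0.le hr.le,
        ← ENNReal.ofReal_mul hc'0.le, ← ENNReal.ofReal_mul (by positivity), hc', Real.mul_rpow (by positivity) hM0.le]
      congr 1
      ring
end KP
namespace KP
variable {m k : ℕ}

/-- symbol of the remainder -/
def sy (s : ℝ) (p : (Eu m × Eu k) × (Eu m × Eu k)) : ℂ := jc s (p.1 + p.2) - jc s p.1 - jc s p.2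

lemma RR_int {s : ℝ} (hs : 0 ≤ s) {u w : Eu m × Eu k → ℂ} (hu : Gd s u) (hw : Gd s w) (x : Eu m × Eu k) :
    Integrable (fun p : (Eu m × Eu k) × (Eu m × Eu k) => sy s p * (u p.1 * w p.2) * ee x (p.1 + p.2)) ∧
    RR s u w x = ∫ p, sy s p * (u p.1 * w p.2) * ee x (p.1 + p.2) := by
  have hζ : Measurable (fun p : (Eu m × Eu k) × (Eu m × Eu k) => p.1 + p.2) := by fun_prop
  have j1 : Integrable (fun p : (Eu m × Eu k) × (Eu m × Eu k) => (jc s p.1 * u p.1) * w p.2) := hu.i1.mul_prod hw.i0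
  have j2 : Integrable (fun p : (Eu m × Eu k) × (Eu m × Eu k) => u p.1 * (jc s p.2 * w p.2)) := hu.i0.mul_prod hw.i1
  have i0 := integrable_mul_ee (μ := (volume : Measure ((Eu m × Eu k) × (Eu m × Eu k)))) (TT_int hs hu hw) hζ x
  have i1 := integrable_mul_ee (μ := (volume : Measure ((Eu m × Eu k) × (Eu m × Eu k)))) j1 hζ x
  have i2 := integrable_mul_ee (μ := (volume : Measure ((Eu m × Eu k) × (Eu m × Eu k)))) j2 hζ x
  have e : (fun p : (Eu m × Eu k) × (Eu m × Eu k) => sy s p * (u p.1 * w p.2) * ee x (p.1 + p.2)) =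
    fun p => (jc s (p.1 + p.2) * (u p.1 * w p.2) * ee x (p.1 + p.2) - jc s p.1 * u p.1 * w p.2 * ee x (p.1 + p.2))
      - u p.1 * (jc s p.2 * w p.2) * ee x (p.1 + p.2) := by
    ext p; simp only [sy]; ring
  rw [e]
  refine ⟨(i0.sub i1).sub i2, ?_⟩
  have e2 := integral_sub (i0.sub i1) i2
  have e3 := integral_sub i0 i1
  simp only [Pi.sub_apply] at e2
  rw [e2, e3, RR, mul_comm (IF w x), IF_mul, IF_mul, TT]

lemma RR_sum {s : ℝ} (hs : 0 ≤ s) {u w : Eu m × Eu k → ℂ} (hu : Gd s u) (hw : Gd s w) (x : Eu m × Eu k) :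
    ‖RR s u w x‖ₑ ≤ ∑' q : ℕ × ℕ, ‖RR s (pv q.1 u) (pv q.2 w) x‖ₑ := by
  obtain ⟨hi, he⟩ := RR_int hs hu hw x
  set G : (Eu m × Eu k) × (Eu m × Eu k) → ℂ := fun p => sy s p * (u p.1 * w p.2) * ee x (p.1 + p.2) with hG
  have hJ : ∀ J : ℕ, ∑ j ∈ Finset.range (J + 1), ∑ l ∈ Finset.range (J + 1), RR s (pv j u) (pv l w) x =
      ∫ p, ((chi (((2:ℝ) ^ J)⁻¹ • p.1) * chi (((2:ℝ) ^ J)⁻¹ • p.2) : ℝ) : ℂ) * G p := by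
    intro J
    have e1 : ∀ j l, RR s (pv j u) (pv l w) x = ∫ p, sy s p * (pv j u p.1 * pv l w p.2) * ee x (p.1 + p.2) :=
      fun j l => (RR_int hs (hu.psi j) (hw.psi l) x).2
    simp_rw [e1]
    have e2 : ∀ j, ∑ l ∈ Finset.range (J + 1), ∫ p, sy s p * (pv j u p.1 * pv l w p.2) * ee x (p.1 + p.2) =
        ∫ p, ∑ l ∈ Finset.range (J + 1), sy s p * (pv j u p.1 * pv l w p.2) * ee x (p.1 + p.2) := fun j =>
      (integral_finset_sum _ fun l _ => (RR_int hs (hu.psi j) (hw.psi l) x).1).symm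
    simp_rw [e2]
    rw [← integral_finset_sum _ fun j _ => integrable_finset_sum _ fun l _ => (RR_int hs (hu.psi j) (hw.psi l) x).1]
    congr 1; ext p
    rw [← sum_psi, ← sum_psi, Finset.sum_mul_sum, Complex.ofReal_sum, Finset.sum_mul]
    refine Finset.sum_congr rfl fun j _ => ?_
    rw [Complex.ofReal_sum, Finset.sum_mul]
    refine Finset.sum_congr rfl fun l _ => ?_
    simp only [pv, hG]; push_cast; ring
  have hlim : Filter.Tendsto (fun J : ℕ => ∑ j ∈ Finset.range (J + 1), ∑ l ∈ Finset.range (J + 1),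
      RR s (pv j u) (pv l w) x) Filter.atTop (nhds (RR s u w x)) := by
    simp_rw [hJ]
    rw [he]
    refine tendsto_integral_of_dominated_convergence (fun p => ‖G p‖) (fun J => ?_) hi.norm (fun J => ?_) ?_
    · have := continuous_chi (m := m) (k := k)
      exact (Continuous.aestronglyMeasurable (by fun_prop)).mul hi.aestronglyMeasurable
    · refine Filter.Eventually.of_forall fun p => ?_
      rw [norm_mul, Complex.norm_real, Real.norm_of_nonneg (mul_nonneg (chi_nonneg _) (chi_nonneg _))]
      exact mul_le_of_le_one_left (norm_nonneg _) (mul_le_one₀ (chi_le _) (chi_nonneg _) (chi_le _))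
    · refine Filter.Eventually.of_forall fun p => ?_
      refine tendsto_const_nhds.congr' ?_
      have h2 := (tendsto_pow_atTop_atTop_of_one_lt (one_lt_two (α := ℝ))).eventually_ge_atTop (max ‖p.1‖ ‖p.2‖)
      filter_upwards [h2] with J hJ
      have h0 : (0:ℝ) < 2 ^ J := by positivity
      rw [chi_one' (by positivity), chi_one' (by positivity)]
      · simp [hG]
      · rw [inv_mul_le_iff₀ h0, mul_one]; exact (le_max_right _ _).trans hJ
      · rw [inv_mul_le_iff₀ h0, mul_one]; exact (le_max_left _ _).trans hJ
  refine le_of_tendsto hlim.enorm (Filter.Eventually.of_forall fun J => ?_)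
  rw [← Finset.sum_product']
  exact (enorm_sum_le _ _).trans (ENNReal.sum_le_tsum _)

lemma core {r s : ℝ} (hr : 0 < r) (hr1 : r ≤ 1) (hs0 : 0 < s)
    (hs : ((m + k : ℕ) : ℝ) * (1 - r) < s * r ∨ ∃ a : ℕ, s = 2 * a)
    {N N1 N2 : (Eu m × Eu k → ℝ≥0∞) → ℝ≥0∞} (hN : LN r N) (hN1 : LN 1 N1) (hN2 : LN 1 N2)
    (hH : ∀ F G : Eu m × Eu k → ℝ≥0∞, Measurable F → Measurable G → N (fun x => F x * G x) ≤ N1 F * N2 G) :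
    ∃ C : ℝ, 0 < C ∧ ∀ (u w : Eu m × Eu k → ℂ), Gd s u → Gd s w →
      N (fun x => ‖TT s u w x‖ₑ) ≤ ENNReal.ofReal C *
        (N1 (fun x => ‖IF (fun ξ => jc s ξ * u ξ) x‖ₑ) * N2 (fun x => ‖IF w x‖ₑ) +
          N1 (fun x => ‖IF u x‖ₑ) * N2 (fun x => ‖IF (fun ξ => jc s ξ * w ξ) x‖ₑ)) := by
  obtain ⟨c1, hc1, hR1⟩ := est_R hr hr1 hs0 hs hN hN1 hN2 hH
  obtain ⟨c2, hc2, hR2⟩ := est_R hr hr1 hs0 hs hN hN2 hN1 (fun F G hF hG => by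
    rw [mul_comm]; simp_rw [mul_comm (F _)]; exact hH G F hG hF)
  obtain ⟨d1, hd1, ha0⟩ := est_i hN1
  obtain ⟨d2, hd2, ha1⟩ := est_ii hN1 s
  obtain ⟨d3, hd3, hb0⟩ := est_i hN2
  obtain ⟨d4, hd4, hb1⟩ := est_ii hN2 s
  obtain ⟨C, hC, hsum⟩ := sum_main (s := s) (ε := min s 1) (r := r) (c := c1 + c2) (C1 := d1 + d2) (C2 := d3 + d4)
    hs0 (lt_min hs0 one_pos) (min_le_left _ _) hr (by positivity) (by positivity) (by positivity)
  refine ⟨(C + 2) ^ (1 / r), by positivity, fun u w hu hw => ?_⟩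
  set A0 := N1 (fun x => ‖IF u x‖ₑ) with hA0
  set A1 := N1 (fun x => ‖IF (fun ξ => jc s ξ * u ξ) x‖ₑ) with hA1
  set B0 := N2 (fun x => ‖IF w x‖ₑ) with hB0
  set B1 := N2 (fun x => ‖IF (fun ξ => jc s ξ * w ξ) x‖ₑ) with hB1
  have cu := continuous_IF hu.i0
  have cw := continuous_IF hw.i0
  have cu1 := continuous_IF hu.i1
  have cw1 := continuous_IF hw.i1
  have cT := TT_cont hs0.le hu hw
  have cR : ∀ j l, Continuous (RR s (pv j u) (pv l w)) := by
    intro j l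
    have cu := continuous_IF (hu.psi j).i0
    have cw := continuous_IF (hw.psi l).i0
    have cu1 := continuous_IF (hu.psi j).i1
    have cw1 := continuous_IF (hw.psi l).i1
    have cT := TT_cont hs0.le (hu.psi j) (hw.psi l)
    have : RR s (pv j u) (pv l w) = fun x => TT s (pv j u) (pv l w) x -
      IF (pv l w) x * IF (fun ξ => jc s ξ * pv j u ξ) x - IF (pv j u) x * IF (fun ξ => jc s ξ * pv l w ξ) x := by
        ext x; rfl
    rw [this]; fun_prop
  have hR : N (fun x => ‖RR s u w x‖ₑ) ^ r ≤ ENNReal.ofReal C * (A1 * B0 + A0 * B1) ^ r := by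
    refine (hN.tsum hr (H := fun (q : ℕ × ℕ) x => ‖RR s (pv q.1 u) (pv q.2 w) x‖ₑ)
      (fun q => (cR q.1 q.2).measurable.enorm) (fun x =>
        (ENNReal.rpow_le_rpow (RR_sum hs0.le hu hw x) hr.le).trans (rpow_tsum_le hr hr1 _))).trans ?_
    refine hsum A0 A1 B0 B1 (fun j => N1 (fun x => ‖IF (pv j u) x‖ₑ)) (fun l => N2 (fun x => ‖IF (pv l w) x‖ₑ)) _
      (fun j => (ha0 j u hu.i0).trans ?_) (fun j => (ha1 j u hu.i1).trans ?_)
      (fun j => (hb0 j w hw.i0).trans ?_) (fun j => (hb1 j w hw.i1).trans ?_) (fun j l h => (hR1 j l u w h hu hw).trans ?_)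
      (fun j l h => ?_)
    · exact mul_le_mul' (ENNReal.ofReal_le_ofReal (by linarith)) le_rfl
    · exact mul_le_mul' (ENNReal.ofReal_le_ofReal (by gcongr; linarith)) le_rfl
    · exact mul_le_mul' (ENNReal.ofReal_le_ofReal (by linarith)) le_rfl
    · exact mul_le_mul' (ENNReal.ofReal_le_ofReal (by gcongr; linarith)) le_rfl
    · exact mul_le_mul' (ENNReal.ofReal_le_ofReal (by gcongr; linarith)) le_rfl
    · have := hR2 j l w u h hw hu
      simp_rw [RR_swap s (pv j w)] at this
      rw [mul_comm (N2 _)] at this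
      exact this.trans (mul_le_mul' (ENNReal.ofReal_le_ofReal (by gcongr; linarith)) le_rfl)
  have p1 : N (fun x => ‖IF w x * IF (fun ξ => jc s ξ * u ξ) x‖ₑ) ≤ A1 * B0 + A0 * B1 := by
    simp_rw [enorm_mul, mul_comm ‖IF w _‖ₑ]
    exact (hH _ _ (Continuous.measurable (by fun_prop)) (Continuous.measurable (by fun_prop))).trans le_self_add
  have p2 : N (fun x => ‖IF u x * IF (fun ξ => jc s ξ * w ξ) x‖ₑ) ≤ A1 * B0 + A0 * B1 := by
    simp_rw [enorm_mul]
    exact (hH _ _ (Continuous.measurable (by fun_prop)) (Continuous.measurable (by fun_prop))).trans le_add_self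
  have hRc : Continuous (RR s u w) := by
    have : RR s u w = fun x => TT s u w x -
      IF w x * IF (fun ξ => jc s ξ * u ξ) x - IF u x * IF (fun ξ => jc s ξ * w ξ) x := by
        ext x; rfl
    rw [this]; fun_prop
  have q1 := hN.add hr hr1 (u := TT s u w)
    (A := fun x => RR s u w x + IF w x * IF (fun ξ => jc s ξ * u ξ) x)
    (B := fun x => -(IF u x * IF (fun ξ => jc s ξ * w ξ) x)) (by fun_prop) (by fun_prop) (fun x => by
      simp only [RR]; ring)
  have q2 := hN.add hr hr1 (u := fun x => RR s u w x + IF w x * IF (fun ξ => jc s ξ * u ξ) x)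
    (A := RR s u w) (B := fun x => -(IF w x * IF (fun ξ => jc s ξ * u ξ) x)) (by fun_prop) (by fun_prop) (fun x => by
      ring)
  simp_rw [enorm_neg] at q1 q2
  have fin : N (fun x => ‖TT s u w x‖ₑ) ^ r ≤ ENNReal.ofReal (C + 2) * (A1 * B0 + A0 * B1) ^ r := by
    calc _ ≤ (ENNReal.ofReal C * (A1 * B0 + A0 * B1) ^ r + (A1 * B0 + A0 * B1) ^ r) + (A1 * B0 + A0 * B1) ^ r :=
        q1.trans (add_le_add (q2.trans (add_le_add hR (ENNReal.rpow_le_rpow p1 hr.le))) (ENNReal.rpow_le_rpow p2 hr.le))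
      _ = _ := by
        rw [ENNReal.ofReal_add hC.le (by norm_num), ENNReal.ofReal_ofNat]; ring
  rw [ENNReal.le_rpow_inv_iff hr |>.symm] at fin
  refine fin.trans (le_of_eq ?_)
  rw [ENNReal.mul_rpow_of_nonneg _ _ (by positivity), ENNReal.ofReal_rpow_of_pos (by positivity), ← one_div,
    ← ENNReal.rpow_mul, mul_one_div_cancel hr.ne', ENNReal.rpow_one]

lemma gd_schwartz (s : ℝ) (F : SchwartzMap (Eu m × Eu k) ℂ) (c : ℂ) : Gd s (fun ξ => c * F ξ) := by
  have hF : Integrable F := F.integrable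
  refine ⟨hF.const_mul c, ?_⟩
  obtain ⟨a, ha⟩ := exists_nat_ge (s / 2)
  have h1 := (F.integrable_pow_mul (volume : Measure (Eu m × Eu k)) (2 * a))
  have h2 := ((hF.norm.add h1).const_mul (‖c‖ * (2 ^ a * 2 ^ (a - 1))))
  refine h2.mono' ?_ (Filter.Eventually.of_forall fun ξ => ?_)
  · exact Continuous.aestronglyMeasurable (by have := F.continuous; fun_prop)
  · have hb1 : 1 ≤ jb ξ := by unfold jb; nlinarith [sq_nonneg ‖ξ.1‖, sq_nonneg ‖ξ.2‖]
    have hb2 : jb ξ ≤ 2 * (1 + ‖ξ‖ ^ 2) := by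
      unfold jb
      have h1 := norm_fst_le ξ
      have h2 := norm_snd_le ξ
      have h3 : ‖ξ.1‖ ^ 2 ≤ ‖ξ‖ ^ 2 := by gcongr
      have h4 : ‖ξ.2‖ ^ 2 ≤ ‖ξ‖ ^ 2 := by gcongr
      linarith
    have hb : jb ξ ^ (s / 2) ≤ 2 ^ a * 2 ^ (a - 1) * (1 + ‖ξ‖ ^ (2 * a)) := by
      calc jb ξ ^ (s / 2) ≤ jb ξ ^ (a : ℝ) := Real.rpow_le_rpow_of_exponent_le hb1 ha
        _ = jb ξ ^ a := Real.rpow_natCast _ _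
        _ ≤ (2 * (1 + ‖ξ‖ ^ 2)) ^ a := by gcongr
        _ = 2 ^ a * (1 + ‖ξ‖ ^ 2) ^ a := by rw [mul_pow]
        _ ≤ 2 ^ a * (2 ^ (a - 1) * (1 ^ a + (‖ξ‖ ^ 2) ^ a)) := by
          gcongr; exact add_pow_le (by norm_num) (by positivity) a
        _ = _ := by rw [one_pow, ← pow_mul]; ring
    rw [norm_mul, norm_mul, norm_jc]
    simp only [Pi.add_apply]
    calc _ ≤ (2 ^ a * 2 ^ (a - 1) * (1 + ‖ξ‖ ^ (2 * a))) * (‖c‖ * ‖F ξ‖) := by gcongr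
      _ = _ := by ring

/-- `J^s(fg)` as a bilinear multiplier -/
lemma Js2_mul {s : ℝ} (hs : 0 ≤ s) {f g v w : Eu m × Eu k → ℂ} (hf : Integrable f) (hv : Gd s v) (hw : Gd s w)
    (hvf : ∀ ξ, v ξ = (cn m k : ℂ) * FT2 f ξ) (hg : ∀ x, g x = IF w x) (x : Eu m × Eu k) :
    Js2 s (fun x => f x * g x) x = TT s v w x := by
  have hFT : ∀ ζ, (cn m k : ℂ) * FT2 (fun x => f x * g x) ζ = ∫ η, v (ζ - η) * w η := by
    intro ζ
    have hκ : Integrable (fun z => f (-z) * ee z ζ) := by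
      have h1 : Integrable (fun z => f (-z)) := hf.comp_neg
      have := integrable_mul_ee h1 measurable_id ζ
      refine this.congr (Filter.Eventually.of_forall fun z => ?_)
      simp only [id, ee_comm]
    have := conv_IF hw.i0 hκ 0
    have e1 : ∫ z, f (-z) * ee z ζ * IF w (0 - z) = FT2 (fun x => f x * g x) ζ := by
      rw [FT2_eq, ← integral_neg_eq_self]
      congr 1; ext z
      rw [hg, zero_sub, neg_neg]; ring
    have e2 : ∀ η, FT2 (fun z => f (-z) * ee z ζ) η = FT2 f (ζ - η) := by
      intro η
      rw [FT2_eq, FT2_eq, ← integral_neg_eq_self]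
      congr 1; ext z
      rw [sub_eq_add_neg, ee_add_right, ee_neg_right, neg_neg]; ring
    rw [e1] at this
    rw [this, IF, ← integral_const_mul]
    congr 1; ext η
    rw [e2, hvf, ee_comm, ee_zero_right]; ring
  have hζ : Measurable (fun p : (Eu m × Eu k) × (Eu m × Eu k) => p.1 + p.2) := by fun_prop
  have i0 := integrable_mul_ee (μ := (volume : Measure ((Eu m × Eu k) × (Eu m × Eu k)))) (TT_int hs hv hw) hζ x
  rw [Js2_eq, TT]
  have mp := measurePreserving_sub_prod (volume : Measure (Eu m × Eu k)) (volume : Measure (Eu m × Eu k))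
  rw [← Measure.volume_eq_prod] at mp
  have i1 := mp.integrable_comp_of_integrable i0
  have e0 : ∫ p : (Eu m × Eu k) × (Eu m × Eu k), jc s (p.1 + p.2) * (v p.1 * w p.2) * ee x (p.1 + p.2) =
    ∫ p : (Eu m × Eu k) × (Eu m × Eu k), jc s (p.1 - p.2 + p.2) * (v (p.1 - p.2) * w p.2) * ee x (p.1 - p.2 + p.2) := by
    have := integral_map mp.aemeasurable (f := fun p : (Eu m × Eu k) × (Eu m × Eu k) =>
      jc s (p.1 + p.2) * (v p.1 * w p.2) * ee x (p.1 + p.2)) (by rw [mp.map_eq]; exact i0.aestronglyMeasurable)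
    rw [mp.map_eq] at this
    exact this
  rw [e0]
  rw [Measure.volume_eq_prod] at i1 ⊢
  have e3 := integral_prod _ i1
  simp only [Function.comp_def] at e3
  rw [e3, IF]
  congr 1; ext ζ
  rw [hFT]
  simp only [sub_add_cancel, jc]
  rw [mul_right_comm, ← integral_const_mul]
  congr 1; ext η; ring

end KP
namespace KP
variable {m k : ℕ}

lemma schwartz_data (f : SchwartzMap (Eu m × Eu k) ℂ) :
    ∃ v : Eu m × Eu k → ℂ, (∀ s, Gd s v) ∧ (∀ ξ, v ξ = (cn m k : ℂ) * FT2 f ξ) ∧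
      (∀ x, f x = IF v x) ∧ ∀ s x, Js2 s f x = IF (fun ξ => jc s ξ * v ξ) x := by
  obtain ⟨F, h1, h2⟩ := schwartz_FT f
  refine ⟨fun ξ => (cn m k : ℂ) * F ξ, fun s => gd_schwartz s F _, fun ξ => by simp only [h1], fun x => ?_, fun s x => ?_⟩
  · rw [h2, IF, IF, ← integral_const_mul]
    congr 1; ext ξ; ring
  · rw [Js2_eq]; simp only [h1, jc]

lemma jc_zero (ξ : Eu m × Eu k) : jc 0 ξ = 1 := by simp [jc]

end KP
/-- **The weighted mixed-norm Kato–Ponce inequality** (Theorem 1.4). -/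
theorem weighted_mixed_kato_ponce (m k : ℕ) (hm : 1 ≤ m) (hk : 1 ≤ k)
    (pd pdd pd₁ pdd₁ pd₂ pdd₂ : ℝ≥0∞) (ad add ad₁ add₁ ad₂ add₂ s : ℝ)
    (hpd : 2⁻¹ ≤ pd) (hpdd : 2⁻¹ ≤ pdd)
    (hpd1 : 1 ≤ pd₁) (hpdd1 : 1 ≤ pdd₁) (hpd2 : 1 ≤ pd₂) (hpdd2 : 1 ≤ pdd₂)
    (had : 0 ≤ ad) (hadd : 0 ≤ add) (had1 : 0 ≤ ad₁) (hadd1 : 0 ≤ add₁)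
    (had2 : 0 ≤ ad₂) (hadd2 : 0 ≤ add₂)
    (hexpd : 1 / pd = 1 / pd₁ + 1 / pd₂)
    (hexpdd : 1 / pdd = 1 / pdd₁ + 1 / pdd₂)
    (hwexpd : ENNReal.ofReal ad / pd = ENNReal.ofReal ad₁ / pd₁ + ENNReal.ofReal ad₂ / pd₂)
    (hwexpdd : ENNReal.ofReal add / pdd =
      ENNReal.ofReal add₁ / pdd₁ + ENNReal.ofReal add₂ / pdd₂)
    (hs : max 0 (((m : ℝ) + (k : ℝ)) * (1 / (min 1 (min pd pdd)).toReal - 1)) < s ∨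
      ∃ j : ℕ, s = 2 * j) :
    ∃ C : ℝ, 0 < C ∧ ∀ f g : SchwartzMap (Eu m × Eu k) ℂ,
      mixedNorm pdd add pd ad (Js2 s (fun x => f x * g x)) ≤
        ENNReal.ofReal C *
          (mixedNorm pdd₁ add₁ pd₁ ad₁ (Js2 s ⇑f) * mixedNorm pdd₂ add₂ pd₂ ad₂ ⇑g +
            mixedNorm pdd₁ add₁ pd₁ ad₁ ⇑f * mixedNorm pdd₂ add₂ pd₂ ad₂ (Js2 s ⇑g)) := by
  have h2 : (0 : ℝ≥0∞) < 2⁻¹ := by simp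
  have hpd0 : pd ≠ 0 := (h2.trans_le hpd).ne'
  have hpdd0 : pdd ≠ 0 := (h2.trans_le hpdd).ne'
  set P : ℝ≥0∞ := min 1 (min pd pdd) with hP
  have hP1 : P ≤ 1 := min_le_left _ _
  have hPt : P ≠ ∞ := (hP1.trans_lt ENNReal.one_lt_top).ne
  have hP0 : P ≠ 0 := (lt_min one_pos (lt_min (pos_iff_ne_zero.2 hpd0) (pos_iff_ne_zero.2 hpdd0))).ne'
  have hr : 0 < P.toReal := ENNReal.toReal_pos hP0 hPt
  have hr1 : P.toReal ≤ 1 := by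
    have := ENNReal.toReal_mono ENNReal.one_ne_top hP1
    simpa using this
  have hof : ENNReal.ofReal P.toReal = P := ENNReal.ofReal_toReal hPt
  have hN : KP.LN P.toReal (KP.NN (m := m) (k := k) pdd add pd ad) :=
    KP.NN_LN hr (by rw [hof]; exact (min_le_right _ _).trans (min_le_right _ _))
      (by rw [hof]; exact (min_le_right _ _).trans (min_le_left _ _)) hadd had
  have hN1 : KP.LN 1 (KP.NN (m := m) (k := k) pdd₁ add₁ pd₁ ad₁) :=
    KP.NN_LN one_pos (by simpa using hpdd1) (by simpa using hpd1) hadd1 had1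
  have hN2 : KP.LN 1 (KP.NN (m := m) (k := k) pdd₂ add₂ pd₂ ad₂) :=
    KP.NN_LN one_pos (by simpa using hpdd2) (by simpa using hpd2) hadd2 had2
  have hH : ∀ F G : Eu m × Eu k → ℝ≥0∞, Measurable F → Measurable G →
      KP.NN pdd add pd ad (fun x => F x * G x) ≤ KP.NN pdd₁ add₁ pd₁ ad₁ F * KP.NN pdd₂ add₂ pd₂ ad₂ G :=
    fun F G hF hG => KP.NN_holder hpdd0 hpd0 hpdd1 hpdd2 hpd1 hpd2 hadd hadd1 hadd2 had had1 had2
      hexpdd hexpd hwexpdd hwexpd hF hG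
  have hs' : s = 0 ∨ (0 < s ∧ (((m + k : ℕ) : ℝ) * (1 - P.toReal) < s * P.toReal ∨ ∃ a : ℕ, s = 2 * a)) := by
    rcases hs with hs | ⟨j, hj⟩
    · right
      obtain ⟨h0, h1⟩ := max_lt_iff.1 hs
      refine ⟨h0, Or.inl ?_⟩
      have h3 := mul_lt_mul_of_pos_right h1 hr
      have h4 : ((m:ℝ) + k) * (1 / P.toReal - 1) * P.toReal = ((m:ℝ) + k) * (1 - P.toReal) := by
        field_simp
      rw [h4] at h3
      push_cast; exact h3
    · rcases Nat.eq_zero_or_pos j with h | h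
      · left; rw [hj, h]; simp
      · right
        refine ⟨?_, Or.inr ⟨j, hj⟩⟩
        rw [hj]; positivity
  rcases hs' with rfl | ⟨hs0, hs1⟩
  · refine ⟨1, one_pos, fun f g => ?_⟩
    obtain ⟨v, hv, hvf, hvi, hvj⟩ := KP.schwartz_data f
    obtain ⟨w, hw, hwf, hwi, hwj⟩ := KP.schwartz_data g
    have e1 : Js2 0 (⇑f) = ⇑f := by
      funext x; rw [hvj, hvi]; simp only [KP.jc_zero, one_mul]
    have e3 : Js2 0 (fun x => f x * g x) = fun x => f x * g x := by
      funext x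
      rw [KP.Js2_mul le_rfl f.integrable (hv 0) (hw 0) hvf hwi, KP.TT, hvi, hwi, KP.IF_mul]
      simp only [KP.jc_zero, one_mul]
    rw [e1, e3]
    simp only [KP.mixedNorm_eq, enorm_mul, ENNReal.ofReal_one, one_mul]
    exact (hH _ _ f.continuous.enorm.measurable g.continuous.enorm.measurable).trans le_self_add
  · obtain ⟨C, hC, h⟩ := KP.core hr hr1 hs0 hs1 hN hN1 hN2 hH
    refine ⟨C, hC, fun f g => ?_⟩
    obtain ⟨v, hv, hvf, hvi, hvj⟩ := KP.schwartz_data f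
    obtain ⟨w, hw, hwf, hwi, hwj⟩ := KP.schwartz_data g
    have := h v w (hv s) (hw s)
    have e3 : ∀ x, Js2 s (fun x => f x * g x) x = KP.TT s v w x :=
      fun x => KP.Js2_mul hs0.le f.integrable (hv s) (hw s) hvf hwi x
    have d1 : Js2 s (fun x => f x * g x) = KP.TT s v w := funext e3
    have d2 : Js2 s (⇑f) = KP.IF (fun ξ => KP.jc s ξ * v ξ) := funext (hvj s)
    have d3 : Js2 s (⇑g) = KP.IF (fun ξ => KP.jc s ξ * w ξ) := funext (hwj s)
    have d4 : (⇑f : Eu m × Eu k → ℂ) = KP.IF v := funext hvi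
    have d5 : (⇑g : Eu m × Eu k → ℂ) = KP.IF w := funext hwi
    rw [d1, d2, d3, d4, d5]
    rw [KP.mixedNorm_eq, KP.mixedNorm_eq, KP.mixedNorm_eq, KP.mixedNorm_eq, KP.mixedNorm_eq]
    exact this
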